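/- Let l ≥ 3 be an odd integer, q ∈ ℂ a primitive l-th root of unity, m an integer with m ≢ 0, 1, −1 (mod l), k an integer with 2k ≡ m (mod l), and n ≥ 2. Let B_n be the quotient of the level-two cyclotomic Khovanov–Lauda–Rouquier algebra R_n by the two-sided ideal generated by all e(i) with (i_1, i_2) ≡ (k, k−1) or (−k, −k−1) (mod l), with its induced ℤ-grading (this quotient is isomorphic to the blob algebra b_n(m)). Then B_n is a graded cellular algebra with respect to the poset (bi(n), ⪰) of one-line bipartitions of n and index sets T(λ) = Std(λ): that is, there exist homogeneous elements {ψ_{st} : λ ∈ bi(n), s, t ∈ Std(λ)} forming a graded cellular basis of B_n with deg ψ_{st} = deg s + deg t for some degree function deg : Std(n) → ℤ. -/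

import Mathlib

noncomputable section

namespace Statement1

/-- Residue sequences of length `n` with values in `ℤ/lℤ`. -/
abbrev Res (l n : ℕ) := Fin n → ZMod l

/-- Generators of the Khovanov–Lauda–Rouquier algebra. -/
inductive KLRGen (l n : ℕ) : Type
  | e : Res l n → KLRGen l n
  | y : Fin n → KLRGen l n
  | psi : Fin (n - 1) → KLRGen l n

/-- The generator `e(i)` in the free algebra. -/
def eG (l n : ℕ) (i : Res l n) : FreeAlgebra ℂ (KLRGen l n) :=
  FreeAlgebra.ι ℂ (KLRGen.e i)

/-- The generator `y_r` in the free algebra. -/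
def yG (l n : ℕ) (r : Fin n) : FreeAlgebra ℂ (KLRGen l n) :=
  FreeAlgebra.ι ℂ (KLRGen.y r)

/-- The generator `ψ_r` in the free algebra. -/
def pG (l n : ℕ) (r : Fin (n - 1)) : FreeAlgebra ℂ (KLRGen l n) :=
  FreeAlgebra.ι ℂ (KLRGen.psi r)

/-- The position `r` as an element of `Fin n`. -/
def lo {n : ℕ} (r : Fin (n - 1)) : Fin n := ⟨r.val, by have := r.2; omega⟩

/-- The position `r + 1` as an element of `Fin n`. -/
def hi {n : ℕ} (r : Fin (n - 1)) : Fin n := ⟨r.val + 1, by have := r.2; omega⟩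

/-- The defining relations of the cyclotomic KLR algebra, where `Lam ⊆ ℤ/lℤ` is the set of
residues allowed at the first position (the multiset of cyclotomic parameters). -/
inductive KLRRel (l n : ℕ) [NeZero l] (Lam : Set (ZMod l)) :
    FreeAlgebra ℂ (KLRGen l n) → FreeAlgebra ℂ (KLRGen l n) → Prop
  | cyc1 (i : Res l n) (r : Fin n) (hr : r.val = 0) (h : i r ∉ Lam) :
      KLRRel l n Lam (eG l n i) 0
  | cyc2 (i : Res l n) (r : Fin n) (hr : r.val = 0) (h : i r ∈ Lam) :
      KLRRel l n Lam (yG l n r * eG l n i) 0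
  | orth (i j : Res l n) (h : i ≠ j) : KLRRel l n Lam (eG l n i * eG l n j) 0
  | idem (i : Res l n) : KLRRel l n Lam (eG l n i * eG l n i) (eG l n i)
  | sum1 : KLRRel l n Lam (∑ i : Res l n, eG l n i) 1
  | ye (r : Fin n) (i : Res l n) :
      KLRRel l n Lam (yG l n r * eG l n i) (eG l n i * yG l n r)
  | psie (r : Fin (n - 1)) (i : Res l n) :
      KLRRel l n Lam (pG l n r * eG l n i) (eG l n (i ∘ Equiv.swap (lo r) (hi r)) * pG l n r)
  | yy (r s : Fin n) : KLRRel l n Lam (yG l n r * yG l n s) (yG l n s * yG l n r)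
  | psiy (r : Fin (n - 1)) (s : Fin n) (h1 : s.val ≠ r.val) (h2 : s.val ≠ r.val + 1) :
      KLRRel l n Lam (pG l n r * yG l n s) (yG l n s * pG l n r)
  | pp (r s : Fin (n - 1)) (h : r.val + 1 < s.val ∨ s.val + 1 < r.val) :
      KLRRel l n Lam (pG l n r * pG l n s) (pG l n s * pG l n r)
  | py (r : Fin (n - 1)) (i : Res l n) :
      KLRRel l n Lam (pG l n r * (yG l n (hi r) * eG l n i))
        ((yG l n (lo r) * pG l n r + if i (lo r) = i (hi r) then 1 else 0) * eG l n i)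
  | yp (r : Fin (n - 1)) (i : Res l n) :
      KLRRel l n Lam (yG l n (hi r) * (pG l n r * eG l n i))
        ((pG l n r * yG l n (lo r) + if i (lo r) = i (hi r) then 1 else 0) * eG l n i)
  | psisq (r : Fin (n - 1)) (i : Res l n) :
      KLRRel l n Lam (pG l n r * pG l n r * eG l n i)
        ((if i (hi r) = i (lo r) then 0
          else if i (hi r) = i (lo r) + 1 then yG l n (hi r) - yG l n (lo r)
          else if i (hi r) = i (lo r) - 1 then yG l n (lo r) - yG l n (hi r)
          else 1) * eG l n i)
  | braid (r s : Fin (n - 1)) (h : s.val = r.val + 1) (i : Res l n) :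
      KLRRel l n Lam (pG l n r * pG l n s * pG l n r * eG l n i)
        ((pG l n s * pG l n r * pG l n s +
          (if i (hi s) = i (lo r) ∧ i (lo s) = i (lo r) + 1 then 1
           else if i (hi s) = i (lo r) ∧ i (lo s) = i (lo r) - 1 then -1
           else 0)) * eG l n i)

/-- The cyclotomic KLR algebra with cyclotomic residue set `Lam`. -/
abbrev KLR (l n : ℕ) [NeZero l] (Lam : Set (ZMod l)) := RingQuot (KLRRel l n Lam)

/-- The relation identifying the chosen KLR idempotents `e(i)`, `i ∈ bad`, with `0`;
quotienting by it is the same as quotienting by the two-sided ideal they generate. -/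
def quotRel (l n : ℕ) [NeZero l] (Lam : Set (ZMod l)) (bad : Set (Res l n)) :
    KLR l n Lam → KLR l n Lam → Prop := fun a b =>
  b = 0 ∧ ∃ i ∈ bad, a = RingQuot.mkAlgHom ℂ (KLRRel l n Lam) (eG l n i)

/-- The quotient of the cyclotomic KLR algebra by the two-sided ideal generated by the
idempotents `e(i)`, `i ∈ bad`. -/
abbrev BQuot (l n : ℕ) [NeZero l] (Lam : Set (ZMod l)) (bad : Set (Res l n)) :=
  RingQuot (quotRel l n Lam bad)

/-- The canonical map from the free algebra onto the quotient. -/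
def bmk (l n : ℕ) [NeZero l] (Lam : Set (ZMod l)) (bad : Set (Res l n)) :
    FreeAlgebra ℂ (KLRGen l n) →ₐ[ℂ] BQuot l n Lam bad :=
  (RingQuot.mkAlgHom ℂ (quotRel l n Lam bad)).comp (RingQuot.mkAlgHom ℂ (KLRRel l n Lam))

/-- The entries of the Cartan matrix of type `A_{l-1}^{(1)}`. -/
def cartan (l : ℕ) (i j : ZMod l) : ℤ :=
  if i = j then 2 else if j = i + 1 ∨ j = i - 1 then -1 else 0

/-- The level-two cyclotomic set `{k, -k} ⊆ ℤ/lℤ`. -/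
def Lam2 (l : ℕ) (k : ℤ) : Set (ZMod l) := {x | x = (k : ZMod l) ∨ x = -(k : ZMod l)}

/-- The residue sequences `i` with `(i₁, i₂) ≡ (k, k-1)` or `(i₁, i₂) ≡ (-k, -k-1) (mod l)`. -/
def badSet2 (l n : ℕ) (k : ℤ) (hn : 2 ≤ n) : Set (Res l n) :=
  {i | (i ⟨0, by omega⟩ = (k : ZMod l) ∧ i ⟨1, by omega⟩ = (k : ZMod l) - 1) ∨
    (i ⟨0, by omega⟩ = -(k : ZMod l) ∧ i ⟨1, by omega⟩ = -(k : ZMod l) - 1)}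

/-- One-line bipartitions of `n`: pairs `((a), (b))` with `a + b = n`. -/
abbrev Bi (n : ℕ) := {p : ℕ × ℕ // p.1 + p.2 = n}

/-- The statistic `f((a),(b)) = a - b`. -/
def fBi {n : ℕ} (lam : Bi n) : ℤ := (lam.1.1 : ℤ) - (lam.1.2 : ℤ)

/-- The order `⪰` on one-line bipartitions: `lam ⪰ mu` iff `|f lam| < |f mu|`, or
`|f lam| = |f mu|` and `f lam ≤ f mu`. -/
def biSucceq {n : ℕ} (lam mu : Bi n) : Prop :=
  |fBi lam| < |fBi mu| ∨ (|fBi lam| = |fBi mu| ∧ fBi lam ≤ fBi mu)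

/-- Standard `lam`-bitableaux, encoded by the set of entries lying in the first component
(`1, …, n` are 0-indexed as `Fin n`). -/
abbrev Std (n : ℕ) (lam : Bi n) := {S : Finset (Fin n) // S.card = lam.1.1}

set_option linter.unusedSectionVars false

section StrandGens

/-- Strand-wise generators: `p r a` is the idempotent selecting residue `a` on strand `r`. -/
structure Gens (A : Type*) (l : ℕ) where
  p : ℕ → ZMod l → A
  y : ℕ → A
  ψ : ℕ → A

variable {O A : Type*} [CommRing O] [Ring A] [Algebra O A] {l : ℕ} [NeZero l]

/-- The idempotent on which strands `r` and `r + 1` carry equal residues. -/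
def Gens.eqv (G : Gens A l) (r : ℕ) : A := ∑ a, G.p r a * G.p (r + 1) a

/-- The error term of the deformed braid relation. -/
def Gens.err (G : Gens A l) (r : ℕ) : A :=
  ∑ a, (G.p r a * G.p (r + 1) (a + 1) * G.p (r + 2) a -
    G.p r a * G.p (r + 1) (a - 1) * G.p (r + 2) a)

/-- The affine KLR relations on `n` strands, deformed by a parameter `x`. -/
structure Gens.IsKLR (G : Gens A l) (n : ℕ) (x : O) : Prop where
  p_idem (r a) : G.p r a * G.p r a = G.p r a
  p_orth (r) {a b} (h : a ≠ b) : G.p r a * G.p r b = 0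
  p_comm (r a s b) : G.p r a * G.p s b = G.p s b * G.p r a
  p_sum (r) (h : r < n) : ∑ a, G.p r a = 1
  p_out (r a) (h : n ≤ r) : G.p r a = 0
  y_out (r) (h : n ≤ r) : G.y r = 0
  ψ_out (r) (h : n ≤ r + 1) : G.ψ r = 0
  y_p (r s a) : G.y r * G.p s a = G.p s a * G.y r
  y_comm (r s) : G.y r * G.y s = G.y s * G.y r
  ψ_p_lo (r a) : G.ψ r * G.p r a = G.p (r + 1) a * G.ψ r
  ψ_p_hi (r a) : G.ψ r * G.p (r + 1) a = G.p r a * G.ψ r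
  ψ_p (r s a) (h1 : s ≠ r) (h2 : s ≠ r + 1) : G.ψ r * G.p s a = G.p s a * G.ψ r
  ψ_y (r s) (h1 : s ≠ r) (h2 : s ≠ r + 1) : G.ψ r * G.y s = G.y s * G.ψ r
  ψ_comm (r s) (h : r + 1 < s) : G.ψ r * G.ψ s = G.ψ s * G.ψ r
  ψ_y_hi (r) : G.ψ r * G.y (r + 1) = G.y r * G.ψ r + G.eqv r
  y_ψ_hi (r) : G.y (r + 1) * G.ψ r = G.ψ r * G.y r + G.eqv r
  sq_same (r a) : G.ψ r * G.ψ r * (G.p r a * G.p (r + 1) a) = 0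
  sq_up (r a) : G.ψ r * G.ψ r * (G.p r a * G.p (r + 1) (a + 1)) =
    (G.y (r + 1) - G.y r - algebraMap O A x) * (G.p r a * G.p (r + 1) (a + 1))
  sq_down (r a) : G.ψ r * G.ψ r * (G.p r a * G.p (r + 1) (a - 1)) =
    (G.y r - G.y (r + 1) - algebraMap O A x) * (G.p r a * G.p (r + 1) (a - 1))
  sq_far (r a b) (h : b ≠ a) (h1 : b ≠ a + 1) (h2 : b ≠ a - 1) :
    G.ψ r * G.ψ r * (G.p r a * G.p (r + 1) b) = G.p r a * G.p (r + 1) b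
  braid (r) : G.ψ r * G.ψ (r + 1) * G.ψ r = G.ψ (r + 1) * G.ψ r * G.ψ (r + 1) + G.err r

/-- `I` is stable under left multiplication by the generators on strands `≥ o`. -/
structure Gens.Stable (G : Gens A l) (o : ℕ) (I : Submodule O A) : Prop where
  p {r a v} (hr : o ≤ r) (hv : v ∈ I) : G.p r a * v ∈ I
  y {r v} (hr : o ≤ r) (hv : v ∈ I) : G.y r * v ∈ I
  ψ {r v} (hr : o ≤ r) (hv : v ∈ I) : G.ψ r * v ∈ I

lemma Gens.stable_bot (G : Gens A l) (o : ℕ) : G.Stable o (⊥ : Submodule O A) where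
  p _ hv := by simp_all
  y _ hv := by simp_all
  ψ _ hv := by simp_all

namespace Gens.IsKLR

variable {G : Gens A l} {n : ℕ} {x : O} (H : G.IsKLR n x)
include H

lemma p_other {r a b} {v : A} (hv : G.p r a * v = v) (h : b ≠ a) : G.p r b * v = 0 := by
  rw [← hv, ← mul_assoc, H.p_orth r h, zero_mul]

lemma p_eq_or {r a} {v : A} (hv : G.p r a * v = v) (b) :
    G.p r b * v = if b = a then v else 0 := by
  split_ifs with h
  · rw [h, hv]
  · exact H.p_other hv h

lemma sum_p_mul {r} (hr : r < n) (v : A) : ∑ a, G.p r a * v = v := by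
  rw [← Finset.sum_mul, H.p_sum r hr, one_mul]

lemma p_ψ_hi {r a} {v : A} (hv : G.p r a * v = v) :
    G.p (r + 1) a * (G.ψ r * v) = G.ψ r * v := by
  rw [← mul_assoc, ← H.ψ_p_lo, mul_assoc, hv]

lemma p_ψ_lo {r a} {v : A} (hv : G.p (r + 1) a * v = v) :
    G.p r a * (G.ψ r * v) = G.ψ r * v := by
  rw [← mul_assoc, ← H.ψ_p_hi, mul_assoc, hv]

lemma p_ψ {r s a} {v : A} (hv : G.p s a * v = v) (h1 : s ≠ r) (h2 : s ≠ r + 1) :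
    G.p s a * (G.ψ r * v) = G.ψ r * v := by
  rw [← mul_assoc, ← H.ψ_p _ _ _ h1 h2, mul_assoc, hv]

lemma p_y {r s a} {v : A} (hv : G.p s a * v = v) : G.p s a * (G.y r * v) = G.y r * v := by
  rw [← mul_assoc, ← H.y_p, mul_assoc, hv]

lemma p_p {r s a b} {v : A} (hv : G.p s a * v = v) :
    G.p s a * (G.p r b * v) = G.p r b * v := by
  rw [← mul_assoc, H.p_comm, mul_assoc, hv]

lemma p_self (r a) (v : A) : G.p r a * (G.p r a * v) = G.p r a * v := by
  rw [← mul_assoc, H.p_idem]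

omit H in
lemma _root_.Statement1.pp_absorb {u w v : A} (h1 : u * v = v) (h2 : w * v = v) :
    u * w * v = v := by
  rw [mul_assoc, h2, h1]

lemma eqv_same {r a} {v : A} (h1 : G.p r a * v = v) (h2 : G.p (r + 1) a * v = v) :
    G.eqv r * v = v := by
  rw [Gens.eqv, Finset.sum_mul, Finset.sum_eq_single a]
  · exact pp_absorb h1 h2
  · intro b _ hb
    rw [mul_assoc, H.p_other h2 hb, mul_zero]
  · simp

lemma eqv_ne {r a b} {v : A} (h1 : G.p r a * v = v) (h2 : G.p (r + 1) b * v = v) (hab : a ≠ b) :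
    G.eqv r * v = 0 := by
  rw [Gens.eqv, Finset.sum_mul, Finset.sum_eq_zero]
  intro c _
  rw [mul_assoc, H.p_eq_or h2]
  split_ifs with h
  · subst h; exact H.p_other h1 hab.symm
  · simp

lemma sq_same' {r a} {v : A} (h1 : G.p r a * v = v) (h2 : G.p (r + 1) a * v = v) :
    G.ψ r * (G.ψ r * v) = 0 := by
  have := congrArg (· * v) (H.sq_same r a)
  simp only [mul_assoc, h2, h1, zero_mul] at this
  exact this

lemma sq_up' {r a} {v : A} (h1 : G.p r a * v = v) (h2 : G.p (r + 1) (a + 1) * v = v) :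
    G.ψ r * (G.ψ r * v) = G.y (r + 1) * v - G.y r * v - x • v := by
  have := congrArg (· * v) (H.sq_up r a)
  simp only [mul_assoc, h2, h1, sub_mul, Algebra.smul_def] at this ⊢
  exact this

lemma sq_far' {r a b} {v : A} (h1 : G.p r a * v = v) (h2 : G.p (r + 1) b * v = v)
    (h : b ≠ a) (h3 : b ≠ a + 1) (h4 : b ≠ a - 1) : G.ψ r * (G.ψ r * v) = v := by
  have := congrArg (· * v) (H.sq_far r a b h h3 h4)
  simp only [mul_assoc, h2, h1] at this
  exact this

lemma err_mul {r a b} {v : A} (h1 : G.p r a * v = v) (h2 : G.p (r + 1) b * v = v)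
    (h3 : G.p (r + 2) a * v = v) :
    G.err r * v = (if b = a + 1 then v else 0) - (if b = a - 1 then v else 0) := by
  rw [Gens.err, Finset.sum_mul, Finset.sum_eq_single a]
  · simp only [sub_mul, mul_assoc, h3, H.p_eq_or h2, mul_ite, h1, mul_zero, eq_comm]
  · intro c _ hc
    simp only [sub_mul, mul_assoc, H.p_other h3 hc, mul_zero, sub_zero]
  · simp

lemma braid' (r) (v : A) : G.ψ r * (G.ψ (r + 1) * (G.ψ r * v)) =
    G.ψ (r + 1) * (G.ψ r * (G.ψ (r + 1) * v)) + G.err r * v := by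
  have := congrArg (· * v) (H.braid r)
  simpa only [mul_assoc, add_mul] using this

/-- A vector of residues `(a, a ± 1, a)` lies in any stable submodule containing its images
under the two crossings. -/
lemma mem_of_braid {o r a b} {v : A} {I : Submodule O A} (hI : G.Stable o I) (ho : o ≤ r)
    (h2 : (2 : ZMod l) ≠ 0) (hb : b = a + 1 ∨ b = a - 1)
    (w1 : G.p r a * v = v) (w2 : G.p (r + 1) b * v = v) (w3 : G.p (r + 2) a * v = v)
    (m1 : G.ψ r * v ∈ I) (m2 : G.ψ (r + 1) * v ∈ I) : v ∈ I := by
  have hE : G.err r * v ∈ I := by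
    have e := H.braid' r v
    rw [← sub_eq_iff_eq_add'] at e
    rw [← e]
    exact I.sub_mem (hI.ψ ho (hI.ψ (by omega) m1)) (hI.ψ (by omega) (hI.ψ ho m2))
  rw [H.err_mul w1 w2 w3] at hE
  have hne : a + 1 ≠ a - 1 := by
    intro h
    apply h2
    linear_combination h
  rcases hb with rfl | rfl
  · simpa [hne] using hE
  · simpa [hne.symm] using hE

/-- The nil-Hecke argument: if `y r` acts by a scalar on a `ψ r`-stable class of vectors with
equal residues on strands `r`, `r + 1`, the class vanishes. -/
lemma mem_of_nilHecke {o r a} {I : Submodule O A} (hI : G.Stable o I) (ho : o ≤ r) (h : O)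
    (W : A → Prop) (w1 : ∀ v, W v → G.p r a * v = v) (w2 : ∀ v, W v → G.p (r + 1) a * v = v)
    (wψ : ∀ v, W v → W (G.ψ r * v)) (wy : ∀ v, W v → G.y r * v - h • v ∈ I)
    (v : A) (hv : W v) : v ∈ I := by
  have key : ∀ u, W u → G.y (r + 1) * (G.ψ r * u) - h • (G.ψ r * u) - u ∈ I := by
    intro u hu
    have e : G.y (r + 1) * (G.ψ r * u) = G.ψ r * (G.y r * u) + u := by
      rw [← mul_assoc, H.y_ψ_hi, add_mul, H.eqv_same (w1 u hu) (w2 u hu), mul_assoc]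
    have := hI.ψ ho (wy u hu)
    rw [mul_sub, mul_smul_comm] at this
    rw [e]
    convert this using 1
    abel
  have h1 : G.ψ r * v ∈ I := by
    have := key _ (wψ v hv)
    rw [H.sq_same' (w1 v hv) (w2 v hv)] at this
    simpa using this
  have := key v hv
  have h3 : G.y (r + 1) * (G.ψ r * v) - h • (G.ψ r * v) ∈ I :=
    I.sub_mem (hI.y (by omega) h1) (I.smul_mem _ h1)
  have := I.sub_mem h3 this
  simpa using this

end Gens.IsKLR

end StrandGens

section Cyclotomic

variable {O A : Type*} [CommRing O] [Ring A] [Algebra O A] {l : ℕ} [NeZero l]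

/-- The cyclotomic-type conditions cut out by an idempotent `ε` commuting with all generators on
strands `≥ o`: strand `o` only carries the residues `κ b`, on which `y o` acts by `h b`, and the
residues `(κ b, κ b - 1)` do not occur on the strands `o`, `o + 1`. -/
structure Gens.Cyc (G : Gens A l) (o : ℕ) (ε : A) (κ : Bool → ZMod l) (h : Bool → O) :
    Prop where
  idem : ε * ε = ε
  p_comm {r} (a) (hr : o ≤ r) : G.p r a * ε = ε * G.p r a
  y_comm {r} (hr : o ≤ r) : G.y r * ε = ε * G.y r
  ψ_comm {r} (hr : o ≤ r) : G.ψ r * ε = ε * G.ψ r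
  out {c} {v : A} (hv : ε * v = v) (hc : G.p o c * v = v) (hne : ∀ b, c ≠ κ b) : v = 0
  y_eq {b} {v : A} (hv : ε * v = v) (hb : G.p o (κ b) * v = v) : G.y o * v = h b • v
  bad {b} {v : A} (hv : ε * v = v) (hb : G.p o (κ b) * v = v)
    (hc : G.p (o + 1) (κ b - 1) * v = v) : v = 0

/-- The two cyclotomic residues are neither equal nor adjacent. -/
def Sep (κ : Bool → ZMod l) : Prop := ∀ b, κ b ≠ κ (!b) ∧ κ b ≠ κ (!b) + 1

/-- The idempotent `ε` cut down to the residues `κ true`, `κ false` on the strands `o`, `o+1`. -/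
def Gens.next (G : Gens A l) (o : ℕ) (ε : A) (κ : Bool → ZMod l) : A :=
  ε * (G.p o (κ true) * G.p (o + 1) (κ false))

/-- `v` lies in the image of `ε` and carries the residues `κ b`, `κ (!b)` on strands `o`, `o+1`. -/
structure Gens.Base (G : Gens A l) (o : ℕ) (ε : A) (κ : Bool → ZMod l) (b : Bool) (v : A) :
    Prop where
  e : ε * v = v
  lo : G.p o (κ b) * v = v
  hi : G.p (o + 1) (κ (!b)) * v = v

lemma Sep.shift {κ : Bool → ZMod l} (h : Sep κ) : Sep (fun b => κ b + 1) := by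
  intro b
  simpa using h b

omit [NeZero l] in
lemma comm_fix {ε g v : A} (h : g * ε = ε * g) (hv : ε * v = v) : ε * (g * v) = g * v := by
  rw [← mul_assoc, ← h, mul_assoc, hv]

namespace Gens.IsKLR

variable {G : Gens A l} {n : ℕ} {x : O} (H : G.IsKLR n x)
  {o : ℕ} {ε : A} {κ : Bool → ZMod l} {h : Bool → O} (C : G.Cyc o ε κ h) (S : Sep κ)
include H C

omit H in
lemma e_ψ {r} {v : A} (hr : o ≤ r) (hv : ε * v = v) : ε * (G.ψ r * v) = G.ψ r * v :=
  comm_fix (C.ψ_comm hr) hv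

lemma base_ψ {r b} {v : A} (hr : o + 2 ≤ r) (hv : G.Base o ε κ b v) :
    G.Base o ε κ b (G.ψ r * v) :=
  ⟨e_ψ C (by omega) hv.e, H.p_ψ hv.lo (by omega) (by omega), H.p_ψ hv.hi (by omega) (by omega)⟩

lemma base_y {r b} {v : A} (hr : o ≤ r) (hv : G.Base o ε κ b v) : G.Base o ε κ b (G.y r * v) :=
  ⟨comm_fix (C.y_comm (by omega)) hv.e, H.p_y hv.lo, H.p_y hv.hi⟩

lemma base_p {r b c} {v : A} (hr : o ≤ r) (hv : G.Base o ε κ b v) :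
    G.Base o ε κ b (G.p r c * v) :=
  ⟨comm_fix (C.p_comm _ (by omega)) hv.e, H.p_p hv.lo, H.p_p hv.hi⟩

lemma base_swap {b} {v : A} (hv : G.Base o ε κ b v) : G.Base o ε κ (!b) (G.ψ o * v) :=
  ⟨e_ψ C le_rfl hv.e, H.p_ψ_lo hv.hi, by simpa using H.p_ψ_hi hv.lo⟩

include S in
omit C in
lemma base_sq {b} {v : A} (hv : G.Base o ε κ b v) : G.ψ o * (G.ψ o * v) = v := by
  refine H.sq_far' hv.lo hv.hi (S b).1.symm ?_ ?_
  · have := (S !b).2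
    simpa using this
  · intro e
    exact (S b).2 (by rw [e]; ring)

/-- Only `κ b + 1` and `κ (!b)` can follow the residue `κ b` on strand `o`. -/
lemma two_zero {b c} {v : A} (hv : ε * v = v) (hb : G.p o (κ b) * v = v)
    (hc : G.p (o + 1) c * v = v) (h1 : c ≠ κ b + 1) (h2 : c ≠ κ (!b)) : v = 0 := by
  by_cases e1 : c = κ b - 1
  · exact C.bad hv hb (e1 ▸ hc)
  by_cases e2 : c = κ b
  · subst e2
    have := H.mem_of_nilHecke (G.stable_bot (O := O) o) le_rfl (h b)
      (fun v => ε * v = v ∧ G.p o (κ b) * v = v ∧ G.p (o + 1) (κ b) * v = v)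
      (fun v w => w.2.1) (fun v w => w.2.2)
      (fun v w => ⟨e_ψ C le_rfl w.1, H.p_ψ_lo w.2.2, H.p_ψ_hi w.2.1⟩)
      (fun v w => by simp [C.y_eq w.1 w.2.1]) v ⟨hv, hb, hc⟩
    simpa using this
  · rw [← H.sq_far' hb hc e2 h1 e1, C.out (e_ψ C le_rfl hv) (H.p_ψ_lo hc), mul_zero]
    intro b'
    by_cases hbb : b' = b
    · exact hbb ▸ e2
    · rwa [Bool.eq_not.2 hbb]

include S in
lemma base_y_hi {b} {v : A} (hv : G.Base o ε κ b v) : G.y (o + 1) * v = h (!b) • v := by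
  have e : G.ψ o * (G.y (o + 1) * v) = h (!b) • (G.ψ o * v) := by
    rw [← mul_assoc, H.ψ_y_hi, add_mul, H.eqv_ne hv.lo hv.hi (S b).1, add_zero, mul_assoc]
    have := H.base_swap C hv
    exact C.y_eq this.e this.lo
  rw [← H.base_sq S (H.base_y C (by omega) hv), e, mul_smul_comm, H.base_sq S hv]

lemma base_far {b c} {v : A} (hv : G.Base o ε κ b v) (hc : G.p (o + 2) c * v = v)
    (n0 : c ≠ κ (!b)) (n1 : c ≠ κ (!b) + 1) (n2 : c ≠ κ (!b) - 1) (n3 : c ≠ κ b + 1) :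
    v = 0 := by
  rw [← H.sq_far' hv.hi hc n0 n1 n2,
    H.two_zero C (e_ψ C (by omega) hv.e) (H.p_ψ hv.lo (by omega) (by omega)) (H.p_ψ_lo hc) n3 n0,
    mul_zero]

include S in
lemma base_same {b} {v : A} (hv : G.Base o ε κ b v) (hc : G.p (o + 2) (κ (!b)) * v = v) :
    v = 0 := by
  have := H.mem_of_nilHecke (G.stable_bot (O := O) o) (by omega) (h (!b))
      (fun v => G.Base o ε κ b v ∧ G.p (o + 2) (κ (!b)) * v = v)
      (fun v w => w.1.hi) (fun v w => w.2)
      (fun v w => ⟨⟨e_ψ C (by omega) w.1.e, H.p_ψ w.1.lo (by omega) (by omega), H.p_ψ_lo w.2⟩,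
        H.p_ψ_hi w.1.hi⟩)
      (fun v w => by simp [H.base_y_hi C S w.1]) v ⟨hv, hc⟩
  simpa using this

include S in
lemma base_cross {b} {v : A} (hl : (1 : ZMod l) ≠ 0) (hv : G.Base o ε κ b v)
    (hc : G.p (o + 2) (κ (!b) + 1) * v = v) : G.ψ (o + 1) * v = 0 := by
  refine H.two_zero C (e_ψ C (by omega) hv.e) (H.p_ψ hv.lo (by omega) (by omega))
    (H.p_ψ_lo hc) ?_ (by simpa using hl)
  simpa using (S b).1.symm

include S in
lemma base_up {b} {v : A} (hl : (1 : ZMod l) ≠ 0) (hv : G.Base o ε κ b v)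
    (hc : G.p (o + 2) (κ (!b) + 1) * v = v) : G.y (o + 2) * v = (h (!b) + x) • v := by
  have e := H.sq_up' hv.hi hc
  rw [H.base_cross C S hl hv hc, mul_zero, H.base_y_hi C S hv] at e
  rw [sub_sub, ← add_smul] at e
  exact sub_eq_zero.1 e.symm

include S in
lemma base_out {b c} {v : A} (hl : (2 : ZMod l) ≠ 0) (hv : G.Base o ε κ b v)
    (hc : G.p (o + 2) c * v = v) (n1 : c ≠ κ b + 1) (n2 : c ≠ κ (!b) + 1) : v = 0 := by
  by_cases e0 : c = κ (!b)
  · exact H.base_same C S hv (e0 ▸ hc)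
  by_cases e1 : c = κ (!b) - 1
  · rw [← H.base_sq S hv, H.base_far C (c := c) (H.base_swap C hv)
      (H.p_ψ hc (by omega) (by omega)), mul_zero]
    · intro e
      exact (S !b).2 (by simp at e ⊢; rw [← e, e1]; ring)
    · simpa using n1
    · intro e
      exact (S !b).1 (by simp at e ⊢; linear_combination e - e1)
    · intro e
      exact hl (by linear_combination e1 - e)
  · exact H.base_far C hv hc e0 n2 e1 n1

include S in
lemma base_y2 {b c} {v : A} (hl : (1 : ZMod l) ≠ 0) (hv : G.Base o ε κ b v)
    (hc : G.p (o + 2) (κ c + 1) * v = v) : G.y (o + 2) * v = (h c + x) • v := by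
  by_cases hbc : c = b
  · subst hbc
    have := H.base_up C S hl (H.base_swap C hv) (by simpa using H.p_ψ hc (by omega) (by omega))
    conv_lhs => rw [← H.base_sq S hv, ← mul_assoc, ← H.ψ_y _ _ (by omega) (by omega), mul_assoc,
      this, mul_smul_comm, H.base_sq S hv]
    simp
  · rw [Bool.eq_not.2 hbc] at hc ⊢
    exact H.base_up C S hl hv hc

include S in
lemma base_bad {b c} {v : A} (hl : (2 : ZMod l) ≠ 0) (hv : G.Base o ε κ b v)
    (hc : G.p (o + 2) (κ c + 1) * v = v) (hd : G.p (o + 3) (κ c) * v = v) : v = 0 := by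
  have key : ∀ b v, G.Base o ε κ b v → G.p (o + 2) (κ (!b) + 1) * v = v →
      G.p (o + 3) (κ (!b)) * v = v → v = 0 := by
    intro b v hv hc hd
    have := H.mem_of_braid (G.stable_bot (O := O) o) (r := o + 1) (by omega) hl (Or.inl rfl)
      hv.hi hc hd ?_ ?_
    · simpa using this
    · simpa using H.base_cross C S (fun e => hl (by linear_combination 2 * e)) hv hc
    · simpa using H.base_same C S (H.base_ψ C le_rfl hv) (H.p_ψ_lo hd)
  by_cases hbc : c = b
  · subst hbc
    rw [← H.base_sq S hv, key _ _ (H.base_swap C hv), mul_zero]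
    · simpa using H.p_ψ hc (by omega) (by omega)
    · simpa using H.p_ψ hd (by omega) (by omega)
  · rw [Bool.eq_not.2 hbc] at hc hd
    exact key _ _ hv hc hd

lemma base_next {v : A} : G.next o ε κ * v = v ↔ G.Base o ε κ true v := by
  have c1 := C.p_comm (r := o) (κ true) le_rfl
  have c2 := C.p_comm (r := o + 1) (κ false) (by omega)
  constructor
  · intro hv
    rw [Gens.next, mul_assoc, mul_assoc] at hv
    refine ⟨?_, ?_, ?_⟩
    · rw [← hv, ← mul_assoc, C.idem]
    · rw [← hv]
      exact comm_fix c1.symm (H.p_self _ _ _)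
    · rw [← hv]
      exact comm_fix c2.symm (H.p_p (H.p_self _ _ _))
  · intro hv
    rw [Gens.next, mul_assoc, pp_absorb hv.lo (show G.p (o + 1) (κ false) * v = v from hv.hi), hv.e]

include S in
/-- The cyclotomic conditions propagate two strands further. -/
lemma cyc_next (hl : (2 : ZMod l) ≠ 0) :
    G.Cyc (o + 2) (G.next o ε κ) (fun b => κ b + 1) (fun b => h b + x) := by
  have hl1 : (1 : ZMod l) ≠ 0 := fun e => hl (by linear_combination 2 * e)
  have comm : ∀ g, g * ε = ε * g → g * G.p o (κ true) = G.p o (κ true) * g →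
      g * G.p (o + 1) (κ false) = G.p (o + 1) (κ false) * g →
      g * G.next o ε κ = G.next o ε κ * g := by
    intro g g1 g2 g3
    exact (Commute.mul_right g1 (Commute.mul_right g2 g3) : Commute g _)
  have out : ∀ v, G.next o ε κ * v = v → G.Base o ε κ true v := fun v => (H.base_next C).1
  exact
  { idem := by
      refine (H.base_next C).2 ⟨?_, ?_, ?_⟩
      · rw [Gens.next, ← mul_assoc, C.idem]
      · exact comm_fix (C.p_comm _ le_rfl).symm (H.p_self _ _ _)
      · exact comm_fix (C.p_comm _ (by omega)).symm (by rw [H.p_comm]; exact H.p_self _ _ _)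
    p_comm := fun a hr => comm _ (C.p_comm _ (by omega)) (H.p_comm ..) (H.p_comm ..)
    y_comm := fun hr => comm _ (C.y_comm (by omega)) (H.y_p ..) (H.y_p ..)
    ψ_comm := fun hr => comm _ (C.ψ_comm (by omega)) (H.ψ_p _ _ _ (by omega) (by omega))
      (H.ψ_p _ _ _ (by omega) (by omega))
    out := fun hv hc hne => H.base_out C S hl (out _ hv) hc (hne _) (hne _)
    y_eq := fun hv hb => H.base_y2 C S hl1 (out _ hv) hb
    bad := fun hv hb hc => H.base_bad C S hl (out _ hv) hb (by simpa using hc) }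

end Gens.IsKLR

end Cyclotomic

section Lines

variable {O A : Type*} [CommRing O] [Ring A] [Algebra O A] {l : ℕ} [NeZero l]

lemma mul_mem_of_span {s : Set A} {I : Submodule O A} (g : A) (hs : ∀ v ∈ s, g * v ∈ I)
    {v : A} (hv : v ∈ Submodule.span O s) : g * v ∈ I := by
  have : Submodule.span O s ≤ I.comap (LinearMap.mulLeft O g) := Submodule.span_le.2 hs
  exact this hv

/-- The descending word `ψ (o + j) ⋯ ψ (o + 1)`. -/
def Gens.D (G : Gens A l) (o : ℕ) : ℕ → A
  | 0 => 1
  | j + 1 => G.ψ (o + 1 + j) * G.D o j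

/-- The span of `D o i * v` for `i ≤ j` and `v ∈ L`. -/
def Gens.N (G : Gens A l) (o j : ℕ) (L : Submodule O A) : Submodule O A :=
  Submodule.span O {u | ∃ i ≤ j, ∃ v ∈ L, u = G.D o i * v}

/-- The span of all `D o i * v`, `v ∈ L`. -/
def Gens.Ninf (G : Gens A l) (o : ℕ) (L : Submodule O A) : Submodule O A := ⨆ j, G.N o j L

/-- A submodule consisting of base vectors, stable under the generators on strands `≥ o + 2`. -/
structure Gens.Layer (G : Gens A l) (o : ℕ) (ε : A) (κ : Bool → ZMod l) (b : Bool)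
    (L : Submodule O A) : Prop where
  stable : G.Stable (o + 2) L
  base : ∀ v ∈ L, G.Base o ε κ b v

lemma Gens.N_mono (G : Gens A l) {o i j : ℕ} (L : Submodule O A) (hij : i ≤ j) :
    G.N o i L ≤ G.N o j L :=
  Submodule.span_mono fun _ ⟨i', hi', h⟩ => ⟨i', hi'.trans hij, h⟩

lemma Gens.D_mem_N (G : Gens A l) {o i j : ℕ} {L : Submodule O A} (hij : i ≤ j) {v : A}
    (hv : v ∈ L) : G.D o i * v ∈ G.N o j L :=
  Submodule.subset_span ⟨i, hij, v, hv, rfl⟩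

lemma Gens.mem_Ninf (G : Gens A l) {o : ℕ} {L : Submodule O A} {v : A} :
    v ∈ G.Ninf o L ↔ ∃ j, v ∈ G.N o j L :=
  Submodule.mem_iSup_of_directed _ fun i j =>
    ⟨max i j, G.N_mono L (le_max_left _ _), G.N_mono L (le_max_right _ _)⟩

lemma Gens.le_Ninf (G : Gens A l) {o : ℕ} {L : Submodule O A} : L ≤ G.Ninf o L := by
  intro v hv
  have := G.D_mem_N (o := o) (le_refl 0) hv
  rw [Gens.D, one_mul] at this
  exact G.mem_Ninf.2 ⟨0, this⟩

namespace Gens.IsKLR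

variable {G : Gens A l} {n : ℕ} {x : O} (H : G.IsKLR n x)
include H

lemma sq_down' {r a} {v : A} (h1 : G.p r a * v = v) (h2 : G.p (r + 1) (a - 1) * v = v) :
    G.ψ r * (G.ψ r * v) = G.y r * v - G.y (r + 1) * v - x • v := by
  have := congrArg (· * v) (H.sq_down r a)
  simp only [mul_assoc, h2, h1, sub_mul, Algebra.smul_def] at this ⊢
  exact this

lemma mem_of_components {r} (hr : r < n) {v : A} {I : Submodule O A}
    (h : ∀ a, G.p r a * v ∈ I) : v ∈ I := by
  rw [← H.sum_p_mul hr v]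
  exact I.sum_mem fun a _ => h a

lemma sq_mem {r} {I : Submodule O A}
    (hp : ∀ s a v, s = r ∨ s = r + 1 → v ∈ I → G.p s a * v ∈ I)
    (hy : ∀ s v, s = r ∨ s = r + 1 → v ∈ I → G.y s * v ∈ I) {v : A} (hv : v ∈ I) :
    G.ψ r * (G.ψ r * v) ∈ I := by
  by_cases hr : n ≤ r + 1
  · rw [H.ψ_out r hr]; simp
  have key : ∀ a b, G.ψ r * (G.ψ r * (G.p r a * (G.p (r + 1) b * v))) ∈ I := by
    intro a b
    set w := G.p r a * (G.p (r + 1) b * v) with hw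
    have wI : w ∈ I := hp _ _ _ (Or.inl rfl) (hp _ _ _ (Or.inr rfl) hv)
    have w1 : G.p r a * w = w := H.p_self _ _ _
    have w2 : G.p (r + 1) b * w = w := H.p_p (H.p_self _ _ _)
    have y1 := hy r w (Or.inl rfl) wI
    have y2 := hy (r + 1) w (Or.inr rfl) wI
    by_cases e0 : b = a
    · subst e0
      rw [H.sq_same' w1 w2]; simp
    by_cases e1 : b = a + 1
    · subst e1
      rw [H.sq_up' w1 w2]
      exact I.sub_mem (I.sub_mem y2 y1) (I.smul_mem _ wI)
    by_cases e2 : b = a - 1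
    · subst e2
      rw [H.sq_down' w1 w2]
      exact I.sub_mem (I.sub_mem y1 y2) (I.smul_mem _ wI)
    rwa [H.sq_far' w1 w2 e0 e1 e2]
  have e : G.ψ r * (G.ψ r * v) =
      ∑ a, ∑ b, G.ψ r * (G.ψ r * (G.p r a * (G.p (r + 1) b * v))) := by
    simp_rw [← Finset.mul_sum, H.sum_p_mul (r := r + 1) (by omega),
      H.sum_p_mul (r := r) (by omega)]
  rw [e]
  exact I.sum_mem fun a _ => I.sum_mem fun b _ => key a b

lemma eqv_mem {r} {I : Submodule O A}
    (hp : ∀ s a v, s = r ∨ s = r + 1 → v ∈ I → G.p s a * v ∈ I) {v : A} (hv : v ∈ I) :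
    G.eqv r * v ∈ I := by
  rw [Gens.eqv, Finset.sum_mul]
  refine I.sum_mem fun a _ => ?_
  rw [mul_assoc]
  exact hp _ _ _ (Or.inl rfl) (hp _ _ _ (Or.inr rfl) hv)

lemma err_mem {r} {I : Submodule O A}
    (hp : ∀ s a v, r ≤ s → v ∈ I → G.p s a * v ∈ I) {v : A} (hv : v ∈ I) :
    G.err r * v ∈ I := by
  rw [Gens.err, Finset.sum_mul]
  refine I.sum_mem fun a _ => ?_
  simp only [sub_mul, mul_assoc]
  exact I.sub_mem
    (hp _ _ _ (by omega) (hp _ _ _ (by omega) (hp _ _ _ (by omega) hv)))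
    (hp _ _ _ (by omega) (hp _ _ _ (by omega) (hp _ _ _ (by omega) hv)))

/-- Crossings far to the right commute with `D o i`. -/
lemma ψ_D {o i r} (hr : o + i + 2 ≤ r) : G.ψ r * G.D o i = G.D o i * G.ψ r := by
  induction i with
  | zero => simp [Gens.D]
  | succ i ih =>
    rw [Gens.D, ← mul_assoc, ← H.ψ_comm _ _ (by omega), mul_assoc, ih (by omega), mul_assoc]

variable {o : ℕ} {ε : A} {κ : Bool → ZMod l} {h : Bool → O} (C : G.Cyc o ε κ h) (S : Sep κ)
  {b : Bool} {L : Submodule O A} (hL : G.Layer o ε κ b L)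

include hL

lemma N_p {r a j} (hr : o ≤ r) {v : A} (hv : v ∈ G.N o j L) : G.p r a * v ∈ G.N o j L := by
  have key : ∀ i, ∀ r, o ≤ r → ∀ v ∈ L, ∃ w ∈ L, G.p r a * (G.D o i * v) = G.D o i * w := by
    intro i
    induction i with
    | zero =>
      intro r hr v hv
      refine ⟨G.p r a * v, ?_, by simp [Gens.D]⟩
      have B := hL.base v hv
      rcases eq_or_lt_of_le hr with rfl | hr
      · rw [H.p_eq_or B.lo]; split_ifs <;> simp [hv]
      rcases eq_or_lt_of_le (Nat.succ_le_of_lt hr) with rfl | hr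
      · rw [Nat.succ_eq_add_one, H.p_eq_or B.hi]; split_ifs <;> simp [hv]
      exact hL.stable.p hr hv
    | succ i ih =>
      intro r hr v hv
      have comm : ∀ r', G.p r a * G.ψ (o + 1 + i) = G.ψ (o + 1 + i) * G.p r' a → o ≤ r' →
          ∃ w ∈ L, G.p r a * (G.D o (i + 1) * v) = G.D o (i + 1) * w := by
        intro r' e hr'
        obtain ⟨w, hw, e'⟩ := ih r' hr' v hv
        refine ⟨w, hw, ?_⟩
        rw [Gens.D, mul_assoc, ← mul_assoc, e, mul_assoc, e', mul_assoc]
      by_cases e1 : r = o + 1 + i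
      · subst e1
        exact comm _ (H.ψ_p_hi ..).symm (by omega)
      by_cases e2 : r = o + 1 + i + 1
      · subst e2
        exact comm _ (H.ψ_p_lo ..).symm (by omega)
      exact comm r (H.ψ_p _ _ _ e1 e2).symm hr
  refine mul_mem_of_span _ ?_ hv
  rintro _ ⟨i, hi, v, hv, rfl⟩
  obtain ⟨w, hw, e⟩ := key i r hr v hv
  rw [e]
  exact G.D_mem_N hi hw

lemma N_ψ_far {r j} (hr : o + j + 2 ≤ r) {v : A} (hv : v ∈ G.N o j L) :
    G.ψ r * v ∈ G.N o j L := by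
  refine mul_mem_of_span _ ?_ hv
  rintro _ ⟨i, hi, v, hv, rfl⟩
  rw [← mul_assoc, H.ψ_D (by omega), mul_assoc]
  exact G.D_mem_N hi (hL.stable.ψ (by omega) hv)

lemma N_ψ_succ {r j} (hr : o + j + 1 ≤ r) {v : A} (hv : v ∈ G.N o j L) :
    G.ψ r * v ∈ G.N o (j + 1) L := by
  refine mul_mem_of_span _ ?_ hv
  rintro _ ⟨i, hi, v, hv, rfl⟩
  by_cases e : r = o + 1 + i
  · rw [e, ← mul_assoc]
    exact G.D_mem_N (i := i + 1) (by omega) hv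
  · rw [← mul_assoc, H.ψ_D (by omega), mul_assoc]
    exact G.D_mem_N (by omega) (hL.stable.ψ (by omega) hv)

include C S

lemma N_y {r j} (hr : o ≤ r) {v : A} (hv : v ∈ G.N o j L) : G.y r * v ∈ G.N o j L := by
  have key : ∀ i, ∀ r, o ≤ r → ∀ v ∈ L, G.y r * (G.D o i * v) ∈ G.N o i L := by
    intro i
    induction i with
    | zero =>
      intro r hr v hv
      have hmem : ∀ u ∈ L, u ∈ G.N o 0 L := fun u hu => by
        simpa [Gens.D] using G.D_mem_N (o := o) (le_refl 0) hu
      have B := hL.base v hv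
      rw [Gens.D, one_mul]
      apply hmem
      rcases eq_or_lt_of_le hr with rfl | hr
      · rw [C.y_eq B.e B.lo]; exact L.smul_mem _ hv
      rcases eq_or_lt_of_le (Nat.succ_le_of_lt hr) with rfl | hr
      · rw [Nat.succ_eq_add_one, H.base_y_hi C S B]; exact L.smul_mem _ hv
      exact hL.stable.y hr hv
    | succ i ih =>
      intro r hr v hv
      have hD : G.D o i * v ∈ G.N o (i + 1) L := G.D_mem_N (by omega) hv
      have hE : G.eqv (o + 1 + i) * (G.D o i * v) ∈ G.N o (i + 1) L :=
        H.eqv_mem (fun s a v hs hv => H.N_p hL (by omega) hv) hD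
      have hU : ∀ r', o ≤ r' → G.ψ (o + 1 + i) * (G.y r' * (G.D o i * v)) ∈ G.N o (i + 1) L :=
        fun r' hr' => H.N_ψ_succ hL (by omega) (ih r' hr' v hv)
      rw [Gens.D, mul_assoc, ← mul_assoc (G.y r)]
      by_cases e1 : r = o + 1 + i
      · subst e1
        rw [eq_sub_of_add_eq (H.ψ_y_hi (o + 1 + i)).symm, sub_mul, mul_assoc]
        exact Submodule.sub_mem _ (hU _ (by omega)) hE
      by_cases e2 : r = o + 1 + i + 1
      · subst e2
        rw [H.y_ψ_hi, add_mul, mul_assoc]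
        exact Submodule.add_mem _ (hU _ (by omega)) hE
      rw [← H.ψ_y _ _ e1 e2, mul_assoc]
      exact hU r hr
  refine mul_mem_of_span _ ?_ hv
  rintro _ ⟨i, hi, v, hv, rfl⟩
  exact G.N_mono L hi (key i r hr v hv)

lemma N_ψ {r j} (hr : o + 1 ≤ r) {v : A} (hv : v ∈ G.N o j L) :
    G.ψ r * v ∈ G.N o (j + 1) L := by
  have key : ∀ i, ∀ r, o + 1 ≤ r → ∀ v ∈ L, r ≤ o + i → G.ψ r * (G.D o i * v) ∈ G.N o i L := by
    intro i
    induction i using Nat.strong_induction_on with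
    | _ i ih =>
    intro r hr v hv hri
    obtain ⟨i, rfl⟩ : ∃ i', i = i' + 1 := ⟨i - 1, by omega⟩
    have hD : G.D o i * v ∈ G.N o i L := G.D_mem_N le_rfl hv
    rw [Gens.D, mul_assoc]
    by_cases e1 : r = o + 1 + i
    · subst e1
      exact G.N_mono L (by omega) (H.sq_mem (fun s a v hs hv => H.N_p hL (by omega) hv)
        (fun s v hs hv => H.N_y C S hL (by omega) hv) hD)
    by_cases e2 : r = o + i
    · obtain ⟨i, rfl⟩ : ∃ i', i = i' + 1 := ⟨i - 1, by omega⟩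
      have er : o + 1 + (i + 1) = r + 1 := by omega
      have er' : o + 1 + i = r := by omega
      rw [Gens.D, er, er', mul_assoc, H.braid']
      refine Submodule.add_mem _ ?_ ?_
      · rw [← mul_assoc (G.ψ (r + 1)) (G.D o i), H.ψ_D (by omega), mul_assoc]
        have : G.ψ (r + 1) * (G.ψ r * (G.D o i * (G.ψ (r + 1) * v))) =
            G.D o (i + 2) * (G.ψ (r + 1) * v) := by
          rw [Gens.D, Gens.D, er, er']; simp only [mul_assoc]
        rw [this]
        exact G.D_mem_N le_rfl (hL.stable.ψ (by omega) hv)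
      · exact H.err_mem (fun s a v hs hv => H.N_p hL (by omega) hv)
          (G.D_mem_N (by omega) hv)
    · rw [← mul_assoc, H.ψ_comm _ _ (by omega), mul_assoc]
      exact H.N_ψ_succ hL (by omega) (ih i (by omega) r hr v hv (by omega))
  refine mul_mem_of_span _ ?_ hv
  rintro _ ⟨i, hi, v, hv, rfl⟩
  by_cases hri : r ≤ o + i
  · exact G.N_mono L (by omega) (key i r hr v hv hri)
  · exact G.N_mono L (by omega) (H.N_ψ_succ hL (by omega) (G.D_mem_N le_rfl hv))

lemma N_ψ_zero (hl : (2 : ZMod l) ≠ 0) {j} {v : A} (hv : v ∈ L) :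
    G.ψ o * (G.D o (j + 1) * v) = 0 := by
  have hl1 : (1 : ZMod l) ≠ 0 := fun e => hl (by linear_combination 2 * e)
  have B := hL.base v hv
  induction j with
  | zero =>
    simp only [Gens.D, mul_one, add_zero]
    by_cases hn : n ≤ o + 2
    · rw [H.ψ_out (o + 1) (by omega)]; simp
    have key : G.ψ o * (G.ψ (o + 1) * v) ∈ (⊥ : Submodule O A) := by
      rw [← mul_assoc]
      have e := H.sum_p_mul (r := o + 2) (by omega) v
      rw [← e, Finset.mul_sum]
      refine Submodule.sum_mem _ fun c _ => ?_
      rw [Submodule.mem_bot, mul_assoc]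
      have B' := H.base_p C (r := o + 2) (c := c) (by omega) B
      have hc := H.p_self (o + 2) c v
      by_cases e1 : c = κ b + 1
      · refine C.out (e_ψ C le_rfl (e_ψ C (by omega) B'.e)) (H.p_ψ_lo (H.p_ψ_lo hc)) ?_
        intro b'
        rw [e1]
        by_cases hb : b' = b
        · subst hb; simpa using hl1
        · rw [Bool.eq_not.2 hb]
          have := (S !b).2
          simp at this
          exact fun e => this e.symm
      by_cases e2 : c = κ (!b) + 1
      · rw [H.base_cross C S hl1 B' (e2 ▸ hc), mul_zero]
      · rw [H.base_out C S hl B' hc e1 e2]; simp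
    simpa using key
  | succ j ih =>
    rw [Gens.D, mul_assoc, ← mul_assoc, H.ψ_comm _ _ (by omega), mul_assoc, ih, mul_zero]

omit hL in
lemma zig_base (hl : (2 : ZMod l) ≠ 0) {w : A} (B : G.Base o ε κ b w)
    (w2 : G.p (o + 2) (κ b + 1) * w = w) (w3 : G.p (o + 3) (κ (!b) + 1) * w = w) :
    G.ψ (o + 2) * (G.ψ (o + 1) * w) = 0 := by
  have hl1 : (1 : ZMod l) ≠ 0 := fun e => hl (by linear_combination 2 * e)
  have a2 : G.p (o + 1) (κ b + 1) * (G.ψ (o + 2) * (G.ψ (o + 1) * w)) = _ :=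
    H.p_ψ (H.p_ψ_lo w2) (by omega) (by omega)
  have a3 : G.p (o + 2) (κ (!b) + 1) * (G.ψ (o + 2) * (G.ψ (o + 1) * w)) = _ :=
    H.p_ψ_lo (H.p_ψ w3 (by omega) (by omega))
  have n1 := (S b).1
  have n2 := (S b).2
  have n3 := (S !b).2
  simp only [Bool.not_not] at n3
  rw [← H.sq_far' a2 a3 (by simpa using n1.symm) (by simpa using n3)
    (fun e => n2 (by linear_combination -e)),
    H.two_zero C (b := b) (c := κ (!b) + 1) (e_ψ C (by omega) (e_ψ C (by omega)
      (e_ψ C (by omega) B.e)))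
      (H.p_ψ (H.p_ψ (H.p_ψ B.lo (by omega) (by omega)) (by omega) (by omega))
        (by omega) (by omega)) (H.p_ψ_lo a3) (by simpa using n1.symm) (by simpa using hl1),
    mul_zero]

lemma zigzag (hl : (2 : ZMod l) ≠ 0) {w : A} (hw : w ∈ L)
    (w2 : G.p (o + 2) (κ b + 1) * w = w) (w3 : G.p (o + 3) (κ (!b) + 1) * w = w) {i j : ℕ}
    (hij : i + 2 ≤ j) : G.D o j * (G.D (o + 2) i * w) ∈ G.N o i L := by
  have hD : ∀ i, ∀ v ∈ L, G.D (o + 2) i * v ∈ L := by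
    intro i v hv
    induction i with
    | zero => simpa [Gens.D] using hv
    | succ i ih =>
      rw [Gens.D, mul_assoc]
      exact hL.stable.ψ (by omega) ih
  have base : ∀ i, G.D o (i + 2) * (G.D (o + 2) i * w) ∈ G.N o i L := by
    intro i
    induction i with
    | zero =>
      have : G.D o 2 * (G.D (o + 2) 0 * w) = G.ψ (o + 2) * (G.ψ (o + 1) * w) := by
        simp [Gens.D, mul_assoc]
      rw [zero_add, this, H.zig_base C S hl (hL.base w hw) w2 w3]
      simp
    | succ i ih =>
      set u := G.D (o + 2) i * w
      have e := H.braid' (o + i + 2) (G.D o (i + 1) * u)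
      have e1 : G.ψ (o + i + 2) * (G.D o (i + 1) * u) = G.D o (i + 2) * u := by
        rw [show G.D o (i + 2) = G.ψ (o + 1 + (i + 1)) * G.D o (i + 1) from rfl,
          show o + 1 + (i + 1) = o + i + 2 by omega, mul_assoc]
      have e2 : G.D o (i + 1 + 2) * (G.D (o + 2) (i + 1) * w) =
          G.ψ (o + i + 2 + 1) * (G.ψ (o + i + 2) * (G.ψ (o + i + 2 + 1) *
            (G.D o (i + 1) * u))) := by
        rw [← mul_assoc (G.ψ (o + i + 2 + 1)) (G.D o (i + 1)), H.ψ_D (by omega)]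
        rw [show G.D (o + 2) (i + 1) = G.ψ (o + i + 2 + 1) * G.D (o + 2) i by
          rw [Gens.D]; congr 2; omega]
        rw [show G.D o (i + 1 + 2) = G.ψ (o + i + 2 + 1) * (G.ψ (o + i + 2) * G.D o (i + 1)) by
          rw [Gens.D, Gens.D, show o + 1 + (i + 1 + 1) = o + i + 2 + 1 by omega,
            show o + 1 + (i + 1) = o + i + 2 by omega]]
        simp only [mul_assoc, u]
      rw [e1] at e
      rw [e2, ← sub_eq_of_eq_add e]
      refine Submodule.sub_mem _ (G.N_mono L (Nat.le_succ i) (H.N_ψ_far hL (by omega)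
        (H.N_ψ_far hL (by omega) ih))) ?_
      exact H.err_mem (fun s a v hs hv => H.N_p hL (by omega) hv)
        (G.D_mem_N le_rfl (hD _ _ hw))
  obtain ⟨d, rfl⟩ := Nat.exists_eq_add_of_le hij
  clear hij
  induction d with
  | zero => exact base i
  | succ d ih =>
    rw [← add_assoc, Gens.D, mul_assoc]
    exact H.N_ψ_far hL (by omega) ih

omit S hL in
lemma layer_swap (hL : G.Layer o ε κ b L) :
    G.Layer o ε κ (!b) (L.map (LinearMap.mulLeft O (G.ψ o))) := by
  have comm : ∀ g : A, G.ψ o * g = g * G.ψ o → (∀ v ∈ L, g * v ∈ L) →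
      ∀ v ∈ L.map (LinearMap.mulLeft O (G.ψ o)),
        g * v ∈ L.map (LinearMap.mulLeft O (G.ψ o)) := by
    rintro g hg hs _ ⟨v, hv, rfl⟩
    refine ⟨g * v, hs v hv, ?_⟩
    simp only [LinearMap.mulLeft_apply, ← mul_assoc, hg]
  refine ⟨⟨?_, ?_, ?_⟩, ?_⟩
  · exact fun hr hv => comm _ (H.ψ_p _ _ _ (by omega) (by omega))
      (fun v hv => hL.stable.p hr hv) _ hv
  · exact fun hr hv => comm _ (H.ψ_y _ _ (by omega) (by omega))
      (fun v hv => hL.stable.y hr hv) _ hv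
  · exact fun hr hv => comm _ (H.ψ_comm _ _ (by omega))
      (fun v hv => hL.stable.ψ hr hv) _ hv
  · rintro _ ⟨v, hv, rfl⟩
    exact H.base_swap C (hL.base v hv)

lemma Ninf_ψ_zero (hl : (2 : ZMod l) ≠ 0) {v : A} (hv : v ∈ G.Ninf o L) :
    G.ψ o * v ∈ L.map (LinearMap.mulLeft O (G.ψ o)) := by
  obtain ⟨j, hv⟩ := G.mem_Ninf.1 hv
  refine mul_mem_of_span _ ?_ hv
  rintro _ ⟨i, hi, v, hv, rfl⟩
  cases i with
  | zero => exact ⟨v, hv, by simp [Gens.D]⟩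
  | succ i => rw [H.N_ψ_zero C S hL hl hv]; exact Submodule.zero_mem _

/-- The submodule obtained from a layer by adding two strands on the left. -/
lemma stable_sup (hl : (2 : ZMod l) ≠ 0) :
    G.Stable o (G.Ninf o L ⊔ G.Ninf o (L.map (LinearMap.mulLeft O (G.ψ o)))) := by
  have hL' := H.layer_swap C hL
  have gen : ∀ (g : A), (∀ b, ∀ L : Submodule O A, G.Layer o ε κ b L → ∀ j, ∀ v ∈ G.N o j L,
      g * v ∈ G.N o (j + 1) L) →
      ∀ v ∈ G.Ninf o L ⊔ G.Ninf o (L.map (LinearMap.mulLeft O (G.ψ o))),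
        g * v ∈ G.Ninf o L ⊔ G.Ninf o (L.map (LinearMap.mulLeft O (G.ψ o))) := by
    intro g hg v hv
    obtain ⟨u, hu, w, hw, rfl⟩ := Submodule.mem_sup.1 hv
    obtain ⟨j, hu⟩ := G.mem_Ninf.1 hu
    obtain ⟨j', hw⟩ := G.mem_Ninf.1 hw
    rw [mul_add]
    exact Submodule.add_mem_sup (G.mem_Ninf.2 ⟨_, hg _ _ hL _ _ hu⟩)
      (G.mem_Ninf.2 ⟨_, hg _ _ hL' _ _ hw⟩)
  refine ⟨fun hr hv => gen _ (fun b L hL j v hv => G.N_mono L (by omega) (H.N_p hL hr hv)) _ hv,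
    fun hr hv => gen _ (fun b L hL j v hv => G.N_mono L (by omega) (H.N_y C S hL hr hv)) _ hv, ?_⟩
  intro r v hr hv
  rcases eq_or_lt_of_le hr with rfl | hr
  · obtain ⟨u, hu, w, hw, rfl⟩ := Submodule.mem_sup.1 hv
    rw [mul_add, add_comm]
    refine Submodule.add_mem_sup ?_ (G.le_Ninf (H.Ninf_ψ_zero C S hL hl hu))
    apply G.le_Ninf
    obtain ⟨_, ⟨u, hu, rfl⟩, e⟩ := H.Ninf_ψ_zero C S hL' hl hw
    rw [← e]
    simpa [H.base_sq S (hL.base u hu)] using hu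
  · exact gen _ (fun b L hL j v hv => H.N_ψ C S hL hr hv) _ hv

end Gens.IsKLR

end Lines

section PathElements

/-- Split off the first turn of a path: `b ^ (j + 1) (!b) t ↦ (j, b, b ^ j t)`. -/
def turn : List Bool → Option (ℕ × Bool × List Bool)
  | [] => none
  | [_] => none
  | a :: b :: t => if a = b then (turn (b :: t)).map fun q => (q.1 + 1, q.2.1, a :: q.2.2)
    else some (0, a, t)

lemma turn_replicate (N : ℕ) (b : Bool) : turn (List.replicate N b) = none := by
  induction N with
  | zero => rfl
  | succ N ih =>
    cases N with
    | zero => rfl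
    | succ N => simpa [List.replicate_succ, turn] using ih

lemma turn_bent (j : ℕ) (b : Bool) (t : List Bool) :
    turn (List.replicate (j + 1) b ++ (!b) :: t) = some (j, b, List.replicate j b ++ t) := by
  induction j with
  | zero => simp [turn]
  | succ j ih =>
    rw [List.replicate_succ, List.cons_append] at ih
    simp [List.replicate_succ, turn, ih]

lemma bool_list_run (b : Bool) (s : List Bool) :
    s = List.replicate s.length b ∨ ∃ j t, s = List.replicate j b ++ (!b) :: t := by
  induction s with
  | nil => simp
  | cons a s ih =>
    by_cases h : a = b
    · subst h
      rcases ih with ih | ⟨j, t, ih⟩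
      · left; rw [List.length_cons, List.replicate_succ, ← ih]
      · right; exact ⟨j + 1, t, by rw [List.replicate_succ, List.cons_append, ← ih]⟩
    · right
      exact ⟨0, s, by simp [Bool.eq_not.2 h]⟩

lemma straight_or_bent (s : List Bool) :
    (∃ b, s = List.replicate s.length b) ∨
      ∃ j b t, s = List.replicate (j + 1) b ++ (!b) :: t := by
  cases s with
  | nil => exact Or.inl ⟨true, rfl⟩
  | cons a s =>
    rcases bool_list_run a s with h | ⟨j, t, h⟩
    · exact Or.inl ⟨a, by rw [List.length_cons, List.replicate_succ, ← h]⟩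
    · exact Or.inr ⟨j, a, t, by rw [List.replicate_succ, List.cons_append, ← h]⟩

lemma turn_length {s : List Bool} {q : ℕ × Bool × List Bool} (h : turn s = some q) :
    q.2.2.length + 2 = s.length := by
  rcases straight_or_bent s with ⟨b, hs⟩ | ⟨j, b, t, rfl⟩
  · rw [hs, turn_replicate] at h; simp at h
  · rw [turn_bent] at h
    obtain rfl := Option.some.inj h
    simp; omega

/-- The height reached by a path. -/
def height (s : List Bool) : ℤ := (s.count true : ℤ) - s.count false

lemma height_bent (j : ℕ) (b : Bool) (t : List Bool) :
    height (List.replicate (j + 1) b ++ (!b) :: t) = height (List.replicate j b ++ t) := by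
  cases b <;> simp [height, List.count_replicate] <;> ring

lemma height_straight (N : ℕ) (b : Bool) : |height (List.replicate N b)| = N := by
  cases b <;> simp [height, List.count_replicate]

lemma abs_height_le (s : List Bool) : |height s| ≤ s.length := by
  induction s with
  | nil => simp [height]
  | cons b s ih =>
    rw [abs_le] at ih ⊢
    cases b <;> simp [height] at ih ⊢ <;> omega

section
variable {O A : Type*} [CommRing O] [Ring A] [Algebra O A] {l : ℕ} [NeZero l]

/-- The idempotent for the residues `c, c + 1, …` on `N` strands starting at `o`. -/
def Gens.line (G : Gens A l) : ℕ → ZMod l → ℕ → A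
  | _, _, 0 => 1
  | o, c, N + 1 => G.p o c * G.line (o + 1) (c + 1) N

/-- Multiplication by `ψ o` if `b` is `false`. -/
def Gens.sw (G : Gens A l) (o : ℕ) (b : Bool) (v : A) : A := if b then v else G.ψ o * v

/-- The element attached to a path. -/
def Gens.Psi (G : Gens A l) (o : ℕ) (ε : A) (κ : Bool → ZMod l) (s : List Bool) : A :=
  match _h : turn s with
  | none => ε * G.line o (κ (s.headD true)) s.length
  | some q => G.D o q.1 *
      G.sw o q.2.1 (G.Psi (o + 2) (G.next o ε κ) (fun b => κ b + 1) q.2.2)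
termination_by s.length
decreasing_by
  have := turn_length _h
  omega

lemma Gens.Psi_straight (G : Gens A l) (o : ℕ) (ε : A) (κ : Bool → ZMod l) (N : ℕ) (b : Bool)
    (hN : N ≠ 0) : G.Psi o ε κ (List.replicate N b) = ε * G.line o (κ b) N := by
  rw [Gens.Psi]
  split
  · obtain ⟨N, rfl⟩ := Nat.exists_eq_succ_of_ne_zero hN
    simp [List.replicate_succ]
  · rename_i q h
    rw [turn_replicate] at h
    simp at h

lemma Gens.Psi_nil (G : Gens A l) (o : ℕ) (ε : A) (κ : Bool → ZMod l) :
    G.Psi o ε κ [] = ε := by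
  rw [Gens.Psi]
  split
  · simp [Gens.line]
  · rename_i q h
    simp [turn] at h

lemma Gens.Psi_bent (G : Gens A l) (o : ℕ) (ε : A) (κ : Bool → ZMod l) (j : ℕ) (b : Bool)
    (t : List Bool) : G.Psi o ε κ (List.replicate (j + 1) b ++ (!b) :: t) = G.D o j *
      G.sw o b (G.Psi (o + 2) (G.next o ε κ) (fun b => κ b + 1) (List.replicate j b ++ t)) := by
  rw [Gens.Psi]
  split
  · rename_i h
    rw [turn_bent] at h
    simp at h
  · rename_i q h
    rw [turn_bent] at h
    obtain rfl := Option.some.inj h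
    rfl

lemma Gens.Psi_turn (G : Gens A l) (o : ℕ) (ε : A) (κ : Bool → ZMod l) (b : Bool)
    (t : List Bool) : G.Psi o ε κ (b :: (!b) :: t) =
      G.sw o b (G.Psi (o + 2) (G.next o ε κ) (fun b => κ b + 1) t) := by
  simpa [Gens.D] using G.Psi_bent o ε κ 0 b t

/-- The span of the path elements of height `f` and of the right ideals generated by those of
smaller absolute height. -/
def Gens.Tgt (O : Type*) [CommRing O] [Algebra O A] (G : Gens A l) (o : ℕ) (ε : A)
    (κ : Bool → ZMod l) (N : ℕ) (f : ℤ) : Submodule O A :=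
  Submodule.span O ({v | ∃ u : List Bool, u.length = N ∧ height u = f ∧ v = G.Psi o ε κ u} ∪
    {v | ∃ u : List Bool, ∃ a : A, u.length = N ∧ |height u| < |f| ∧ v = G.Psi o ε κ u * a})

/-- The right ideal generated by the path elements of absolute height `< f`. -/
def Gens.Low (O : Type*) [CommRing O] [Algebra O A] (G : Gens A l) (o : ℕ) (ε : A)
    (κ : Bool → ZMod l) (N : ℕ) (f : ℤ) : Submodule O A :=
  Submodule.span O
    {v | ∃ u : List Bool, ∃ a : A, u.length = N ∧ |height u| < f ∧ v = G.Psi o ε κ u * a}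

lemma Gens.low_le_tgt (G : Gens A l) (o : ℕ) (ε : A) (κ : Bool → ZMod l) (N : ℕ) (f : ℤ) :
    G.Low O o ε κ N |f| ≤ G.Tgt O o ε κ N f :=
  Submodule.span_mono fun _ h => Or.inr h

lemma Gens.psi_mem_tgt (G : Gens A l) (o : ℕ) (ε : A) (κ : Bool → ZMod l) {N : ℕ} {f : ℤ}
    {u : List Bool} (hu : u.length = N) (hf : height u = f) :
    G.Psi o ε κ u ∈ G.Tgt O o ε κ N f :=
  Submodule.subset_span (Or.inl ⟨u, hu, hf, rfl⟩)

lemma Gens.tgt_mul (G : Gens A l) (o : ℕ) (ε : A) (κ : Bool → ZMod l) {N : ℕ} {f g : ℤ}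
    (hfg : |f| < g) {v : A} (hv : v ∈ G.Tgt O o ε κ N f) (a : A) :
    v * a ∈ G.Low O o ε κ N g := by
  have : G.Tgt O o ε κ N f ≤ (G.Low O o ε κ N g).comap (LinearMap.mulRight O a) := by
    refine Submodule.span_le.2 ?_
    rintro _ (⟨u, h1, h2, rfl⟩ | ⟨u, a', h1, h2, rfl⟩)
    · exact Submodule.subset_span ⟨u, a, h1, h2 ▸ hfg, rfl⟩
    · exact Submodule.subset_span ⟨u, a' * a, h1, h2.trans hfg, by simp [mul_assoc]⟩
  exact this hv

/-- To map `Tgt` into `Tgt` compatibly with right multiplication it suffices to treat `Psi`. -/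
lemma Gens.tgt_map (G : Gens A l) {o o' : ℕ} {ε ε' : A} {κ κ' : Bool → ZMod l} {N N' : ℕ}
    (g : A) {f : ℤ} (hg : ∀ u : List Bool, u.length = N' → |height u| ≤ |f| →
      g * G.Psi o' ε' κ' u ∈ G.Tgt O o ε κ N (height u)) {v : A}
    (hv : v ∈ G.Tgt O o' ε' κ' N' f) : g * v ∈ G.Tgt O o ε κ N f := by
  refine mul_mem_of_span _ ?_ hv
  rintro _ (⟨u, h1, h2, rfl⟩ | ⟨u, a, h1, h2, rfl⟩)
  · exact h2 ▸ hg u h1 (by rw [h2])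
  · rw [← mul_assoc]
    exact G.low_le_tgt o ε κ N f (G.tgt_mul o ε κ h2 (hg u h1 h2.le) a)

namespace Gens.IsKLR

variable {G : Gens A l} {n : ℕ} {x : O} (H : G.IsKLR n x)
include H

lemma D_fix {o j : ℕ} {g v : A} (hg : ∀ r, o + 1 ≤ r → ∀ v, g * v = v → g * (G.ψ r * v) = G.ψ r * v)
    (hv : g * v = v) : g * (G.D o j * v) = G.D o j * v := by
  induction j with
  | zero => simpa [Gens.D] using hv
  | succ j ih =>
    rw [Gens.D, mul_assoc]
    exact hg _ (by omega) _ ih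

lemma D_zero {o j : ℕ} {v : A} (hv : G.ψ (o + 1) * v = 0) : G.D o (j + 1) * v = 0 := by
  induction j with
  | zero => simpa [Gens.D] using hv
  | succ j ih => rw [Gens.D, mul_assoc, ih, mul_zero]

lemma D_large {o j : ℕ} (h : n ≤ o + j + 2) : G.D o (j + 1) = 0 := by
  rw [Gens.D, H.ψ_out _ (by omega), zero_mul]

lemma ψ_D' {o i : ℕ} : G.ψ o * G.D (o + 2) i = G.D (o + 2) i * G.ψ o := by
  induction i with
  | zero => simp [Gens.D]
  | succ i ih => rw [Gens.D, ← mul_assoc, H.ψ_comm _ _ (by omega), mul_assoc, ih, mul_assoc]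

variable {o : ℕ} {ε : A} {κ : Bool → ZMod l} {h : Bool → O} (C : G.Cyc o ε κ h) (S : Sep κ)
include C

lemma base_sw {b : Bool} {v : A} (hv : G.Base o ε κ true v) : G.Base o ε κ b (G.sw o b v) := by
  cases b
  · exact H.base_swap C hv
  · exact hv

lemma sw_D {i : ℕ} {b : Bool} {v : A} : G.sw o b (G.D (o + 2) i * v) =
    G.D (o + 2) i * G.sw o b v := by
  cases b
  · simp only [Gens.sw, Bool.false_eq_true, if_false]
    rw [← mul_assoc, H.ψ_D', mul_assoc]
  · rfl

include S in
lemma psi_ε (hl : (2 : ZMod l) ≠ 0) (s : List Bool) : ε * G.Psi o ε κ s = G.Psi o ε κ s := by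
  induction hs : s.length using Nat.strong_induction_on generalizing o ε κ h s with
  | _ N ih =>
  rcases straight_or_bent s with ⟨b, h⟩ | ⟨j, b, t, rfl⟩
  · by_cases hN : s.length = 0
    · rw [List.length_eq_zero_iff.1 hN, Gens.Psi_nil, C.idem]
    · rw [h, Gens.Psi_straight _ _ _ _ _ _ hN, ← mul_assoc, C.idem]
  · rw [Gens.Psi_bent]
    have B := H.base_sw C (b := b) ((H.base_next C).1 (ih _ (by simp at hs ⊢; omega)
      (H.cyc_next C S hl) S.shift (List.replicate j b ++ t) rfl))
    exact H.D_fix (fun r hr v hv => e_ψ C (by omega) hv) B.e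

include S in
lemma psi_base (hl : (2 : ZMod l) ≠ 0) (b : Bool) (s : List Bool) :
    G.Base o ε κ b (G.sw o b (G.Psi (o + 2) (G.next o ε κ) (fun b => κ b + 1) s)) :=
  H.base_sw C ((H.base_next C).1 (H.psi_ε (H.cyc_next C S hl) S.shift hl s))

include S in
lemma psi_head (hl : (2 : ZMod l) ≠ 0) (b : Bool) (s : List Bool) :
    G.p o (κ b) * G.Psi o ε κ (b :: s) = G.Psi o ε κ (b :: s) := by
  rcases straight_or_bent (b :: s) with ⟨c, h⟩ | ⟨j, c, t, h⟩
  · have hb : b = c := by simpa [List.replicate_succ] using congrArg List.head? h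
    subst hb
    rw [h, List.length_cons, Gens.Psi_straight _ _ _ _ _ _ (by omega), Gens.line]
    exact comm_fix (C.p_comm _ le_rfl).symm (H.p_self _ _ _)
  · have hb : b = c := by simpa [List.replicate_succ] using congrArg List.head? h
    subst hb
    rw [h, Gens.Psi_bent]
    exact H.D_fix (fun r hr v hv => H.p_ψ hv (by omega) (by omega)) (H.psi_base C S hl _ _).lo

include S in
lemma layer_tgt (hl : (2 : ZMod l) ≠ 0) {N : ℕ} {f : ℤ}
    (st : G.Stable (o + 2) (G.Tgt O (o + 2) (G.next o ε κ) (fun b => κ b + 1) N f)) :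
    G.Layer o ε κ true (G.Tgt O (o + 2) (G.next o ε κ) (fun b => κ b + 1) N f) := by
  refine ⟨st, fun v hv => (H.base_next C).1 ?_⟩
  have hP := H.psi_ε (H.cyc_next C S hl) S.shift hl
  induction hv using Submodule.span_induction with
  | mem v hv =>
    rcases hv with ⟨u, -, -, rfl⟩ | ⟨u, a, -, -, rfl⟩
    · exact hP u
    · rw [← mul_assoc, hP u]
  | zero => simp
  | add v w _ _ h1 h2 => rw [mul_add, h1, h2]
  | smul a v _ h1 => rw [mul_smul_comm, h1]

lemma sw_layer {b : Bool} {L : Submodule O A} (hL : G.Layer o ε κ true L) :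
    ∃ L' : Submodule O A, G.Layer o ε κ b L' ∧ ∀ v, v ∈ L' ↔ ∃ w ∈ L, v = G.sw o b w := by
  cases b
  · exact ⟨_, H.layer_swap C hL, fun v => by
      simp [Gens.sw, eq_comm]⟩
  · exact ⟨L, hL, fun v => by simp [Gens.sw]⟩

include S in
lemma D_sw_mem (hl : (2 : ZMod l) ≠ 0) {N : ℕ} (hN : o + 2 + N = n)
    (st : ∀ f, G.Stable (o + 2) (G.Tgt O (o + 2) (G.next o ε κ) (fun b => κ b + 1) N f))
    (j : ℕ) (c : Bool) {f : ℤ} {v : A}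
    (hv : v ∈ G.Tgt O (o + 2) (G.next o ε κ) (fun b => κ b + 1) N f) :
    G.D o j * G.sw o c v ∈ G.Tgt O o ε κ (N + 2) f := by
  have C' := H.cyc_next C S hl
  have hl1 : (1 : ZMod l) ≠ 0 := fun e => hl (by linear_combination 2 * e)
  induction j using Nat.strong_induction_on generalizing c f v with
  | _ j ih =>
  suffices hg : ∀ u : List Bool, u.length = N → |height u| ≤ |f| →
      G.D o j * G.sw o c (G.Psi (o + 2) (G.next o ε κ) (fun b => κ b + 1) u) ∈
        G.Tgt O o ε κ (N + 2) (height u) by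
    cases c
    · simp only [Gens.sw, Bool.false_eq_true, if_false, ← mul_assoc] at hg ⊢
      exact G.tgt_map _ hg hv
    · exact G.tgt_map _ hg hv
  clear hv v
  intro u hu hf
  have B := H.psi_base C S hl c u
  have good : ∀ t, u = List.replicate j c ++ t →
      G.D o j * G.sw o c (G.Psi (o + 2) (G.next o ε κ) (fun b => κ b + 1) u) ∈
        G.Tgt O o ε κ (N + 2) (height u) := by
    rintro t rfl
    rw [← Gens.Psi_bent, ← height_bent]
    refine G.psi_mem_tgt o ε κ ?_ rfl
    simp at hu ⊢; omega
  rcases bool_list_run c u with hs | ⟨i, t, hs⟩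
  · by_cases hj : j ≤ N
    · exact good (List.replicate (N - j) c) (by rw [hs, hu, ← List.replicate_add]; congr 1; omega)
    · obtain ⟨j, rfl⟩ : ∃ j', j = j' + 1 := ⟨j - 1, by omega⟩
      rw [H.D_large (by omega), zero_mul]
      exact Submodule.zero_mem _
  · by_cases hj : j ≤ i
    · exact good (List.replicate (i - j) c ++ (!c) :: t) (by
        rw [hs, ← List.append_assoc, ← List.replicate_add]; congr 2; omega)
    · cases i with
      | zero =>
        obtain ⟨j, rfl⟩ : ∃ j', j = j' + 1 := ⟨j - 1, by omega⟩
        rw [H.D_zero, ]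
        · exact Submodule.zero_mem _
        · refine H.base_cross C S hl1 B ?_
          have e : u = (!c) :: t := by simpa using hs
          have := H.psi_head C' S.shift hl (!c) t
          rw [← e] at this
          cases c
          · exact H.p_ψ this (by omega) (by omega)
          · exact this
      | succ i =>
        have e := G.Psi_bent (o + 2) (G.next o ε κ) (fun b => κ b + 1) i c t
        rw [← hs] at e
        set w := G.sw (o + 2) c (G.Psi (o + 2 + 2) (G.next (o + 2) (G.next o ε κ)
          (fun b => κ b + 1)) (fun b => κ b + 1 + 1) (List.replicate i c ++ t)) with hw
        have hL := H.layer_tgt C S hl (st (height u))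
        have wL : w ∈ G.Tgt O (o + 2) (G.next o ε κ) (fun b => κ b + 1) N (height u) := by
          rw [hw, ← Gens.Psi_turn]
          have hs' := congrArg List.length hs
          refine G.psi_mem_tgt _ _ _ ?_ ?_
          · simp at hs' ⊢; omega
          · rw [hs, height_bent]
            simpa using height_bent 0 c (List.replicate i c ++ t)
        have Bw : G.Base (o + 2) (G.next o ε κ) (fun b => κ b + 1) c w :=
          H.psi_base C' S.shift hl c _
        rw [e, H.sw_D C]
        obtain ⟨L', hL', mL'⟩ := H.sw_layer C (b := c) hL
        have key := H.zigzag C S hL' hl ((mL' _).2 ⟨w, wL, rfl⟩) ?_ ?_ (i := i) (j := j) (by omega)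
        · refine (Submodule.span_le.2 ?_ : G.N o i L' ≤ _) key
          rintro _ ⟨i', hi', v, hv, rfl⟩
          obtain ⟨v', hv', rfl⟩ := (mL' _).1 hv
          exact ih i' (by omega) c hv'
        · cases c
          · exact H.p_ψ Bw.lo (by omega) (by omega)
          · exact Bw.lo
        · cases c
          · exact H.p_ψ Bw.hi (by omega) (by omega)
          · exact Bw.hi

include S in
lemma tgt_bent (hl : (2 : ZMod l) ≠ 0) {N : ℕ} (hN : o + 2 + N = n)
    (st : ∀ f, G.Stable (o + 2) (G.Tgt O (o + 2) (G.next o ε κ) (fun b => κ b + 1) N f))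
    (u : List Bool) (hu : u.length = N + 2) (hu' : |height u| < N + 2) :
    ∃ M : Submodule O A, G.Stable o M ∧ G.Psi o ε κ u ∈ M ∧
      M ≤ G.Tgt O o ε κ (N + 2) (height u) := by
  rcases straight_or_bent u with ⟨b, h⟩ | ⟨j, b, t, rfl⟩
  · rw [h, height_straight] at hu'
    push_cast [hu] at hu'
    omega
  · have hL := H.layer_tgt C S hl (st (height (List.replicate j b ++ t)))
    rw [height_bent]
    have hu2 : (List.replicate j b ++ t).length = N := by simp at hu ⊢; omega
    refine ⟨_, H.stable_sup C S hL hl, ?_, sup_le ?_ ?_⟩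
    · rw [Gens.Psi_bent]
      have hm := G.psi_mem_tgt (O := O) (o + 2) (G.next o ε κ) (fun b => κ b + 1) hu2 rfl
      cases b
      · refine Submodule.mem_sup_right (G.mem_Ninf.2 ⟨j, G.D_mem_N le_rfl ⟨_, hm, ?_⟩⟩)
        simp [Gens.sw]
      · exact Submodule.mem_sup_left (G.mem_Ninf.2 ⟨j, G.D_mem_N le_rfl hm⟩)
    · refine iSup_le fun j => Submodule.span_le.2 ?_
      rintro _ ⟨i, -, v, hv, rfl⟩
      exact H.D_sw_mem C S hl hN st i true hv
    · refine iSup_le fun j => Submodule.span_le.2 ?_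
      rintro _ ⟨i, -, v, ⟨v, hv, rfl⟩, rfl⟩
      exact H.D_sw_mem C S hl hN st i false hv

end Gens.IsKLR
end

end PathElements

section Spanning

variable {O A : Type*} [CommRing O] [Ring A] [Algebra O A] {l : ℕ} [NeZero l]

/-- `v` lies in the image of `ε` and carries the residues `κ b, κ b + 1, …` on `j` strands. -/
structure Gens.Line (G : Gens A l) (o : ℕ) (ε : A) (κ : Bool → ZMod l) (b : Bool) (j : ℕ)
    (v : A) : Prop where
  e : ε * v = v
  res : ∀ i < j, G.p (o + i) (κ b + i) * v = v

namespace Gens.IsKLR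

variable {G : Gens A l} {n : ℕ} {x : O} (H : G.IsKLR n x)
  {o : ℕ} {ε : A} {κ : Bool → ZMod l} {h : Bool → O} (C : G.Cyc o ε κ h) (S : Sep κ)
include H C

lemma line_ψ {b j r} {v : A} (hv : G.Line o ε κ b j v) (hr : o + j ≤ r) :
    G.Line o ε κ b j (G.ψ r * v) :=
  ⟨e_ψ C (by omega) hv.e, fun i hi => H.p_ψ (hv.res i hi) (by omega) (by omega)⟩

omit H C in
lemma line_mono {b j j'} {v : A} (hv : G.Line o ε κ b j v) (hj : j' ≤ j) :
    G.Line o ε κ b j' v :=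
  ⟨hv.e, fun i hi => hv.res i (by omega)⟩

omit H C in
lemma line_succ {b j} {v : A} (hv : G.Line o ε κ b j v)
    (hc : G.p (o + j) (κ b + j) * v = v) : G.Line o ε κ b (j + 1) v :=
  ⟨hv.e, fun i hi => by
    rcases Nat.lt_succ_iff_lt_or_eq.1 hi with hi | rfl
    · exact hv.res i hi
    · exact hc⟩

omit H C in
lemma line_last {b j} {v : A} (hv : G.Line o ε κ b (j + 1) v) :
    G.p (o + j) (κ b + j) * v = v := hv.res j (by omega)

include S in
/-- Modulo a stable submodule containing all base vectors, the strand following a straight line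
continues it, and the last dot on a straight line acts by a scalar. -/
lemma line_mod (hl : (2 : ZMod l) ≠ 0) {I : Submodule O A} (hI : G.Stable o I)
    (hB : ∀ b v, G.Base o ε κ b v → v ∈ I) (b : Bool) (j : ℕ) :
    (∀ c v, G.Line o ε κ b j v → G.p (o + j) c * v = v → c ≠ κ b + j →
      (1 ≤ j ∨ c ≠ κ (!b)) → v ∈ I) ∧
    (∀ v, G.Line o ε κ b (j + 1) v → G.y (o + j) * v - (h b + j * x) • v ∈ I) := by
  have hl1 : (1 : ZMod l) ≠ 0 := fun e => hl (by linear_combination 2 * e)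
  have nb : κ b + 1 ≠ κ (!b) := by
    have := (S !b).2
    simpa using this.symm
  induction j using Nat.strong_induction_on with
  | _ j ih =>
  cases j with
  | zero =>
    refine ⟨fun c v hv hc h1 h2 => ?_, fun v hv => ?_⟩
    · have h2 : c ≠ κ (!b) := by simpa using h2
      have h1 : c ≠ κ b := by simpa using h1
      rw [C.out hv.e hc]
      · exact I.zero_mem
      · intro b'
        by_cases hb : b' = b
        · exact hb ▸ h1
        · rwa [Bool.eq_not.2 hb]
    · have := hv.res 0 (by omega)
      simp only [Nat.cast_zero, add_zero, zero_mul] at this ⊢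
      rw [C.y_eq hv.e this]
      simp
  | succ j =>
    have s1 : ∀ c v, G.Line o ε κ b (j + 1) v → G.p (o + (j + 1)) c * v = v →
        c ≠ κ b + (j + 1 : ℕ) → v ∈ I := by
      intro c v hv hc h1
      push_cast at h1
      by_cases e0 : c = κ b + j
      · subst e0
        refine H.mem_of_nilHecke hI (r := o + j) (by omega) (h b + j * x)
          (fun v => G.Line o ε κ b (j + 1) v ∧ G.p (o + (j + 1)) (κ b + j) * v = v)
          (fun v w => line_last w.1) (fun v w => w.2) (fun v w => ⟨?_, ?_⟩)
          (fun v w => (ih j (by omega)).2 v w.1) v ⟨hv, hc⟩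
        · exact line_succ (H.line_ψ C (line_mono w.1 (by omega)) le_rfl) (H.p_ψ_lo w.2)
        · exact H.p_ψ_hi (line_last w.1)
      by_cases e1 : c = κ b + j - 1
      · cases j with
        | zero =>
          have r1 := line_last hv
          rw [e1] at hc
          rw [C.bad hv.e (by simpa using r1) (by simpa using hc)]
          exact I.zero_mem
        | succ j =>
          have ec : c = κ b + j := by rw [e1]; push_cast; ring
          subst ec
          have r1 : G.p (o + j) (κ b + j) * v = v := hv.res j (by omega)
          have r2 : G.p (o + j + 1) (κ b + j + 1) * v = v := by
            have := line_last hv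
            push_cast at this
            rwa [← add_assoc, ← add_assoc] at this
          refine H.mem_of_braid hI (r := o + j) (by omega) hl (Or.inl rfl) r1 r2 hc ?_ ?_
          · refine (ih j (by omega)).1 (κ b + j + 1) _
              (H.line_ψ C (line_mono hv (by omega)) le_rfl) (H.p_ψ_lo r2) (by simpa using hl1) ?_
            rcases Nat.eq_zero_or_pos j with rfl | hj
            · right; simpa using nb
            · left; exact hj
          · refine (ih (j + 1) (by omega)).1 (κ b + j) _
              (H.line_ψ C (line_mono hv (by omega)) (by omega)) (H.p_ψ_lo hc) ?_
              (Or.inl (by omega))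
            push_cast
            intro e
            exact hl1 (by linear_combination -e)
      · have r1 := line_last hv
        rw [← H.sq_far' r1 hc e0 (by rw [add_assoc]; exact h1) e1]
        by_cases hj : j = 0 ∧ c = κ (!b)
        · obtain ⟨rfl, rfl⟩ := hj
          refine hI.ψ (by omega) (hI.ψ (by omega) (hB b v ⟨hv.e, by simpa using r1, hc⟩))
        · refine hI.ψ (by omega) ((ih j (by omega)).1 c _
            (H.line_ψ C (line_mono hv (by omega)) le_rfl) (H.p_ψ_lo hc) e0 ?_)
          by_contra! hh
          exact hj ⟨by omega, hh.2⟩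
    refine ⟨fun c v hv hc h1 _ => s1 c v hv hc h1, fun v hv => ?_⟩
    have r1 := line_last (line_mono hv (by omega : j + 1 ≤ j + 1 + 1))
    have r2 : G.p (o + j + 1) (κ b + j + 1) * v = v := by
      have := line_last hv
      push_cast at this
      rwa [← add_assoc, ← add_assoc] at this
    have m1 : G.ψ (o + j) * v ∈ I := by
      refine (ih j (by omega)).1 (κ b + j + 1) _
        (H.line_ψ C (line_mono hv (by omega)) le_rfl) (H.p_ψ_lo r2) (by simpa using hl1) ?_
      rcases Nat.eq_zero_or_pos j with rfl | hj
      · right; simpa using nb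
      · left; exact hj
    have m2 := hI.ψ (by omega : o ≤ o + j) m1
    rw [H.sq_up' r1 r2] at m2
    have m3 := (ih j (by omega)).2 v (line_mono hv (by omega))
    have := I.add_mem m2 m3
    convert this using 1
    push_cast
    simp only [add_mul, add_smul, one_mul, ← add_assoc]
    abel

omit H C in
lemma line_mul_self (G : Gens A l) {o N : ℕ} {c : ZMod l} {v : A}
    (hv : ∀ i < N, G.p (o + i) (c + i) * v = v) : G.line o c N * v = v := by
  induction N generalizing o c with
  | zero => simp [Gens.line]
  | succ N ih =>
    rw [Gens.line, mul_assoc, ih, (by simpa using hv 0 (by omega) : G.p o c * v = v)]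
    intro i hi
    have := hv (i + 1) (by omega)
    push_cast at this
    rwa [add_assoc, add_assoc, add_comm 1, add_comm 1]

omit C in
lemma p_line (r a : _) {o N : ℕ} {c : ZMod l} :
    G.p r a * G.line o c N = G.line o c N * G.p r a := by
  induction N generalizing o c with
  | zero => simp [Gens.line]
  | succ N ih => rw [Gens.line, ← mul_assoc, H.p_comm, mul_assoc, ih, mul_assoc]

omit C in
lemma line_res {o N i : ℕ} {c : ZMod l} (hi : i < N) :
    G.p (o + i) (c + i) * G.line o c N = G.line o c N := by
  induction N generalizing o c i with
  | zero => omega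
  | succ N ih =>
    rw [Gens.line]
    cases i with
    | zero => simpa using H.p_self o c _
    | succ i =>
      have := ih (o := o + 1) (c := c + 1) (i := i) (by omega)
      rw [add_assoc, add_assoc, add_comm 1, add_comm 1] at this
      push_cast
      rw [H.p_p this]

lemma line_straight (b : Bool) {N : ℕ} (hN : N ≠ 0) :
    G.Line o ε κ b N (G.Psi o ε κ (List.replicate N b)) := by
  rw [Gens.Psi_straight _ _ _ _ _ _ hN]
  exact ⟨by rw [← mul_assoc, C.idem],
    fun i hi => comm_fix (C.p_comm _ (by omega)).symm (H.line_res hi)⟩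

omit H C in
lemma straight_mul {b : Bool} {N : ℕ} (hN : N ≠ 0) {v : A} (hv : G.Line o ε κ b N v) :
    G.Psi o ε κ (List.replicate N b) * v = v := by
  rw [Gens.Psi_straight _ _ _ _ _ _ hN, mul_assoc, line_mul_self G hv.res, hv.e]

omit C in
lemma tgt_zero {o : ℕ} (ho : n ≤ o) (I : Submodule O A) : G.Stable o I where
  p hr hv := by rw [H.p_out _ _ (by omega), zero_mul]; exact I.zero_mem
  y hr hv := by rw [H.y_out _ (by omega), zero_mul]; exact I.zero_mem
  ψ hr hv := by rw [H.ψ_out _ (by omega), zero_mul]; exact I.zero_mem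

include S in
/-- The inductive step from strands `≥ o + 2` to strands `≥ o`. -/
lemma span_step (hl : (2 : ZMod l) ≠ 0) {N : ℕ} (hN : o + N = n) (h0 : N ≠ 0)
    {J : Submodule O A} (hJ : J = G.Low O o ε κ N N) (st : G.Stable o J)
    (hB : ∀ b v, G.Base o ε κ b v → v ∈ J)
    (stb : ∀ u : List Bool, u.length = N → |height u| < N → ∃ M : Submodule O A,
      G.Stable o M ∧ G.Psi o ε κ u ∈ M ∧ M ≤ G.Tgt O o ε κ N (height u)) :
    (∀ f, G.Stable o (G.Tgt O o ε κ N f)) ∧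
      ε ∈ Submodule.span O
        {v | ∃ u : List Bool, ∃ a : A, u.length = N ∧ v = G.Psi o ε κ u * a} := by
  have LM := fun b j => H.line_mod C S hl st hB b j
  constructor
  · have gen : ∀ (g : A), (∀ M : Submodule O A, G.Stable o M → ∀ v ∈ M, g * v ∈ M) →
        (∀ b, ∀ v, G.Line o ε κ b N v → ∃ c : O, g * v - c • v ∈ J) → ∀ f,
        ∀ v ∈ G.Tgt O o ε κ N f, g * v ∈ G.Tgt O o ε κ N f := by
      intro g h1 h2 f v hv
      refine G.tgt_map g (fun u hu hf => ?_) hv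
      by_cases hlt : |height u| < N
      · obtain ⟨M, m1, m2, m3⟩ := stb u hu hlt
        exact m3 (h1 M m1 _ m2)
      · have hge := abs_height_le u
        rw [hu] at hge
        have heq : |height u| = N := le_antisymm hge (not_lt.1 hlt)
        rcases straight_or_bent u with ⟨b, e⟩ | ⟨j, b, t, rfl⟩
        · rw [hu] at e
          have hm := G.psi_mem_tgt (O := O) o ε κ hu rfl
          have hli := H.line_straight C b h0
          rw [← e] at hli
          obtain ⟨c, hc⟩ := h2 b _ hli
          rw [hJ, ← heq] at hc
          have := Submodule.add_mem _ (G.low_le_tgt o ε κ N _ hc) (Submodule.smul_mem _ c hm)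
          simpa using this
        · exfalso
          rw [height_bent] at heq
          have := abs_height_le (List.replicate j b ++ t)
          rw [heq] at this
          simp at this hu
          omega
    refine fun f => ⟨fun hr hv => gen _ (fun M hM v hv => hM.p hr hv) ?_ f _ hv,
      fun hr hv => gen _ (fun M hM v hv => hM.y hr hv) ?_ f _ hv,
      fun hr hv => gen _ (fun M hM v hv => hM.ψ hr hv) ?_ f _ hv⟩
    · rename_i r a v
      intro b v hv
      by_cases hn : n ≤ r
      · exact ⟨0, by rw [H.p_out _ _ hn]; simp⟩
      · obtain ⟨i, rfl⟩ := Nat.exists_eq_add_of_le hr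
        rw [H.p_eq_or (hv.res i (by omega))]
        split_ifs
        · exact ⟨1, by simp⟩
        · exact ⟨0, by simp⟩
    · rename_i r v
      intro b v hv
      by_cases hn : n ≤ r
      · exact ⟨0, by rw [H.y_out _ hn]; simp⟩
      · obtain ⟨i, rfl⟩ := Nat.exists_eq_add_of_le hr
        exact ⟨_, (LM b i).2 v (line_mono hv (by omega))⟩
    · rename_i r v
      intro b v hv
      refine ⟨0, ?_⟩
      rw [zero_smul, sub_zero]
      by_cases hn : n ≤ r + 1
      · rw [H.ψ_out _ hn]; simp
      · obtain ⟨i, rfl⟩ := Nat.exists_eq_add_of_le hr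
        have r2 : G.p (o + i + 1) (κ b + i + 1) * v = v := by
          have := hv.res (i + 1) (by omega)
          push_cast at this
          rwa [← add_assoc, ← add_assoc] at this
        have hl1 : (1 : ZMod l) ≠ 0 := fun e => hl (by linear_combination 2 * e)
        refine (LM b i).1 _ _ (H.line_ψ C (line_mono hv (by omega)) le_rfl) (H.p_ψ_lo r2)
          (by simpa using hl1) ?_
        rcases Nat.eq_zero_or_pos i with rfl | hj
        · right
          have := (S !b).2
          simpa using this.symm
        · left; exact hj
  · set T := Submodule.span O
        {v | ∃ u : List Bool, ∃ a : A, u.length = N ∧ v = G.Psi o ε κ u * a} with hT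
    have JT : J ≤ T := by
      rw [hJ]
      exact Submodule.span_mono fun v ⟨u, a, h1, _, h3⟩ => ⟨u, a, h1, h3⟩
    have key : ∀ b d j v, j + d = N → 1 ≤ j → G.Line o ε κ b j v → v ∈ T := by
      intro b d
      induction d with
      | zero =>
        intro j v hj _ hv
        rw [add_zero] at hj
        subst hj
        refine Submodule.subset_span ⟨List.replicate j b, v, by simp, ?_⟩
        rw [straight_mul h0 hv]
      | succ d ih =>
        intro j v hj hj1 hv
        refine H.mem_of_components (r := o + j) (by omega) fun c => ?_
        have hv' : G.Line o ε κ b j (G.p (o + j) c * v) :=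
          ⟨comm_fix (C.p_comm _ (by omega)) hv.e, fun i hi => H.p_p (hv.res i hi)⟩
        have hc := H.p_self (o + j) c v
        by_cases e : c = κ b + j
        · subst e
          exact ih (j + 1) _ (by omega) (by omega) (line_succ hv' hc)
        · exact JT ((LM b j).1 c _ hv' hc e (Or.inl hj1))
    refine H.mem_of_components (r := o) (by omega) fun c => ?_
    have hv : ε * (G.p o c * ε) = G.p o c * ε := comm_fix (C.p_comm _ le_rfl) C.idem
    have hc := H.p_self o c ε
    by_cases e : ∃ b, c = κ b
    · obtain ⟨b, rfl⟩ := e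
      refine key b (N - 1) 1 _ (by omega) le_rfl (line_succ ⟨hv, by simp⟩ (by simpa using hc))
    · push Not at e
      rw [C.out hv hc e]
      exact T.zero_mem

end Gens.IsKLR

/-- The span of the path elements of a given height, together with the right ideals of lower ones,
is stable under the generators, and the path elements generate the right ideal of `ε`. -/
theorem Gens.IsKLR.span_main {G : Gens A l} {n : ℕ} {x : O} (H : G.IsKLR n x)
    (hl : (2 : ZMod l) ≠ 0) {o : ℕ} {ε : A} {κ : Bool → ZMod l} {h : Bool → O}
    (C : G.Cyc o ε κ h) (S : Sep κ) (N : ℕ) (hN : o + N = n) :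
    (∀ f, G.Stable o (G.Tgt O o ε κ N f)) ∧
      ε ∈ Submodule.span O
        {v | ∃ u : List Bool, ∃ a : A, u.length = N ∧ v = G.Psi o ε κ u * a} := by
  induction N using Nat.strong_induction_on generalizing o ε κ h with
  | _ N ih =>
  rcases N with _ | _ | N
  · refine ⟨fun f => H.tgt_zero (by omega) _, Submodule.subset_span ⟨[], 1, rfl, ?_⟩⟩
    rw [Gens.Psi_nil, mul_one]
  · have e : ∀ u : List Bool, u.length = 1 → |height u| = 1 := by
      intro u hu
      obtain ⟨b, rfl⟩ := List.length_eq_one_iff.1 hu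
      exact height_straight 1 b
    refine H.span_step C S hl hN (by omega) rfl ?_ ?_ ?_
    · convert G.stable_bot (O := O) o
      rw [Gens.Low, Submodule.span_eq_bot]
      rintro _ ⟨u, a, hu, hu', -⟩
      rw [e u hu] at hu'
      simp at hu'
    · intro b v hv
      have := hv.hi
      rw [H.p_out _ _ (by omega), zero_mul] at this
      rw [← this]
      exact Submodule.zero_mem _
    · intro u hu hu'
      rw [e u hu] at hu'
      simp at hu'
  · obtain ⟨i1, i2⟩ := ih N (by omega) (H.cyc_next C S hl) S.shift (by omega)
    have stb : ∀ u : List Bool, u.length = N + 1 + 1 → |height u| < (N + 1 + 1 : ℕ) →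
        ∃ M : Submodule O A, G.Stable o M ∧ G.Psi o ε κ u ∈ M ∧
          M ≤ G.Tgt O o ε κ (N + 1 + 1) (height u) := fun u hu hu' =>
      H.tgt_bent C S hl (N := N) (by omega) i1 u hu (by push_cast at hu'; omega)
    have hst : G.Stable o (G.Low O o ε κ (N + 1 + 1) (N + 1 + 1 : ℕ)) := by
      have gen : ∀ (g : A), (∀ M : Submodule O A, G.Stable o M → ∀ v ∈ M, g * v ∈ M) →
          ∀ v ∈ G.Low O o ε κ (N + 1 + 1) (N + 1 + 1 : ℕ),
            g * v ∈ G.Low O o ε κ (N + 1 + 1) (N + 1 + 1 : ℕ) := by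
        intro g hg v hv
        refine mul_mem_of_span _ ?_ hv
        rintro _ ⟨u, a, h1, h2, rfl⟩
        obtain ⟨M, m1, m2, m3⟩ := stb u h1 h2
        rw [← mul_assoc]
        exact G.tgt_mul o ε κ h2 (m3 (hg M m1 _ m2)) a
      exact ⟨fun hr hv => gen _ (fun M hM v hv => hM.p hr hv) _ hv,
        fun hr hv => gen _ (fun M hM v hv => hM.y hr hv) _ hv,
        fun hr hv => gen _ (fun M hM v hv => hM.ψ hr hv) _ hv⟩
    have hBt : ∀ v, G.Base o ε κ true v → v ∈ G.Low O o ε κ (N + 1 + 1) (N + 1 + 1 : ℕ) := by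
      intro v hv
      have e := (H.base_next C).2 hv
      have : Submodule.span O {v | ∃ u : List Bool, ∃ a : A, u.length = N ∧
          v = G.Psi (o + 2) (G.next o ε κ) (fun b => κ b + 1) u * a} ≤
          (G.Low O o ε κ (N + 1 + 1) (N + 1 + 1 : ℕ)).comap (LinearMap.mulRight O v) := by
        refine Submodule.span_le.2 ?_
        rintro _ ⟨u, a, hu, rfl⟩
        refine Submodule.subset_span ⟨true :: false :: u, a * v, by simp [hu], ?_, ?_⟩
        · have h1 := height_bent 0 true u
          have h2 := abs_height_le u
          simp only [zero_add, List.replicate_one, List.cons_append, List.nil_append,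
            List.replicate_zero, Bool.not_true] at h1
          rw [h1]
          push_cast [hu] at h2 ⊢
          omega
        · have := G.Psi_turn o ε κ true u
          simp only [Bool.not_true] at this
          rw [this]
          simp [Gens.sw, mul_assoc]
      have := this i2
      rw [Submodule.mem_comap, LinearMap.mulRight_apply, e] at this
      exact this
    refine H.span_step C S hl hN (by omega) rfl hst ?_ (fun u hu hu' => stb u hu hu')
    intro b v hv
    cases b
    · rw [← H.base_sq S hv]
      exact hst.ψ le_rfl (hBt _ (H.base_swap C hv))
    · exact hBt v hv

end Spanning

section Opposite

open MulOpposite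
variable {O A : Type*} [CommRing O] [Ring A] [Algebra O A] {l : ℕ} [NeZero l]

/-- The same generators in the opposite algebra. -/
def Gens.op (G : Gens A l) : Gens Aᵐᵒᵖ l where
  p r a := MulOpposite.op (G.p r a)
  y r := MulOpposite.op (G.y r)
  ψ r := MulOpposite.op (G.ψ r)

/-- The cyclotomic conditions for the whole algebra. -/
structure Gens.Cyc0 (G : Gens A l) (κ : Bool → ZMod l) (h : Bool → O) : Prop where
  out {c} (hc : ∀ b, c ≠ κ b) : G.p 0 c = 0
  y_eq (b) : G.y 0 * G.p 0 (κ b) = h b • G.p 0 (κ b)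
  bad (b) : G.p 0 (κ b) * G.p 1 (κ b - 1) = 0

/-- The set of all generators. -/
def Gens.gens (G : Gens A l) : Set A :=
  {g | (∃ r a, g = G.p r a) ∨ (∃ r, g = G.y r) ∨ ∃ r, g = G.ψ r}

lemma Gens.Cyc0.cyc {G : Gens A l} {κ : Bool → ZMod l} {h : Bool → O} (C : G.Cyc0 κ h) :
    G.Cyc 0 1 κ h where
  idem := one_mul 1
  p_comm a _ := by simp
  y_comm _ := by simp
  ψ_comm _ := by simp
  out _ hc hne := by rw [← hc, C.out hne, zero_mul]
  y_eq {b v} _ hb := by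
    conv_lhs => rw [← hb, ← mul_assoc, C.y_eq, smul_mul_assoc, hb]
  bad {b v} _ hb hc := by
    rw [← hb, ← hc, ← mul_assoc, zero_add, C.bad, zero_mul]

lemma Gens.Stable.mul_mem {G : Gens A l} {I : Submodule O A} (hI : G.Stable 0 I)
    (hg : Algebra.adjoin O G.gens = ⊤) (a : A) {v : A} (hv : v ∈ I) : a * v ∈ I := by
  have ha : a ∈ Algebra.adjoin O G.gens := hg ▸ Algebra.mem_top
  induction ha using Algebra.adjoin_induction generalizing v with
  | mem g hg =>
    rcases hg with ⟨r, a, rfl⟩ | ⟨r, rfl⟩ | ⟨r, rfl⟩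
    · exact hI.p (Nat.zero_le _) hv
    · exact hI.y (Nat.zero_le _) hv
    · exact hI.ψ (Nat.zero_le _) hv
  | algebraMap c => rw [← Algebra.smul_def]; exact I.smul_mem c hv
  | add a b _ _ h1 h2 => rw [add_mul]; exact I.add_mem (h1 hv) (h2 hv)
  | mul a b _ _ h1 h2 => rw [mul_assoc]; exact h1 (h2 hv)

lemma Gens.Stable.op_mul_mem {G : Gens A l} {I : Submodule O Aᵐᵒᵖ} (hI : G.op.Stable 0 I)
    (hg : Algebra.adjoin O G.gens = ⊤) (a : A) {v : Aᵐᵒᵖ} (hv : v ∈ I) :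
    MulOpposite.op a * v ∈ I := by
  have ha : a ∈ Algebra.adjoin O G.gens := hg ▸ Algebra.mem_top
  induction ha using Algebra.adjoin_induction generalizing v with
  | mem g hg =>
    rcases hg with ⟨r, a, rfl⟩ | ⟨r, rfl⟩ | ⟨r, rfl⟩
    · exact hI.p (Nat.zero_le _) hv
    · exact hI.y (Nat.zero_le _) hv
    · exact hI.ψ (Nat.zero_le _) hv
  | algebraMap c =>
    rw [← MulOpposite.algebraMap_apply, ← Algebra.smul_def]; exact I.smul_mem c hv
  | add a b _ _ h1 h2 => rw [op_add, add_mul]; exact I.add_mem (h1 hv) (h2 hv)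
  | mul a b _ _ h1 h2 => rw [op_mul, mul_assoc]; exact h2 (h1 hv)

/-- The mirror image of the path element `Psi`. -/
def Gens.PsiStar (G : Gens A l) (κ : Bool → ZMod l) (s : List Bool) : A :=
  unop (G.op.Psi 0 1 κ s)

namespace Gens.IsKLR
variable {G : Gens A l} {n : ℕ} {x : O} (H : G.IsKLR n x)
include H

lemma op_eqv (r : ℕ) : G.op.eqv r = MulOpposite.op (G.eqv r) := by
  simp only [Gens.eqv, Gens.op, ← op_mul, Finset.op_sum]
  exact Finset.sum_congr rfl fun a _ => congrArg _ (H.p_comm ..)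

lemma op_err (r : ℕ) : G.op.err r = MulOpposite.op (G.err r) := by
  have key (a b) : G.p (r + 2) a * (G.p (r + 1) b * G.p r a) =
      G.p r a * G.p (r + 1) b * G.p (r + 2) a := by
    rw [H.p_comm (r + 1)]
    exact (Commute.mul_right (H.p_comm ..) (H.p_comm ..)).eq
  simp only [Gens.err, Gens.op, ← op_mul, ← op_sub, Finset.op_sum, key]

lemma ψψ_pp (r a b) : G.p (r + 1) b * G.p r a * (G.ψ r * G.ψ r) =
    G.ψ r * G.ψ r * (G.p r a * G.p (r + 1) b) := by
  have h1 : Commute (G.p r a) (G.ψ r * G.ψ r) := by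
    rw [Commute, SemiconjBy, ← mul_assoc, ← H.ψ_p_hi, mul_assoc, ← H.ψ_p_lo, mul_assoc]
  have h2 : Commute (G.p (r + 1) b) (G.ψ r * G.ψ r) := by
    rw [Commute, SemiconjBy, ← mul_assoc, ← H.ψ_p_lo, mul_assoc, ← H.ψ_p_hi, mul_assoc]
  rw [H.p_comm r]
  exact (h2.mul_left h1).eq

lemma pp_sub (r a b s t) : G.p (r + 1) b * G.p r a * (G.y s - G.y t - algebraMap O A x) =
    (G.y s - G.y t - algebraMap O A x) * (G.p r a * G.p (r + 1) b) := by
  have h (q c) : Commute (G.p q c) (G.y s - G.y t - algebraMap O A x) :=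
    (Commute.sub_right (Commute.symm (H.y_p s q c)) (Commute.symm (H.y_p t q c))).sub_right
      (Algebra.commute_algebraMap_right x _)
  rw [H.p_comm r]
  exact ((h _ _).mul_left (h _ _)).eq

lemma op : G.op.IsKLR n x where
  p_idem r a := by simp only [Gens.op, ← op_mul, H.p_idem]
  p_orth r {a b} h := by simp only [Gens.op, ← op_mul, H.p_orth r h.symm, op_zero]
  p_comm r a s b := by simp only [Gens.op, ← op_mul]; rw [H.p_comm]
  p_sum r h := by simp only [Gens.op, ← Finset.op_sum, H.p_sum r h, op_one]
  p_out r a h := by simp [Gens.op, H.p_out r a h]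
  y_out r h := by simp [Gens.op, H.y_out r h]
  ψ_out r h := by simp [Gens.op, H.ψ_out r h]
  y_p r s a := by simp only [Gens.op, ← op_mul, H.y_p]
  y_comm r s := by simp only [Gens.op, ← op_mul]; rw [H.y_comm]
  ψ_p_lo r a := by simp only [Gens.op, ← op_mul, H.ψ_p_hi]
  ψ_p_hi r a := by simp only [Gens.op, ← op_mul, H.ψ_p_lo]
  ψ_p r s a h1 h2 := by simp only [Gens.op, ← op_mul]; rw [H.ψ_p _ _ _ h1 h2]
  ψ_y r s h1 h2 := by simp only [Gens.op, ← op_mul]; rw [H.ψ_y _ _ h1 h2]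
  ψ_comm r s h := by simp only [Gens.op, ← op_mul]; rw [H.ψ_comm _ _ h]
  ψ_y_hi r := by rw [H.op_eqv]; simp only [Gens.op, ← op_mul, ← op_add, H.y_ψ_hi]
  y_ψ_hi r := by rw [H.op_eqv]; simp only [Gens.op, ← op_mul, ← op_add, H.ψ_y_hi]
  sq_same r a := by
    simp only [Gens.op, ← op_mul, H.ψψ_pp, H.sq_same, op_zero]
  sq_up r a := by
    simp only [Gens.op, ← op_mul, H.ψψ_pp, H.sq_up, MulOpposite.algebraMap_apply, ← op_sub,
      H.pp_sub]
  sq_down r a := by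
    simp only [Gens.op, ← op_mul, H.ψψ_pp, H.sq_down, MulOpposite.algebraMap_apply, ← op_sub,
      H.pp_sub]
  sq_far r a b h h1 h2 := by
    simp only [Gens.op, ← op_mul, H.ψψ_pp, H.sq_far _ _ _ h h1 h2]
    rw [H.p_comm]
  braid r := by
    rw [H.op_err]
    simp only [Gens.op, ← op_mul, ← op_add, ← mul_assoc, H.braid]

lemma op_cyc0 {κ : Bool → ZMod l} {h : Bool → O} (C : G.Cyc0 κ h) : G.op.Cyc0 κ h where
  out hc := by simp [Gens.op, C.out hc]
  y_eq b := by simp only [Gens.op, ← op_mul, ← H.y_p, C.y_eq, op_smul]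
  bad b := by simp only [Gens.op, ← op_mul, H.p_comm 1, C.bad, op_zero]

end Gens.IsKLR

/-- The path starting with as many detours as possible that ends like the given one. -/
def canon (s : List Bool) : List Bool :=
  match _h : turn s with
  | none => s
  | some q => true :: false :: canon q.2.2
termination_by s.length
decreasing_by
  have := turn_length _h
  omega

lemma canon_replicate (N : ℕ) (b : Bool) :
    canon (List.replicate N b) = List.replicate N b := by
  rw [canon]
  split
  · rfl
  · rename_i h
    simp [turn_replicate] at h

lemma canon_bent (j : ℕ) (b : Bool) (t : List Bool) :
    canon (List.replicate (j + 1) b ++ (!b) :: t) =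
      true :: false :: canon (List.replicate j b ++ t) := by
  rw [canon]
  split
  · rename_i h
    simp [turn_bent] at h
  · rename_i q h
    rw [turn_bent] at h
    obtain rfl := Option.some.inj h
    rfl

lemma canon_length (s : List Bool) : (canon s).length = s.length := by
  induction hs : s.length using Nat.strong_induction_on generalizing s with
  | _ N ih =>
  rcases straight_or_bent s with ⟨b, h⟩ | ⟨j, b, t, rfl⟩
  · rw [h, canon_replicate, List.length_replicate, hs]
  · rw [canon_bent, List.length_cons, List.length_cons, ih _ _ _ rfl] <;>
      simp at hs ⊢ <;> omega

lemma height_canon (s : List Bool) : height (canon s) = height s := by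
  induction hs : s.length using Nat.strong_induction_on generalizing s with
  | _ N ih =>
  rcases straight_or_bent s with ⟨b, h⟩ | ⟨j, b, t, rfl⟩
  · rw [h, canon_replicate]
  · rw [canon_bent, height_bent, ← ih (List.replicate j b ++ t).length _ _ rfl]
    · simp [height]
    · simp at hs ⊢; omega

namespace Gens.IsKLR
variable {G : Gens A l} {n : ℕ} {x : O} (H : G.IsKLR n x)
  {o : ℕ} {ε : A} {κ : Bool → ZMod l} {h : Bool → O} (C : G.Cyc o ε κ h) (S : Sep κ)
include H C S

lemma psi_canon (hl : (2 : ZMod l) ≠ 0) (s : List Bool) :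
    G.Psi o ε κ s * G.Psi o ε κ (canon s) = G.Psi o ε κ s := by
  induction hs : s.length using Nat.strong_induction_on generalizing o ε κ h s with
  | _ N ih =>
  rcases straight_or_bent s with ⟨b, h⟩ | ⟨j, b, t, rfl⟩
  · by_cases hN : s.length = 0
    · rw [List.length_eq_zero_iff.1 hN]
      have : canon [] = [] := canon_replicate 0 true
      rw [this, Gens.Psi_nil, C.idem]
    · rw [h, canon_replicate]
      exact straight_mul hN (H.line_straight C b hN)
  · have := ih (List.replicate j b ++ t).length (by simp at hs ⊢; omega)
      (H.cyc_next C S hl) S.shift _ rfl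
    rw [canon_bent, Gens.Psi_bent, mul_assoc]
    have e := G.Psi_turn o ε κ true (canon (List.replicate j b ++ t))
    rw [Bool.not_true] at e
    rw [e]
    cases b <;> simp only [Gens.sw, if_true, Bool.false_eq_true, if_false, mul_assoc, this]

lemma op_psi_canon (hl : (2 : ZMod l) ≠ 0) (s : List Bool) :
    G.op.Psi o (MulOpposite.op ε) κ (canon s) = MulOpposite.op (G.Psi o ε κ (canon s)) := by
  induction hs : s.length using Nat.strong_induction_on generalizing o ε κ h s with
  | _ N ih =>
  rcases straight_or_bent s with ⟨b, h⟩ | ⟨j, b, t, rfl⟩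
  · by_cases hN : s.length = 0
    · rw [List.length_eq_zero_iff.1 hN]
      have : canon [] = [] := canon_replicate 0 true
      rw [this, Gens.Psi_nil, Gens.Psi_nil]
    · rw [h, canon_replicate, Gens.Psi_straight _ _ _ _ _ _ hN, Gens.Psi_straight _ _ _ _ _ _ hN]
      have line_op (o N : ℕ) (c : ZMod l) : G.op.line o c N = MulOpposite.op (G.line o c N) := by
        induction N generalizing o c with
        | zero => rfl
        | succ N ih => rw [Gens.line, Gens.line, ih, Gens.op, ← op_mul, H.p_line]
      have line_ε (o' N : ℕ) (c : ZMod l) (ho : o ≤ o') : G.line o' c N * ε = ε * G.line o' c N := by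
        induction N generalizing o' c with
        | zero => simp [Gens.line]
        | succ N ih =>
          rw [Gens.line, mul_assoc, ih _ _ (by omega), ← mul_assoc, C.p_comm _ ho, mul_assoc]
      rw [line_op, ← op_mul, line_ε _ _ _ le_rfl]
  · have := ih (List.replicate j b ++ t).length (by simp at hs ⊢; omega)
      (H.cyc_next C S hl) S.shift _ rfl
    have nx : G.op.next o (MulOpposite.op ε) κ = MulOpposite.op (G.next o ε κ) := by
      simp only [Gens.next, Gens.op, ← op_mul]
      rw [H.p_comm (o + 1), mul_assoc, C.p_comm _ (by omega), ← mul_assoc, C.p_comm _ le_rfl,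
        mul_assoc]
    have e := G.Psi_turn o ε κ true (canon (List.replicate j b ++ t))
    have e' := G.op.Psi_turn o (MulOpposite.op ε) κ true (canon (List.replicate j b ++ t))
    rw [Bool.not_true] at e e'
    rw [canon_bent, e, e', nx]
    exact this

end Gens.IsKLR

/-- The span of the products of path elements and mirrored path elements of equal height, of
absolute value less than `f`. -/
def Gens.Cell (O : Type*) [CommRing O] [Algebra O A] (G : Gens A l) (κ : Bool → ZMod l) (n : ℕ)
    (f : ℤ) : Submodule O A :=
  Submodule.span O {v | ∃ u w : List Bool, u.length = n ∧ w.length = n ∧ height u = height w ∧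
    |height u| < f ∧ v = G.Psi 0 1 κ u * G.PsiStar κ w}

namespace Gens.IsKLR
variable {G : Gens A l} {n : ℕ} {x : O} (H : G.IsKLR n x)
  {κ : Bool → ZMod l} {h : Bool → O} (C : G.Cyc0 κ h) (S : Sep κ)
  (hg : Algebra.adjoin O G.gens = ⊤) (hl : (2 : ZMod l) ≠ 0)
include H C S hg hl

omit hg in
lemma psiStar_canon (u : List Bool) :
    G.Psi 0 1 κ (canon u) * G.PsiStar κ u = G.PsiStar κ u := by
  have h1 := H.op.psi_canon (H.op_cyc0 C).cyc S hl u
  have h2 := H.op_psi_canon C.cyc S hl u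
  rw [op_one] at h2
  rw [h2] at h1
  exact congrArg unop h1

omit hg in
lemma psi_canonStar (u : List Bool) :
    G.Psi 0 1 κ u * G.PsiStar κ (canon u) = G.Psi 0 1 κ u := by
  have h2 := H.op_psi_canon C.cyc S hl u
  rw [op_one] at h2
  rw [Gens.PsiStar, h2, unop_op, H.psi_canon C.cyc S hl]

lemma psi_mul_mem_cell {f : ℤ} {u : List Bool} (hu : u.length = n) (hf : |height u| < f) (a : A) :
    G.Psi 0 1 κ u * a ∈ G.Cell O κ n f := by
  induction hk : (height u).natAbs using Nat.strong_induction_on generalizing u a with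
  | _ k ih =>
  have stab := (H.span_main hl C.cyc S n (Nat.zero_add n)).1
  have stab' := (H.op.span_main hl (H.op_cyc0 C).cyc S n (Nat.zero_add n)).1
  rw [← H.psi_canonStar C S hl, mul_assoc]
  have hm : MulOpposite.op a * G.op.Psi 0 1 κ (canon u) ∈ G.op.Tgt O 0 1 κ n (height u) :=
    (stab' _).op_mul_mem hg a
      (G.op.psi_mem_tgt _ _ _ (by rw [canon_length, hu]) (height_canon u))
  have e : G.PsiStar κ (canon u) * a = unop (MulOpposite.op a * G.op.Psi 0 1 κ (canon u)) := rfl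
  rw [e]
  generalize MulOpposite.op a * G.op.Psi 0 1 κ (canon u) = v at hm
  induction hm using Submodule.span_induction with
  | zero => simp
  | add v w _ _ h1 h2 => rw [unop_add, mul_add]; exact Submodule.add_mem _ h1 h2
  | smul c v _ h1 => rw [unop_smul, mul_smul_comm]; exact Submodule.smul_mem _ c h1
  | mem v hv =>
    rcases hv with ⟨w, h1, h2, rfl⟩ | ⟨w, a', h1, h2, rfl⟩
    · exact Submodule.subset_span ⟨u, w, hu, h1, h2.symm, hf, rfl⟩
    · rw [unop_mul, ← Gens.PsiStar, ← H.psiStar_canon C S hl w, ← mul_assoc, ← mul_assoc]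
      have hm : G.Psi 0 1 κ u * unop a' * G.Psi 0 1 κ (canon w) ∈ G.Tgt O 0 1 κ n (height w) :=
        (stab _).mul_mem hg _ (G.psi_mem_tgt _ _ _ (by rw [canon_length, h1]) (height_canon w))
      generalize G.Psi 0 1 κ u * unop a' * G.Psi 0 1 κ (canon w) = z at hm
      induction hm using Submodule.span_induction with
      | zero => simp
      | add v w _ _ h1 h2 => rw [add_mul]; exact Submodule.add_mem _ h1 h2
      | smul c v _ h1 => rw [smul_mul_assoc]; exact Submodule.smul_mem _ c h1
      | mem v hv =>
        rcases hv with ⟨t, h3, h4, rfl⟩ | ⟨t, a'', h3, h4, rfl⟩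
        · exact Submodule.subset_span ⟨t, w, h3, h1, h4, by rw [h4]; omega, rfl⟩
        · rw [mul_assoc]
          exact ih (height t).natAbs (by zify; rw [← hk]; zify; linarith) h3 (by linarith) _ rfl

theorem mem_cell (a : A) : a ∈ G.Cell O κ n (n + 1) := by
  have h1 := (H.span_main hl C.cyc S n (Nat.zero_add n)).2
  suffices h : ∀ v ∈ Submodule.span O {v | ∃ u : List Bool, ∃ a : A, u.length = n ∧
      v = G.Psi 0 1 κ u * a}, v * a ∈ G.Cell O κ n (n + 1) by simpa using h 1 h1
  intro v hv
  induction hv using Submodule.span_induction with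
  | zero => simp
  | add v w _ _ h1 h2 => rw [add_mul]; exact Submodule.add_mem _ h1 h2
  | smul c v _ h1 => rw [smul_mul_assoc]; exact Submodule.smul_mem _ c h1
  | mem v hv =>
    obtain ⟨u, a', h1, rfl⟩ := hv
    rw [mul_assoc]
    have := abs_height_le u
    exact H.psi_mul_mem_cell C S hg hl h1 (by omega) _

theorem mul_psi (a : A) {s : List Bool} (hs : s.length = n) :
    ∃ z ∈ Submodule.span O {v | ∃ u : List Bool, u.length = n ∧ height u = height s ∧
      v = G.Psi 0 1 κ u}, ∀ b, a * G.Psi 0 1 κ s * b - z * b ∈ G.Cell O κ n |height s| := by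
  have stab := (H.span_main hl C.cyc S n (Nat.zero_add n)).1
  have hm : a * G.Psi 0 1 κ s ∈ G.Tgt O 0 1 κ n (height s) :=
    (stab _).mul_mem hg a (G.psi_mem_tgt _ _ _ hs rfl)
  rw [Gens.Tgt, Submodule.span_union] at hm
  obtain ⟨z, hz, w, hw, e⟩ := Submodule.mem_sup.1 hm
  refine ⟨z, hz, fun b => ?_⟩
  rw [← e, add_mul, add_sub_cancel_left]
  clear e hz hm
  induction hw using Submodule.span_induction with
  | zero => simp
  | add v w _ _ h1 h2 => rw [add_mul]; exact Submodule.add_mem _ h1 h2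
  | smul c v _ h1 => rw [smul_mul_assoc]; exact Submodule.smul_mem _ c h1
  | mem v hv =>
    obtain ⟨u, a', h1, h2, rfl⟩ := hv
    rw [mul_assoc]
    exact H.psi_mul_mem_cell C S hg hl h1 h2 _

end Gens.IsKLR

end Opposite

section Homogeneity

variable {O A A' : Type*} [CommRing O] [Ring A] [Algebra O A] [Ring A'] {l : ℕ} [NeZero l]

/-- The image of the generators under a ring homomorphism. -/
def Gens.map (G : Gens A l) (f : A →+* A') : Gens A' l where
  p r a := f (G.p r a)
  y r := f (G.y r)
  ψ r := f (G.ψ r)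

lemma Gens.psi_map (G : Gens A l) (f : A →+* A') (o : ℕ) (ε : A) (κ : Bool → ZMod l)
    (s : List Bool) : (G.map f).Psi o (f ε) κ s = f (G.Psi o ε κ s) := by
  induction hs : s.length using Nat.strong_induction_on generalizing o ε κ s with
  | _ N ih =>
  rcases straight_or_bent s with ⟨b, h⟩ | ⟨j, b, t, rfl⟩
  · by_cases hN : s.length = 0
    · rw [List.length_eq_zero_iff.1 hN, Gens.Psi_nil, Gens.Psi_nil]
    · have line_map (o N : ℕ) (c : ZMod l) : (G.map f).line o c N = f (G.line o c N) := by
        induction N generalizing o c with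
        | zero => simp [Gens.line]
        | succ N ih => rw [Gens.line, Gens.line, ih, Gens.map, map_mul]
      rw [h, Gens.Psi_straight _ _ _ _ _ _ hN, Gens.Psi_straight _ _ _ _ _ _ hN, line_map,
        map_mul]
  · have := ih (List.replicate j b ++ t).length (by simp at hs ⊢; omega) (o + 2)
      (G.next o ε κ) (fun b => κ b + 1) _ rfl
    have nx : (G.map f).next o (f ε) κ = f (G.next o ε κ) := by
      simp only [Gens.next, Gens.map, map_mul]
    have D_map (j : ℕ) : (G.map f).D o j = f (G.D o j) := by
      induction j with
      | zero => simp [Gens.D]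
      | succ j ih => rw [Gens.D, Gens.D, ih, map_mul]; rfl
    rw [Gens.Psi_bent, Gens.Psi_bent, nx, this, D_map, map_mul]
    cases b <;> simp [Gens.sw, Gens.map]

lemma Gens.psiStar_map (G : Gens A l) (f : A →+* A') (κ : Bool → ZMod l) (s : List Bool) :
    (G.map f).PsiStar κ s = f (G.PsiStar κ s) := by
  have := G.op.psi_map (RingHom.op f) 0 1 κ s
  rw [map_one] at this
  exact congrArg MulOpposite.unop this

/-- `v` is supported on a single residue sequence. -/
def Gens.IsWt (G : Gens A l) (n : ℕ) (v : A) : Prop := ∀ r < n, ∃ a, G.p r a * v = v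

namespace Gens.IsKLR
variable {G : Gens A l} {n : ℕ} {x : O} (H : G.IsKLR n x)
include H

lemma wt_ψ {v : A} (hv : G.IsWt n v) (r : ℕ) : G.IsWt n (G.ψ r * v) := by
  intro s hs
  by_cases hr : n ≤ r + 1
  · exact ⟨0, by simp [H.ψ_out r hr]⟩
  by_cases h1 : s = r
  · obtain ⟨a, ha⟩ := hv (r + 1) (by omega)
    subst h1; exact ⟨a, H.p_ψ_lo ha⟩
  by_cases h2 : s = r + 1
  · obtain ⟨a, ha⟩ := hv r (by omega)
    subst h2; exact ⟨a, H.p_ψ_hi ha⟩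
  · obtain ⟨a, ha⟩ := hv s hs
    exact ⟨a, H.p_ψ ha h1 h2⟩

/-- Path elements are homogeneous with respect to a ring endomorphism scaling the generators. -/
lemma psi_homog (f : A →ₐ[O] A) (z : Oˣ) (fp : ∀ r a, f (G.p r a) = G.p r a)
    (c : ZMod l → ZMod l → ℤ)
    (fψ : ∀ r a b v, G.p r a * v = v → G.p (r + 1) b * v = v →
      f (G.ψ r) * v = (z ^ c a b) • (G.ψ r * v))
    {o N : ℕ} (hN : o + N = n) {ε : A} (hε : f ε = ε)
    (wε : ∀ r < o, ∃ a, G.p r a * ε = ε) (pε : ∀ r a, G.p r a * ε = ε * G.p r a)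
    (κ : Bool → ZMod l) (s : List Bool) (hs : s.length = N) :
    G.IsWt n (G.Psi o ε κ s) ∧ ∃ d : ℤ, f (G.Psi o ε κ s) = (z ^ d) • G.Psi o ε κ s := by
  have stepψ (v : A) (hv : G.IsWt n v ∧ ∃ d : ℤ, f v = (z ^ d) • v) (r : ℕ) :
      G.IsWt n (G.ψ r * v) ∧ ∃ d : ℤ, f (G.ψ r * v) = (z ^ d) • (G.ψ r * v) := by
    refine ⟨H.wt_ψ hv.1 r, ?_⟩
    by_cases hr : n ≤ r + 1
    · exact ⟨0, by simp [H.ψ_out r hr]⟩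
    obtain ⟨d, hd⟩ := hv.2
    obtain ⟨a, ha⟩ := hv.1 r (by omega)
    obtain ⟨b, hb⟩ := hv.1 (r + 1) (by omega)
    refine ⟨d + c a b, ?_⟩
    rw [map_mul, hd, mul_smul_comm, fψ r a b v ha hb, smul_smul, zpow_add]
  induction N using Nat.strong_induction_on generalizing o ε κ s with
  | _ N ih =>
  rcases straight_or_bent s with ⟨b, h⟩ | ⟨j, b, t, rfl⟩
  · by_cases h0 : s.length = 0
    · rw [List.length_eq_zero_iff.1 h0, Gens.Psi_nil]
      exact ⟨fun r hr => wε r (by omega), 0, by simpa using hε⟩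
    · rw [h, Gens.Psi_straight _ _ _ _ _ _ h0]
      have line_map (o N : ℕ) (c : ZMod l) : f (G.line o c N) = G.line o c N := by
        induction N generalizing o c with
        | zero => simp [Gens.line]
        | succ N ih => rw [Gens.line, map_mul, ih, fp]
      refine ⟨fun r hr => ?_, 0, by simp [hε, line_map]⟩
      rcases lt_or_ge r o with h1 | h1
      · obtain ⟨a, ha⟩ := wε r h1
        exact ⟨a, by rw [← mul_assoc, ha]⟩
      · obtain ⟨i, rfl⟩ := Nat.exists_eq_add_of_le h1
        exact ⟨_, by rw [← mul_assoc, pε, mul_assoc, H.line_res (by omega)]⟩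
  · rw [Gens.Psi_bent]
    have key := ih (List.replicate j b ++ t).length (by simp at hs ⊢; omega)
      (o := o + 2) (ε := G.next o ε κ) (by simp at hs ⊢; omega)
      (by simp [Gens.next, hε, fp])
      (fun r hr => by
        rw [Gens.next]
        rcases lt_or_ge r o with h1 | h1
        · obtain ⟨a, ha⟩ := wε r h1
          exact ⟨a, by rw [← mul_assoc, ha]⟩
        · obtain rfl | rfl : r = o ∨ r = o + 1 := by omega
          · exact ⟨κ true, by rw [← mul_assoc, pε, mul_assoc, H.p_self]⟩
          · exact ⟨κ false, by rw [← mul_assoc, pε, mul_assoc, H.p_comm o, H.p_self]⟩)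
      (fun r a => by
        have : Commute (G.p r a) (G.next o ε κ) :=
          Commute.mul_right (pε r a) (Commute.mul_right (H.p_comm ..) (H.p_comm ..))
        exact this)
      (fun b => κ b + 1) _ rfl
    generalize G.Psi (o + 2) (G.next o ε κ) (fun b => κ b + 1) (List.replicate j b ++ t) = v
      at key ⊢
    have key' : G.IsWt n (G.sw o b v) ∧ ∃ d : ℤ, f (G.sw o b v) = (z ^ d) • (G.sw o b v) := by
      cases b
      · exact stepψ _ key o
      · exact key
    generalize G.sw o b v = w at key' ⊢
    clear hs ih
    induction j with
    | zero => simpa [Gens.D] using key'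
    | succ j ihj =>
      rw [Gens.D, mul_assoc]
      exact stepψ _ (ihj) _

end Gens.IsKLR

end Homogeneity

section Families

variable {O A : Type*} [CommRing O] [Ring A] [Algebra O A] {l n : ℕ} [NeZero l]

/-- A family of elements indexed by the Khovanov–Lauda–Rouquier generators. -/
structure Fam (A : Type*) (l n : ℕ) where
  e : Res l n → A
  y : Fin n → A
  ψ : Fin (n - 1) → A

/-- The affine Khovanov–Lauda–Rouquier relations, with quadratic relation deformed by `x`. -/
structure Fam.IsKLR (D : Fam A l n) (x : A) : Prop where
  orth {i j} (h : i ≠ j) : D.e i * D.e j = 0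
  idem (i) : D.e i * D.e i = D.e i
  sum1 : ∑ i, D.e i = 1
  ye (r i) : D.y r * D.e i = D.e i * D.y r
  psie (r i) : D.ψ r * D.e i = D.e (i ∘ Equiv.swap (lo r) (hi r)) * D.ψ r
  yy (r s) : D.y r * D.y s = D.y s * D.y r
  psiy (r : Fin (n - 1)) (s : Fin n) (h1 : s.val ≠ r.val) (h2 : s.val ≠ r.val + 1) :
    D.ψ r * D.y s = D.y s * D.ψ r
  pp (r s : Fin (n - 1)) (h : r.val + 1 < s.val ∨ s.val + 1 < r.val) :
    D.ψ r * D.ψ s = D.ψ s * D.ψ r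
  py (r i) : D.ψ r * (D.y (hi r) * D.e i) =
    (D.y (lo r) * D.ψ r + if i (lo r) = i (hi r) then 1 else 0) * D.e i
  yp (r i) : D.y (hi r) * (D.ψ r * D.e i) =
    (D.ψ r * D.y (lo r) + if i (lo r) = i (hi r) then 1 else 0) * D.e i
  psisq (r i) : D.ψ r * D.ψ r * D.e i =
    (if i (hi r) = i (lo r) then 0
      else if i (hi r) = i (lo r) + 1 then D.y (hi r) - D.y (lo r) - x
      else if i (hi r) = i (lo r) - 1 then D.y (lo r) - D.y (hi r) - x
      else 1) * D.e i
  braid (r s : Fin (n - 1)) (h : s.val = r.val + 1) (i) : D.ψ r * D.ψ s * D.ψ r * D.e i =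
    (D.ψ s * D.ψ r * D.ψ s +
      (if i (hi s) = i (lo r) ∧ i (lo s) = i (lo r) + 1 then 1
        else if i (hi s) = i (lo r) ∧ i (lo s) = i (lo r) - 1 then -1
        else 0)) * D.e i

/-- The strand-wise generators of a family. -/
def Fam.gen (D : Fam A l n) : Gens A l where
  p r a := if h : r < n then ∑ i : Res l n, if i ⟨r, h⟩ = a then D.e i else 0 else 0
  y r := if h : r < n then D.y ⟨r, h⟩ else 0
  ψ r := if h : r < n - 1 then D.ψ ⟨r, h⟩ else 0

namespace Fam.IsKLR
variable {D : Fam A l n} {x : A} (H : D.IsKLR x)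
include H

lemma ext {u v : A} (h : ∀ i, u * D.e i = v * D.e i) : u = v := by
  rw [← mul_one u, ← mul_one v, ← H.sum1, Finset.mul_sum, Finset.mul_sum]
  exact Finset.sum_congr rfl fun i _ => h i

lemma p_e (r : Fin n) (a i) : D.gen.p r a * D.e i = if i r = a then D.e i else 0 := by
  simp only [Fam.gen, r.2, dif_pos, Fin.eta, Finset.sum_mul, ite_mul, zero_mul]
  rw [Finset.sum_eq_single i]
  · simp [H.idem]
  · intro j _ hj
    simp [H.orth hj]
  · simp

lemma e_p (r : Fin n) (a i) : D.e i * D.gen.p r a = if i r = a then D.e i else 0 := by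
  simp only [Fam.gen, r.2, dif_pos, Fin.eta, Finset.mul_sum, mul_ite, mul_zero]
  rw [Finset.sum_eq_single i]
  · simp [H.idem]
  · intro j _ hj
    simp [H.orth hj.symm]
  · simp

lemma p_ψ_e (s : Fin n) (r : Fin (n - 1)) (a i) : D.gen.p s a * (D.ψ r * D.e i) =
    if i (Equiv.swap (lo r) (hi r) s) = a then D.ψ r * D.e i else 0 := by
  rw [H.psie, ← mul_assoc, H.p_e]
  simp [ite_mul]

lemma p_y_e (s r : Fin n) (a i) : D.gen.p s a * (D.y r * D.e i) =
    if i s = a then D.y r * D.e i else 0 := by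
  rw [H.ye, ← mul_assoc, H.p_e]
  simp [ite_mul]

lemma gen_p_out {r : ℕ} (h : n ≤ r) (a) : D.gen.p r a = 0 := by simp [Fam.gen, h.not_gt]
lemma gen_y_out {r : ℕ} (h : n ≤ r) : D.gen.y r = 0 := by simp [Fam.gen, h.not_gt]
lemma gen_ψ_out {r : ℕ} (h : n ≤ r + 1) : D.gen.ψ r = 0 := by
  simp [Fam.gen, show ¬ r < n - 1 by omega]
lemma gen_y (r : Fin n) : D.gen.y r = D.y r := by simp [Fam.gen]
lemma gen_ψ (r : Fin (n - 1)) : D.gen.ψ r = D.ψ r := by simp [Fam.gen]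

lemma p_lo_e (r : Fin (n - 1)) (a i) :
    D.gen.p r a * D.e i = if i (lo r) = a then D.e i else 0 := H.p_e (lo r) a i

lemma p_hi_e (r : Fin (n - 1)) (a i) :
    D.gen.p (r + 1) a * D.e i = if i (hi r) = a then D.e i else 0 := H.p_e (hi r) a i

lemma gen_y_lo (r : Fin (n - 1)) : D.gen.y r = D.y (lo r) := H.gen_y (lo r)
lemma gen_y_hi (r : Fin (n - 1)) : D.gen.y (r + 1) = D.y (hi r) := H.gen_y (hi r)

lemma eqv_e (r : Fin (n - 1)) (i) : D.gen.eqv r * D.e i =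
    (if i (lo r) = i (hi r) then 1 else 0) * D.e i := by
  simp only [Gens.eqv, Finset.sum_mul, mul_assoc, H.p_lo_e, H.p_hi_e, mul_ite, mul_zero]
  simp [ite_mul]

lemma gen (hl : (2 : ZMod l) ≠ 0) {x' : O} (hx : algebraMap O A x' = x) :
    D.gen.IsKLR n x' where
  p_idem r a := by
    by_cases h : r < n
    · refine H.ext fun i => ?_
      lift r to Fin n using h
      rw [mul_assoc, H.p_e]; split_ifs with h
      · simp [H.p_e, h]
      · simp
    · simp [H.gen_p_out (not_lt.1 h)]
  p_orth r a b hab := by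
    by_cases h : r < n
    · refine H.ext fun i => ?_
      lift r to Fin n using h
      rw [mul_assoc, H.p_e]; split_ifs with h
      · simp [H.p_e, h, hab.symm]
      · simp
    · simp [H.gen_p_out (not_lt.1 h)]
  p_comm r a s b := by
    by_cases h : r < n
    · by_cases h' : s < n
      · refine H.ext fun i => ?_
        lift r to Fin n using h
        lift s to Fin n using h'
        simp only [mul_assoc, H.p_e, mul_ite, mul_zero]
        split_ifs <;> rfl
      · simp [H.gen_p_out (not_lt.1 h')]
    · simp [H.gen_p_out (not_lt.1 h)]
  p_sum r h := by
    refine H.ext fun i => ?_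
    lift r to Fin n using h
    simp [Finset.sum_mul, H.p_e]
  p_out r a h := H.gen_p_out h a
  y_out r h := H.gen_y_out h
  ψ_out r h := H.gen_ψ_out h
  y_p r s a := by
    by_cases h : r < n
    · by_cases h' : s < n
      · refine H.ext fun i => ?_
        lift r to Fin n using h
        lift s to Fin n using h'
        simp only [mul_assoc, H.p_e, mul_ite, mul_zero, H.gen_y, H.p_y_e]
      · simp [H.gen_p_out (not_lt.1 h')]
    · simp [H.gen_y_out (not_lt.1 h)]
  y_comm r s := by
    by_cases h : r < n
    · by_cases h' : s < n
      · lift r to Fin n using h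
        lift s to Fin n using h'
        simp only [H.gen_y, H.yy r s]
      · simp [H.gen_y_out (not_lt.1 h')]
    · simp [H.gen_y_out (not_lt.1 h)]
  ψ_p_lo r a := by
    by_cases h : r < n - 1
    · refine H.ext fun i => ?_
      lift r to Fin (n - 1) using h
      have h2 : D.gen.p (r + 1) a * (D.ψ r * D.e i) = _ := H.p_ψ_e (hi r) r a i
      simp only [mul_assoc, H.p_lo_e, H.gen_ψ, h2, mul_ite, mul_zero, Equiv.swap_apply_right]
    · simp [H.gen_ψ_out (show n ≤ r + 1 by omega)]
  ψ_p_hi r a := by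
    by_cases h : r < n - 1
    · refine H.ext fun i => ?_
      lift r to Fin (n - 1) using h
      have h2 : D.gen.p r a * (D.ψ r * D.e i) = _ := H.p_ψ_e (lo r) r a i
      simp only [mul_assoc, H.p_hi_e, H.gen_ψ, h2, mul_ite, mul_zero, Equiv.swap_apply_left]
    · simp [H.gen_ψ_out (show n ≤ r + 1 by omega)]
  ψ_p r s a h1 h2 := by
    by_cases h : r < n - 1
    · by_cases h' : s < n
      · refine H.ext fun i => ?_
        lift r to Fin (n - 1) using h
        lift s to Fin n using h'
        have e : Equiv.swap (lo r) (hi r) s = s := Equiv.swap_apply_of_ne_of_ne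
          (fun h => h1 (congrArg Fin.val h)) (fun h => h2 (congrArg Fin.val h))
        simp only [mul_assoc, H.p_e, mul_ite, mul_zero, H.gen_ψ, H.p_ψ_e, e]
      · simp [H.gen_p_out (not_lt.1 h')]
    · simp [H.gen_ψ_out (show n ≤ r + 1 by omega)]
  ψ_y r s h1 h2 := by
    by_cases h : r < n - 1
    · by_cases h' : s < n
      · lift r to Fin (n - 1) using h
        lift s to Fin n using h'
        simp only [H.gen_ψ, H.gen_y, H.psiy _ _ h1 h2]
      · simp [H.gen_y_out (not_lt.1 h')]
    · simp [H.gen_ψ_out (show n ≤ r + 1 by omega)]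
  ψ_comm r s hrs := by
    by_cases h : r < n - 1
    · by_cases h' : s < n - 1
      · lift r to Fin (n - 1) using h
        lift s to Fin (n - 1) using h'
        simp only [H.gen_ψ, H.pp _ _ (Or.inl hrs)]
      · simp [H.gen_ψ_out (show n ≤ s + 1 by omega)]
    · simp [H.gen_ψ_out (show n ≤ r + 1 by omega)]
  ψ_y_hi r := by
    by_cases h : r < n - 1
    · refine H.ext fun i => ?_
      lift r to Fin (n - 1) using h
      rw [add_mul, H.eqv_e, H.gen_ψ, H.gen_y_lo, H.gen_y_hi, mul_assoc]
      exact (H.py r i).trans (add_mul ..)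
    · simp [H.gen_ψ_out (show n ≤ r + 1 by omega), Gens.eqv,
        H.gen_p_out (show n ≤ r + 1 by omega)]
  y_ψ_hi r := by
    by_cases h : r < n - 1
    · refine H.ext fun i => ?_
      lift r to Fin (n - 1) using h
      rw [add_mul, H.eqv_e, H.gen_ψ, H.gen_y_lo, H.gen_y_hi, mul_assoc]
      exact (H.yp r i).trans (add_mul ..)
    · simp [H.gen_ψ_out (show n ≤ r + 1 by omega), Gens.eqv,
        H.gen_p_out (show n ≤ r + 1 by omega)]
  sq_same r a := by
    by_cases h : r < n - 1
    · refine H.ext fun i => ?_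
      lift r to Fin (n - 1) using h
      have := H.psisq r i
      simp only [mul_assoc, H.p_lo_e, H.p_hi_e, mul_ite, mul_zero, H.gen_ψ] at this ⊢
      split_ifs with h3 h4 <;> simp_all
    · simp [H.gen_ψ_out (show n ≤ r + 1 by omega)]
  sq_up r a := by
    have hl1 : (1 : ZMod l) ≠ 0 := fun e => hl (by linear_combination 2 * e)
    by_cases h : r < n - 1
    · refine H.ext fun i => ?_
      lift r to Fin (n - 1) using h
      have := H.psisq r i
      rw [hx, H.gen_y_lo, H.gen_y_hi]
      simp only [mul_assoc, H.p_lo_e, H.p_hi_e, mul_ite, mul_zero, H.gen_ψ] at this ⊢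
      split_ifs with h3 h4 <;> simp_all
    · simp [H.gen_ψ_out (show n ≤ r + 1 by omega), H.gen_p_out (show n ≤ r + 1 by omega)]
  sq_down r a := by
    have hl1 : (1 : ZMod l) ≠ 0 := fun e => hl (by linear_combination 2 * e)
    have hne : a - 1 ≠ a + 1 := fun e => hl (by linear_combination -e)
    by_cases h : r < n - 1
    · refine H.ext fun i => ?_
      lift r to Fin (n - 1) using h
      have := H.psisq r i
      rw [hx, H.gen_y_lo, H.gen_y_hi]
      simp only [mul_assoc, H.p_lo_e, H.p_hi_e, mul_ite, mul_zero, H.gen_ψ] at this ⊢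
      split_ifs with h3 h4 <;> simp_all
    · simp [H.gen_ψ_out (show n ≤ r + 1 by omega), H.gen_p_out (show n ≤ r + 1 by omega)]
  sq_far r a b hb hb1 hb2 := by
    by_cases h : r < n - 1
    · refine H.ext fun i => ?_
      lift r to Fin (n - 1) using h
      have := H.psisq r i
      simp only [mul_assoc, H.p_lo_e, H.p_hi_e, mul_ite, mul_zero, H.gen_ψ] at this ⊢
      split_ifs with h3 h4 <;> simp_all
    · simp [H.gen_ψ_out (show n ≤ r + 1 by omega), H.gen_p_out (show n ≤ r + 1 by omega)]
  braid r := by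
    have hl1 : (1 : ZMod l) ≠ 0 := fun e => hl (by linear_combination 2 * e)
    by_cases h : r + 1 < n - 1
    · refine H.ext fun i => ?_
      have h1 := H.p_e ⟨r, by omega⟩
      have h2 := H.p_e ⟨r + 1, by omega⟩
      have h3 := H.p_e ⟨r + 2, by omega⟩
      have hb := H.braid ⟨r, by omega⟩ ⟨r + 1, h⟩ rfl i
      have e1 := H.gen_ψ ⟨r, by omega⟩
      have e2 := H.gen_ψ ⟨r + 1, h⟩
      have c1 : lo (⟨r, by omega⟩ : Fin (n - 1)) = ⟨r, by omega⟩ := rfl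
      have c2 : lo (⟨r + 1, h⟩ : Fin (n - 1)) = ⟨r + 1, by omega⟩ := rfl
      have c3 : hi (⟨r + 1, h⟩ : Fin (n - 1)) = ⟨r + 2, by omega⟩ := rfl
      rw [c1, c2, c3] at hb
      dsimp only at h1 h2 h3 e1 e2
      rw [e1, e2, hb, add_mul, add_mul]
      congr 1
      simp only [Gens.err, Finset.sum_mul, sub_mul, mul_assoc, h1, h2, h3, mul_ite, mul_zero]
      rw [Finset.sum_eq_single (i ⟨r, by omega⟩)]
      · have hne : i ⟨r, by omega⟩ + 1 ≠ i ⟨r, by omega⟩ - 1 :=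
          fun e => hl (by linear_combination e)
        by_cases c1 : i ⟨r + 2, by omega⟩ = i ⟨r, by omega⟩
        · by_cases c2 : i ⟨r + 1, by omega⟩ = i ⟨r, by omega⟩ + 1
          · simp [c1, c2, hne]
          · simp [c1, c2]
            split_ifs <;> simp
        · simp [c1]
      · intro b _ hb
        simp [hb.symm]
      · simp
    · simp [H.gen_ψ_out (show n ≤ r + 1 + 1 by omega), Gens.err,
        H.gen_p_out (show n ≤ r + 2 by omega)]

end Fam.IsKLR

end Families

section Presentation

variable {O A A' : Type*} [CommRing O] [Ring A] [Algebra O A] [Ring A'] {l n : ℕ} [NeZero l]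

/-- The elements of a family, indexed by the generators. -/
def Fam.elt (D : Fam A l n) : KLRGen l n → A
  | .e i => D.e i
  | .y r => D.y r
  | .psi r => D.ψ r

/-- The image of a family under a ring homomorphism. -/
def Fam.map (D : Fam A l n) (f : A →+* A') : Fam A' l n where
  e i := f (D.e i)
  y r := f (D.y r)
  ψ r := f (D.ψ r)

/-- The cyclotomic and blob conditions on a family. -/
structure Fam.IsCyc (D : Fam A l n) (hn : 2 ≤ n) (κ : Bool → ZMod l) (h : Bool → A) : Prop where
  out {i} (hi : ∀ b, i ⟨0, by omega⟩ ≠ κ b) : D.e i = 0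
  y_eq {i b} (hi : i ⟨0, by omega⟩ = κ b) : D.y ⟨0, by omega⟩ * D.e i = h b * D.e i
  bad {i b} (h0 : i ⟨0, by omega⟩ = κ b) (h1 : i ⟨1, by omega⟩ = κ b - 1) : D.e i = 0

lemma Fam.gen_map (D : Fam A l n) (f : A →+* A') : (D.map f).gen = D.gen.map f := by
  simp only [Fam.gen, Fam.map, Gens.map, apply_dite f, apply_ite f, map_sum, map_zero]

lemma Fam.IsKLR.map {D : Fam A l n} {x : A} (H : D.IsKLR x) (f : A →+* A') :
    (D.map f).IsKLR (f x) where
  orth h := by simp [Fam.map, ← map_mul, H.orth h]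
  idem i := by simp [Fam.map, ← map_mul, H.idem i]
  sum1 := by simp [Fam.map, ← map_sum, H.sum1]
  ye r i := by simp only [Fam.map, ← map_mul, H.ye]
  psie r i := by simp only [Fam.map, ← map_mul, H.psie]
  yy r s := by simp only [Fam.map, ← map_mul, H.yy r s]
  psiy r s h1 h2 := by simp only [Fam.map, ← map_mul, H.psiy r s h1 h2]
  pp r s h := by simp only [Fam.map, ← map_mul, H.pp r s h]
  py r i := by
    have := congrArg f (H.py r i)
    split_ifs at this ⊢ <;> simpa [Fam.map] using this
  yp r i := by
    have := congrArg f (H.yp r i)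
    split_ifs at this ⊢ <;> simpa [Fam.map] using this
  psisq r i := by
    have := congrArg f (H.psisq r i)
    split_ifs at this ⊢ <;> simpa [Fam.map] using this
  braid r s h i := by
    have := congrArg f (H.braid r s h i)
    split_ifs at this ⊢ <;> simpa [Fam.map] using this

lemma Fam.IsCyc.map {D : Fam A l n} {hn : 2 ≤ n} {κ : Bool → ZMod l} {h : Bool → A}
    (C : D.IsCyc hn κ h) (f : A →+* A') : (D.map f).IsCyc hn κ (fun b => f (h b)) where
  out hi := by simp [Fam.map, C.out hi]
  y_eq hi := by simp only [Fam.map, ← map_mul, C.y_eq hi]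
  bad h0 h1 := by simp [Fam.map, C.bad h0 h1]

lemma Fam.IsCyc.cyc0 {D : Fam A l n} {x : A} (H : D.IsKLR x) {hn : 2 ≤ n} {κ : Bool → ZMod l}
    {h : Bool → O} (C : D.IsCyc hn κ (fun b => algebraMap O A (h b))) : D.gen.Cyc0 κ h := by
  have h0 := H.p_e ⟨0, by omega⟩
  have h1 := H.p_e ⟨1, by omega⟩
  have h2 := H.gen_y ⟨0, by omega⟩
  dsimp only at h0 h1 h2
  refine ⟨fun hc => H.ext fun i => ?_, fun b => H.ext fun i => ?_, fun b => H.ext fun i => ?_⟩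
  · rw [h0, zero_mul]
    split_ifs with hi
    · exact C.out fun b => hi ▸ hc b
    · rfl
  · rw [mul_assoc, h0, h2, smul_mul_assoc, h0]
    split_ifs with hi
    · rw [C.y_eq hi, Algebra.smul_def]
    · simp
  · rw [mul_assoc, h1, zero_mul]
    split_ifs with hi
    · rw [h0]
      split_ifs with hi'
      · exact C.bad hi' hi
      · rfl
    · simp

lemma Fam.IsKLR.adjoin_gens {D : Fam A l n} {x : A} (H : D.IsKLR x)
    (hD : Algebra.adjoin O (Set.range D.elt) = ⊤) : Algebra.adjoin O D.gen.gens = ⊤ := by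
  rw [← top_le_iff, ← hD]
  refine Algebra.adjoin_le ?_
  rintro _ ⟨g | g | g, rfl⟩
  · have key : ∀ m ≤ n, (∑ j, if ∀ r : Fin n, r.val < m → j r = g r then D.e j else 0) ∈
        Algebra.adjoin O D.gen.gens := by
      intro m
      induction m with
      | zero => intro _; simp [H.sum1]
      | succ m ih =>
        intro hm
        convert mul_mem (ih (by omega)) (Algebra.subset_adjoin (Or.inl ⟨m, g ⟨m, hm⟩, rfl⟩) :
          D.gen.p m (g ⟨m, hm⟩) ∈ Algebra.adjoin O D.gen.gens) using 1
        have hp := H.e_p ⟨m, hm⟩ (g ⟨m, hm⟩)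
        dsimp only at hp
        rw [Finset.sum_mul]
        refine Finset.sum_congr rfl fun j _ => ?_
        rw [ite_mul, hp, zero_mul, ← ite_and]
        refine if_congr ⟨fun h => ⟨fun r hr => h r (by omega), h _ (Nat.lt_succ_self m)⟩,
          fun h r hr => ?_⟩ rfl rfl
        rcases Nat.lt_succ_iff_lt_or_eq.1 hr with hr | hr
        · exact h.1 r hr
        · obtain rfl : r = ⟨m, hm⟩ := Fin.ext hr
          exact h.2
    have := key n le_rfl
    rw [Finset.sum_eq_single g] at this
    · simpa [Fam.elt] using this
    · intro j _ hj
      rw [if_neg]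
      exact fun h => hj (funext fun r => h r r.2)
    · simp
  · exact Algebra.subset_adjoin (Or.inr (Or.inl ⟨g, (H.gen_y g).symm⟩))
  · exact Algebra.subset_adjoin (Or.inr (Or.inr ⟨g, (H.gen_ψ g).symm⟩))

/-- The universal property of the quotient. -/
lemma exists_lift {A : Type*} [Ring A] [Algebra ℂ A] {Lam : Set (ZMod l)} {bad : Set (Res l n)}
    {D : Fam A l n} (H : D.IsKLR 0)
    (h1 : ∀ (i : Res l n) (r : Fin n), r.val = 0 → i r ∉ Lam → D.e i = 0)
    (h2 : ∀ (i : Res l n) (r : Fin n), r.val = 0 → i r ∈ Lam → D.y r * D.e i = 0)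
    (h3 : ∀ i ∈ bad, D.e i = 0) :
    ∃ f : BQuot l n Lam bad →ₐ[ℂ] A, ∀ g : KLRGen l n,
      f (bmk l n Lam bad (FreeAlgebra.ι ℂ g)) = D.elt g := by
  have r1 : ∀ ⦃a b⦄, KLRRel l n Lam a b →
      FreeAlgebra.lift ℂ D.elt a = FreeAlgebra.lift ℂ D.elt b := by
    intro a b hab
    cases hab with
    | cyc1 i r hr h => simpa [eG, Fam.elt] using h1 i r hr h
    | cyc2 i r hr h => simpa [eG, yG, Fam.elt] using h2 i r hr h
    | orth i j h => simpa [eG, Fam.elt] using H.orth h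
    | idem i => simpa [eG, Fam.elt] using H.idem i
    | sum1 => simpa [eG, Fam.elt] using H.sum1
    | ye r i => simpa [eG, yG, Fam.elt] using H.ye r i
    | psie r i => simpa [eG, pG, Fam.elt] using H.psie r i
    | yy r s => simpa [yG, Fam.elt] using H.yy r s
    | psiy r s a b => simpa [yG, pG, Fam.elt] using H.psiy r s a b
    | pp r s h => simpa [pG, Fam.elt] using H.pp r s h
    | py r i =>
      have := H.py r i
      split_ifs at this ⊢ <;> simpa [eG, yG, pG, Fam.elt] using this
    | yp r i =>
      have := H.yp r i
      split_ifs at this ⊢ <;> simpa [eG, yG, pG, Fam.elt] using this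
    | psisq r i =>
      have := H.psisq r i
      split_ifs at this ⊢ <;> simpa [eG, yG, pG, Fam.elt] using this
    | braid r s h i =>
      have := H.braid r s h i
      split_ifs at this ⊢ <;> simpa [eG, pG, Fam.elt] using this
  refine ⟨RingQuot.liftAlgHom ℂ ⟨RingQuot.liftAlgHom ℂ ⟨FreeAlgebra.lift ℂ D.elt, r1⟩, ?_⟩,
    fun g => ?_⟩
  · rintro a b ⟨rfl, i, hi, rfl⟩
    rw [RingQuot.liftAlgHom_mkAlgHom_apply, map_zero]
    simpa [eG, Fam.elt] using h3 i hi
  · simp [bmk, RingQuot.liftAlgHom_mkAlgHom_apply]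

/-- The generators of the quotient. -/
def bfam (l n : ℕ) [NeZero l] (Lam : Set (ZMod l)) (bad : Set (Res l n)) :
    Fam (BQuot l n Lam bad) l n where
  e i := bmk l n Lam bad (eG l n i)
  y r := bmk l n Lam bad (yG l n r)
  ψ r := bmk l n Lam bad (pG l n r)

lemma bfam_elt (Lam : Set (ZMod l)) (bad : Set (Res l n)) (g : KLRGen l n) :
    (bfam l n Lam bad).elt g = bmk l n Lam bad (FreeAlgebra.ι ℂ g) := by
  cases g <;> rfl

lemma bmk_surjective (Lam : Set (ZMod l)) (bad : Set (Res l n)) :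
    Function.Surjective (bmk l n Lam bad) :=
  (RingQuot.mkAlgHom_surjective ℂ _).comp (RingQuot.mkAlgHom_surjective ℂ _)

lemma bfam_adjoin (Lam : Set (ZMod l)) (bad : Set (Res l n)) :
    Algebra.adjoin ℂ (Set.range (bfam l n Lam bad).elt) = ⊤ := by
  have : Set.range (bfam l n Lam bad).elt =
      bmk l n Lam bad '' Set.range (FreeAlgebra.ι ℂ) := by
    rw [← Set.range_comp]
    exact congrArg _ (funext (bfam_elt Lam bad))
  rw [this, ← AlgHom.map_adjoin, FreeAlgebra.adjoin_range_ι, Algebra.map_top,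
    (AlgHom.range_eq_top _).2 (bmk_surjective Lam bad)]

lemma bmk_rel (Lam : Set (ZMod l)) (bad : Set (Res l n)) {a b} (h : KLRRel l n Lam a b) :
    bmk l n Lam bad a = bmk l n Lam bad b :=
  congrArg (RingQuot.mkAlgHom ℂ (quotRel l n Lam bad)) (RingQuot.mkAlgHom_rel ℂ h)

lemma bfam_isKLR (Lam : Set (ZMod l)) (bad : Set (Res l n)) : (bfam l n Lam bad).IsKLR 0 where
  orth h := by simpa [bfam] using bmk_rel Lam bad (.orth _ _ h)
  idem i := by simpa [bfam] using bmk_rel Lam bad (.idem i)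
  sum1 := by simpa [bfam] using bmk_rel Lam bad .sum1
  ye r i := by simpa [bfam] using bmk_rel Lam bad (.ye r i)
  psie r i := by simpa [bfam] using bmk_rel Lam bad (.psie r i)
  yy r s := by simpa [bfam] using bmk_rel Lam bad (.yy r s)
  psiy r s h1 h2 := by simpa [bfam] using bmk_rel Lam bad (.psiy r s h1 h2)
  pp r s h := by simpa [bfam] using bmk_rel Lam bad (.pp r s h)
  py r i := by
    have := bmk_rel Lam bad (.py r i)
    split_ifs at this ⊢ <;> simpa [bfam] using this
  yp r i := by
    have := bmk_rel Lam bad (.yp r i)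
    split_ifs at this ⊢ <;> simpa [bfam] using this
  psisq r i := by
    have := bmk_rel Lam bad (.psisq r i)
    have z : ∀ a : BQuot l n Lam bad, a - 0 = a := fun a => sub_zero a
    split_ifs at this ⊢ <;> simpa [bfam, z] using this
  braid r s h i := by
    have := bmk_rel Lam bad (.braid r s h i)
    split_ifs at this ⊢ <;> simpa [bfam] using this

lemma bfam_bad {Lam : Set (ZMod l)} {bad : Set (Res l n)} {i} (hi : i ∈ bad) :
    (bfam l n Lam bad).e i = 0 := by
  have := RingQuot.mkAlgHom_rel ℂ (s := quotRel l n Lam bad) ⟨rfl, i, hi, rfl⟩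
  simpa [bfam, bmk, eG] using this

/-- The two cyclotomic residues. -/
def kap (l : ℕ) (k : ℤ) (b : Bool) : ZMod l := if b then (k : ZMod l) else -(k : ZMod l)

lemma mem_Lam2 {k : ℤ} {c : ZMod l} : c ∈ Lam2 l k ↔ ∃ b, c = kap l k b := by
  simp [Lam2, kap, or_comm]

lemma mem_badSet2 {k : ℤ} {hn : 2 ≤ n} {i : Res l n} : i ∈ badSet2 l n k hn ↔
    ∃ b, i ⟨0, by omega⟩ = kap l k b ∧ i ⟨1, by omega⟩ = kap l k b - 1 := by
  simp [badSet2, kap, or_comm]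

lemma bfam_isCyc (k : ℤ) (hn : 2 ≤ n) :
    (bfam l n (Lam2 l k) (badSet2 l n k hn)).IsCyc hn (kap l k) 0 where
  out {i} hi := by
    have : i ⟨0, by omega⟩ ∉ Lam2 l k := fun h => (mem_Lam2.1 h).elim hi
    simpa [bfam] using bmk_rel _ (badSet2 l n k hn) (.cyc1 i _ rfl this)
  y_eq {i b} hi := by
    have : i ⟨0, by omega⟩ ∈ Lam2 l k := mem_Lam2.2 ⟨b, hi⟩
    simpa [bfam] using bmk_rel _ (badSet2 l n k hn) (.cyc2 i _ rfl this)
  bad h0 h1 := bfam_bad (mem_badSet2.2 ⟨_, h0, h1⟩)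

/-- The universal property of the blob quotient. -/
lemma exists_blob_lift {A : Type*} [Ring A] [Algebra ℂ A] {k : ℤ} {hn : 2 ≤ n} {D : Fam A l n}
    (H : D.IsKLR 0) (C : D.IsCyc hn (kap l k) 0) :
    ∃ f : BQuot l n (Lam2 l k) (badSet2 l n k hn) →ₐ[ℂ] A,
      (bfam l n (Lam2 l k) (badSet2 l n k hn)).map f = D := by
  obtain ⟨f, hf⟩ := exists_lift (Lam := Lam2 l k) (bad := badSet2 l n k hn) H
    (fun i r hr h => by
      have h0 : 0 < n := by omega
      obtain rfl : r = ⟨0, h0⟩ := Fin.ext hr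
      exact C.out fun b hb => h (mem_Lam2.2 ⟨b, hb⟩))
    (fun i r hr h => by
      have h0 : 0 < n := by omega
      obtain rfl : r = ⟨0, h0⟩ := Fin.ext hr
      obtain ⟨b, hb⟩ := mem_Lam2.1 h
      simpa using C.y_eq hb)
    (fun i hi => by
      obtain ⟨b, h0, h1⟩ := mem_badSet2.1 hi
      exact C.bad h0 h1)
  refine ⟨f, ?_⟩
  unfold Fam.map
  congr 1
  · exact funext fun i => hf (.e i)
  · exact funext fun i => hf (.y i)
  · exact funext fun i => hf (.psi i)

end Presentation

section Op
open MulOpposite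
variable {A : Type*} [Ring A] {l n : ℕ} [NeZero l]

/-- The opposite family. -/
def Fam.op (D : Fam A l n) : Fam Aᵐᵒᵖ l n where
  e i := MulOpposite.op (D.e i)
  y r := MulOpposite.op (D.y r)
  ψ r := MulOpposite.op (D.ψ r)

lemma Fam.gen_op (D : Fam A l n) : D.op.gen = D.gen.op := by
  simp only [Fam.gen, Fam.op, Gens.op, apply_dite MulOpposite.op, apply_ite MulOpposite.op,
    Finset.op_sum, op_zero]

/-- The transposition exchanging positions `r` and `r + 1`. -/
def sw (r : Fin (n - 1)) : Equiv.Perm (Fin n) := Equiv.swap (lo r) (hi r)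

lemma comp_sw_sw {α : Type*} (i : Fin n → α) (r : Fin (n - 1)) : (i ∘ sw r) ∘ sw r = i := by
  funext j; simp [sw]

lemma sw_lo (r : Fin (n - 1)) : sw r (lo r) = hi r := Equiv.swap_apply_left _ _
lemma sw_hi (r : Fin (n - 1)) : sw r (hi r) = lo r := Equiv.swap_apply_right _ _
lemma sw_of_ne {r : Fin (n - 1)} {s : Fin n} (h1 : s.val ≠ r.val) (h2 : s.val ≠ r.val + 1) :
    sw r s = s :=
  Equiv.swap_apply_of_ne_of_ne (fun h => h1 (congrArg Fin.val h)) (fun h => h2 (congrArg Fin.val h))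

lemma comp_sw_of_eq {α : Type*} {i : Fin n → α} {r : Fin (n - 1)} (h : i (lo r) = i (hi r)) : i ∘ sw r = i := by
  funext j
  rcases eq_or_ne j (lo r) with rfl | h1
  · simp [sw_lo, h]
  rcases eq_or_ne j (hi r) with rfl | h2
  · simp [sw_hi, h]
  · simp [sw, Equiv.swap_apply_of_ne_of_ne h1 h2]

lemma lo_eq_hi {r s : Fin (n - 1)} (h : s.val = r.val + 1) : lo s = hi r := Fin.ext h

lemma sw_braid {α : Type*} {r s : Fin (n - 1)} (h : s.val = r.val + 1) (i : Fin n → α) :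
    ((i ∘ sw r) ∘ sw s) ∘ sw r = ((i ∘ sw s) ∘ sw r) ∘ sw s := by
  have h1 : lo r ≠ hi r := fun h => by simpa [lo, hi] using congrArg Fin.val h
  have h2 : lo r ≠ hi s := fun e => by have := congrArg Fin.val e; simp [lo, hi] at this; omega
  have h3 : hi r ≠ hi s := fun e => by have := congrArg Fin.val e; simp [hi] at this; omega
  funext j
  simp only [Function.comp, sw, lo_eq_hi h]
  congr 1
  simp only [Equiv.swap_apply_def]
  split_ifs <;> simp_all

lemma sw_braid_apply {r s : Fin (n - 1)} (h : s.val = r.val + 1) (i : Res l n) :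
    (((i ∘ sw r) ∘ sw s) ∘ sw r) (hi s) = i (lo r) ∧
    (((i ∘ sw r) ∘ sw s) ∘ sw r) (lo s) = i (lo s) ∧
    (((i ∘ sw r) ∘ sw s) ∘ sw r) (lo r) = i (hi s) := by
  have h1 : sw r (hi s) = hi s := sw_of_ne (by simp [hi]; omega) (by simp [hi]; omega)
  have h2 : sw s (lo r) = lo r := sw_of_ne (by simp [lo]; omega) (by simp [lo]; omega)
  simp only [Function.comp]
  refine ⟨?_, ?_, ?_⟩
  · rw [h1, sw_hi, lo_eq_hi h, sw_hi]
  · rw [lo_eq_hi h, sw_hi, h2, sw_lo]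
  · rw [sw_lo, ← lo_eq_hi h, sw_lo, h1]

lemma sw_braid_of_eq {r s : Fin (n - 1)} (h : s.val = r.val + 1) {i : Res l n}
    (hc : i (hi s) = i (lo r)) : ((i ∘ sw r) ∘ sw s) ∘ sw r = i := by
  obtain ⟨e1, e2, e3⟩ := sw_braid_apply h i
  funext j
  by_cases j1 : j = hi s
  · rw [j1, e1, hc]
  by_cases j2 : j = lo s
  · rw [j2, e2]
  by_cases j3 : j = lo r
  · rw [j3, e3, hc]
  simp only [Fin.ext_iff, lo, hi] at j1 j2 j3
  have h1 : sw r j = j := sw_of_ne (by omega) (by omega)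
  have h2 : sw s j = j := sw_of_ne (by omega) (by omega)
  simp only [Function.comp, h1, h2]

namespace Fam.IsKLR
variable {D : Fam A l n} {x : A} (H : D.IsKLR x)
include H

lemma e_psi (r : Fin (n - 1)) (i : Res l n) : D.e i * D.ψ r = D.ψ r * D.e (i ∘ sw r) := by
  have := H.psie r (i ∘ sw r)
  rw [← sw, comp_sw_sw] at this
  exact this.symm

lemma e_psi' (r : Fin (n - 1)) (i : Res l n) (v : A) :
    D.e i * (D.ψ r * v) = D.ψ r * (D.e (i ∘ sw r) * v) := by
  rw [← mul_assoc, H.e_psi, mul_assoc]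

lemma op (hx : ∀ i, x * D.e i = D.e i * x) : D.op.IsKLR (MulOpposite.op x) where
  orth h := unop_injective (H.orth h.symm)
  idem i := unop_injective (H.idem i)
  sum1 := unop_injective (by simpa [Fam.op] using H.sum1)
  ye r i := unop_injective (H.ye r i).symm
  psie r i := unop_injective (H.e_psi r i)
  yy r s := unop_injective (H.yy s r)
  psiy r s h1 h2 := unop_injective (H.psiy r s h1 h2).symm
  pp r s h := unop_injective (H.pp r s h).symm
  py r i := unop_injective <| by
    have := H.yp r (i ∘ sw r)
    have e : (i ∘ sw r) (lo r) = (i ∘ sw r) (hi r) ↔ i (lo r) = i (hi r) := by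
      simp [sw_lo, sw_hi, eq_comm]
    simp only [e] at this
    simp only [Fam.op, unop_mul, unop_op, unop_add, apply_ite unop, unop_one, unop_zero]
    rw [← H.ye, mul_assoc, H.e_psi, this, add_mul, mul_add, mul_assoc, H.ye, H.e_psi']
    split_ifs with h
    · simp [comp_sw_of_eq h]
    · simp
  yp r i := unop_injective <| by
    have := H.py r (i ∘ sw r)
    have e : (i ∘ sw r) (lo r) = (i ∘ sw r) (hi r) ↔ i (lo r) = i (hi r) := by
      simp [sw_lo, sw_hi, eq_comm]
    simp only [e] at this
    simp only [Fam.op, unop_mul, unop_op, unop_add, apply_ite unop, unop_one, unop_zero]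
    rw [H.e_psi, mul_assoc, ← H.ye, this, add_mul, mul_add, mul_assoc, ← H.e_psi, ← mul_assoc,
      ← mul_assoc, H.ye]
    split_ifs with h
    · simp [comp_sw_of_eq h]
    · simp
  psisq r i := unop_injective <| by
    have := H.psisq r i
    simp only [Fam.op, unop_mul, unop_op, unop_sub, apply_ite unop, unop_one, unop_zero]
    rw [H.e_psi', H.e_psi, comp_sw_sw, ← mul_assoc, this]
    split_ifs <;> simp only [sub_mul, mul_sub, H.ye, hx, mul_zero, zero_mul, one_mul, mul_one]
  braid r s h i := unop_injective <| by
    have := H.braid r s h (((i ∘ sw r) ∘ sw s) ∘ sw r)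
    simp only [Fam.op, unop_mul, unop_op, unop_add, apply_ite unop, unop_one, unop_zero, unop_neg,
      mul_add]
    rw [H.e_psi', H.e_psi', H.e_psi, H.e_psi', H.e_psi', H.e_psi, ← sw_braid h]
    simp only [← mul_assoc]
    rw [this, add_mul]
    congr 1
    obtain ⟨e1, e2, e3⟩ := sw_braid_apply h i
    rw [e1, e2, e3]
    by_cases hc : i (hi s) = i (lo r)
    · have : (((i ∘ sw r) ∘ sw s) ∘ sw r) = i := sw_braid_of_eq h hc
      rw [this, hc]
      split_ifs <;> simp
    · simp [hc, Ne.symm hc]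

end Fam.IsKLR

lemma Fam.IsCyc.op {D : Fam A l n} {x : A} (H : D.IsKLR x) {hn : 2 ≤ n} {κ : Bool → ZMod l}
    (C : D.IsCyc hn κ 0) : D.op.IsCyc hn κ 0 where
  out hi := unop_injective (C.out hi)
  y_eq hi := unop_injective <| by simpa [Fam.op, ← H.ye] using C.y_eq hi
  bad h0 h1 := unop_injective (C.bad h0 h1)

end Op

section Scale
variable {O A : Type*} [CommRing O] [Ring A] [Algebra O A] {l n : ℕ} [NeZero l]

lemma cartan_comm (a b : ZMod l) : cartan l a b = cartan l b a := by
  unfold cartan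
  by_cases h : a = b
  · simp [h]
  rw [if_neg h, if_neg (Ne.symm h)]
  refine if_congr ?_ rfl rfl
  rw [eq_sub_iff_add_eq, eq_sub_iff_add_eq, eq_comm (a := b + 1), eq_comm (a := a + 1), or_comm]

/-- The degree of a crossing on a residue sequence. -/
def cdeg (r : Fin (n - 1)) (i : Res l n) : ℤ := -cartan l (i (lo r)) (i (hi r))

/-- The family with each generator scaled by `z` to the power of its degree. -/
def Fam.scale (D : Fam A l n) (z : Oˣ) : Fam A l n where
  e := D.e
  y r := (z ^ (2 : ℤ)) • D.y r
  ψ r := ∑ i, (z ^ cdeg r i) • (D.ψ r * D.e i)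

lemma cdeg_sw (r : Fin (n - 1)) (i : Res l n) : cdeg r (i ∘ sw r) = cdeg r i := by
  simp only [cdeg, Function.comp, sw_lo, sw_hi, cartan_comm]

lemma cdeg_far {r s : Fin (n - 1)} (h : r.val + 1 < s.val ∨ s.val + 1 < r.val) (i : Res l n) :
    cdeg r (i ∘ sw s) = cdeg r i := by
  simp only [cdeg, Function.comp]
  rw [sw_of_ne (by simp [lo]; omega) (by simp [lo]; omega),
    sw_of_ne (by simp [hi]; omega) (by simp [hi]; omega)]

lemma cdeg_braid {r s : Fin (n - 1)} (h : s.val = r.val + 1) (i : Res l n) :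
    cdeg r i = cdeg s ((i ∘ sw s) ∘ sw r) ∧ cdeg s (i ∘ sw r) = cdeg r (i ∘ sw s) ∧
    cdeg r ((i ∘ sw r) ∘ sw s) = cdeg s i := by
  have h1 : sw r (hi s) = hi s := sw_of_ne (by simp [hi]; omega) (by simp [hi]; omega)
  have h2 : sw s (lo r) = lo r := sw_of_ne (by simp [lo]; omega) (by simp [lo]; omega)
  have h3 := lo_eq_hi h
  have h5 : sw s (hi r) = hi s := by rw [← h3, sw_lo]
  simp only [cdeg, Function.comp, h1, h2, h5, sw_lo, sw_hi, h3, cartan_comm, and_self]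

namespace Fam.IsKLR
variable {D : Fam A l n} {x : A} (H : D.IsKLR x) (z : Oˣ)
include H

lemma scale_ψ (r : Fin (n - 1)) {i : Res l n} {v : A} (hv : D.e i * v = v) :
    (D.scale z).ψ r * v = (z ^ cdeg r i) • (D.ψ r * v) := by
  rw [Fam.scale, Finset.sum_mul, Finset.sum_eq_single i]
  · rw [smul_mul_assoc, mul_assoc, hv]
  · intro j _ hj
    rw [smul_mul_assoc, mul_assoc, ← hv, ← mul_assoc (D.e j), H.orth hj, zero_mul, mul_zero,
      smul_zero]
  · simp

lemma wt_psi (r : Fin (n - 1)) {i : Res l n} {v : A} (hv : D.e i * v = v) :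
    D.e (i ∘ sw r) * (D.ψ r * v) = D.ψ r * v := by
  rw [H.e_psi', comp_sw_sw, hv]

lemma wt_y (r : Fin n) {i : Res l n} {v : A} (hv : D.e i * v = v) :
    D.e i * (D.y r * v) = D.y r * v := by
  rw [← mul_assoc, ← H.ye, mul_assoc, hv]

end Fam.IsKLR

lemma Fam.IsKLR.scale {D : Fam A l n} (H : D.IsKLR 0) (hl : (1 : ZMod l) ≠ 0) (z : Oˣ) :
    (D.scale z).IsKLR 0 where
  orth h := H.orth h
  idem i := H.idem i
  sum1 := H.sum1
  ye r i := by simp only [Fam.scale, smul_mul_assoc, mul_smul_comm, H.ye]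
  psie r i := H.ext fun j => by
    have e' : (D.scale z).e = D.e := rfl
    rw [mul_assoc, mul_assoc, H.scale_ψ z r (H.idem j), e']
    rcases eq_or_ne i j with rfl | hj
    · rw [H.idem, mul_smul_comm, H.scale_ψ z r (H.idem i)]
      congr 1
      exact (H.wt_psi r (H.idem i)).symm
    · rw [H.orth hj, mul_zero, mul_smul_comm, ← mul_assoc, ← H.psie, mul_assoc, H.orth hj,
        mul_zero, smul_zero]
  yy r s := by simp only [Fam.scale, smul_mul_assoc, mul_smul_comm, H.yy r s]
  psiy r s h1 h2 := H.ext fun i => by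
    have e : (D.scale z).y s = (z ^ (2 : ℤ)) • D.y s := rfl
    rw [mul_assoc, mul_assoc, H.scale_ψ z r (H.idem i), e, smul_mul_assoc, smul_mul_assoc,
      mul_smul_comm, H.scale_ψ z r (H.wt_y s (H.idem i)), mul_smul_comm, ← mul_assoc,
      ← mul_assoc, H.psiy r s h1 h2, smul_comm]
  pp r s h := H.ext fun i => by
    rw [mul_assoc, mul_assoc, H.scale_ψ z s (H.idem i), H.scale_ψ z r (H.idem i),
      mul_smul_comm, mul_smul_comm, H.scale_ψ z r (H.wt_psi s (H.idem i)),
      H.scale_ψ z s (H.wt_psi r (H.idem i)), cdeg_far h, cdeg_far h.symm, smul_comm, ← mul_assoc,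
      ← mul_assoc, H.pp r s h]
  py r i := by
    have e s : (D.scale z).y s = (z ^ (2 : ℤ)) • D.y s := rfl
    have e' : (D.scale z).e = D.e := rfl
    have := H.py r i
    rw [add_mul, mul_assoc] at this
    rw [e, e, e', add_mul, smul_mul_assoc, smul_mul_assoc, smul_mul_assoc, mul_smul_comm,
      H.scale_ψ z r (H.wt_y _ (H.idem i)), mul_assoc, H.scale_ψ z r (H.idem i), mul_smul_comm,
      this, smul_add, smul_add]
    congr 1
    split_ifs with h
    · rw [smul_smul, ← zpow_add]
      simp [cdeg, cartan, h]
    · simp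
  yp r i := by
    have e s : (D.scale z).y s = (z ^ (2 : ℤ)) • D.y s := rfl
    have e' : (D.scale z).e = D.e := rfl
    have := H.yp r i
    rw [add_mul, mul_assoc] at this
    rw [e, e, e', add_mul, smul_mul_assoc, H.scale_ψ z r (H.idem i), mul_smul_comm, mul_smul_comm,
      this, smul_mul_assoc, mul_assoc, H.scale_ψ z r (H.wt_y _ (H.idem i)), smul_add, smul_add]
    congr 1
    split_ifs with h
    · rw [smul_smul, ← zpow_add]
      simp [cdeg, cartan, h]
    · simp
  psisq r i := by
    have e s : (D.scale z).y s = (z ^ (2 : ℤ)) • D.y s := rfl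
    have e' : (D.scale z).e = D.e := rfl
    have := H.psisq r i
    rw [mul_assoc] at this
    rw [e, e, e', mul_assoc, H.scale_ψ z r (H.idem i), mul_smul_comm,
      H.scale_ψ z r (H.wt_psi r (H.idem i)), smul_smul, ← zpow_add, cdeg_sw, this]
    simp only [sub_zero, ← smul_sub]
    split_ifs with h1 h2 h3
    · simp
    · rw [smul_mul_assoc]
      congr 2
      rw [cdeg, cartan, if_neg (Ne.symm h1), if_pos (Or.inl h2)]
      rfl
    · rw [smul_mul_assoc]
      congr 2
      rw [cdeg, cartan, if_neg (Ne.symm h1), if_pos (Or.inr h3)]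
      rfl
    · rw [cdeg, cartan, if_neg (Ne.symm h1), if_neg (not_or.2 ⟨h2, h3⟩)]
      simp
  braid r s h i := by
    have e' : (D.scale z).e = D.e := rfl
    have := H.braid r s h i
    obtain ⟨h1, h2, h3⟩ := cdeg_braid h i
    rw [e', add_mul]
    rw [add_mul] at this
    simp only [mul_assoc] at this ⊢
    have w := H.idem i
    rw [H.scale_ψ z r w, H.scale_ψ z s w, mul_smul_comm, mul_smul_comm,
      mul_smul_comm, mul_smul_comm,
      H.scale_ψ z s (H.wt_psi r w), H.scale_ψ z r (H.wt_psi s w), mul_smul_comm, mul_smul_comm,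
      H.scale_ψ z r (H.wt_psi s (H.wt_psi r w)), H.scale_ψ z s (H.wt_psi r (H.wt_psi s w)),
      this, ← h1, ← h2, h3, smul_add, smul_add, smul_add]
    congr 1
    · simp only [smul_smul]
      congr 1
      rw [mul_left_comm, mul_comm (z ^ cdeg r i), mul_left_comm]
    · simp only [smul_smul, ← zpow_add]
      have key (h1 : i (hi s) = i (lo r))
          (h2 : i (lo s) = i (lo r) + 1 ∨ i (lo s) = i (lo r) - 1) :
          cdeg r i + (cdeg s (i ∘ sw r) + cdeg s i) = 0 := by
        have e1 : sw r (hi s) = hi s := sw_of_ne (by simp [hi]; omega) (by simp [hi]; omega)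
        have e2 : sw r (lo s) = lo r := by rw [lo_eq_hi h, sw_hi]
        have ne : i (lo s) ≠ i (lo r) := by rcases h2 with h2 | h2 <;> simp [h2, hl]
        simp only [cdeg, Function.comp, e1, e2, h1, cartan_comm (i (lo s)), ← lo_eq_hi h]
        simp [cartan, ne.symm, h2]
      split_ifs with c1 c2
      · rw [key c1.1 (Or.inl c1.2), zpow_zero, one_smul]
      · rw [key c2.1 (Or.inr c2.2), zpow_zero, one_smul]
      · simp

lemma Fam.IsCyc.scale {D : Fam A l n} {hn : 2 ≤ n} {κ : Bool → ZMod l}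
    (C : D.IsCyc hn κ 0) (z : Oˣ) : (D.scale z).IsCyc hn κ 0 where
  out hi := C.out hi
  y_eq hi := by
    have := C.y_eq hi
    simp only [Fam.scale, smul_mul_assoc, this, Pi.zero_apply, zero_mul, smul_zero]
  bad h0 h1 := C.bad h0 h1

end Scale

section Generic
variable {K : Type*} [Field K] {l n : ℕ} [NeZero l]

/-- Diagonal coefficient of a crossing in the seminormal form. -/
def cA (z w : ZMod l × K) : K := if z.1 = w.1 then (w.2 - z.2)⁻¹ else 0

/-- Off-diagonal coefficient of a crossing in the seminormal form. -/
def cB (X : K) (z w : ZMod l × K) : K :=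
  if z.1 = w.1 then -(w.2 - z.2)⁻¹ else if w.1 = z.1 + 1 then w.2 - z.2 - X else 1

lemma cA_swap (z w : ZMod l × K) : cA w z = - cA z w := by
  unfold cA
  by_cases h : z.1 = w.1
  · rw [if_pos h, if_pos h.symm, ← inv_neg, neg_sub]
  · rw [if_neg h, if_neg (Ne.symm h), neg_zero]

lemma sub_ne_zero_of_fst {z w : ZMod l × K} (h : z ≠ w) (h1 : z.1 = w.1) : w.2 - z.2 ≠ 0 :=
  fun e => h (Prod.ext h1 (sub_eq_zero.1 e).symm)

lemma cA_mul {z w : ZMod l × K} (h : z ≠ w) :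
    cA z w * (w.2 - z.2) = if z.1 = w.1 then 1 else 0 := by
  unfold cA
  split_ifs with h1
  · exact inv_mul_cancel₀ (sub_ne_zero_of_fst h h1)
  · simp

lemma cAB_sq (hl : (2 : ZMod l) ≠ 0) (X : K) {z w : ZMod l × K} (h : z ≠ w) :
    cA z w * cA z w + cB X z w * cB X w z = if w.1 = z.1 then 0
      else if w.1 = z.1 + 1 then w.2 - z.2 - X
      else if w.1 = z.1 - 1 then z.2 - w.2 - X else 1 := by
  unfold cA cB
  have e1 : z.1 = w.1 + 1 ↔ w.1 = z.1 - 1 := by rw [eq_sub_iff_add_eq, eq_comm]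
  simp only [eq_comm (a := w.1) (b := z.1), e1]
  split_ifs with h1 h2 h3
  · have := sub_ne_zero_of_fst h h1
    rw [← neg_sub w.2 z.2, inv_neg]; ring
  · exact absurd (h2.symm.trans h3) fun e => hl (by linear_combination e)
  all_goals ring

lemma braid_e (hl : (2 : ZMod l) ≠ 0) (X : K) {u v w : ZMod l × K} (huv : u ≠ v) (huw : u ≠ w)
    (hvw : v ≠ w) :
    cA u v * cA v w * cA u v + cB X u v * cA u w * cB X v u =
      cA v w * cA u v * cA v w + cB X v w * cA u w * cB X w v +
      (if w.1 = u.1 ∧ v.1 = u.1 + 1 then 1 else if w.1 = u.1 ∧ v.1 = u.1 - 1 then -1 else 0) := by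
  have hl1 : (1 : ZMod l) ≠ 0 := fun e => hl (by linear_combination 2 * e)
  have h12 := sub_ne_zero_of_fst huv
  have h13 := sub_ne_zero_of_fst huw
  have h23 := sub_ne_zero_of_fst hvw
  obtain ⟨a, y1⟩ := u
  obtain ⟨b, y2⟩ := v
  obtain ⟨c, y3⟩ := w
  simp only at h12 h13 h23
  unfold cA cB
  simp only
  by_cases h2 : a = b
  · subst h2
    by_cases h3 : a = c
    · subst h3
      have g1 := h12 rfl
      have g2 := h13 rfl
      have g3 := h23 rfl
      have g4 : y1 - y2 ≠ 0 := sub_ne_zero.2 (sub_ne_zero.1 g1).symm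
      have g5 : y2 - y3 ≠ 0 := sub_ne_zero.2 (sub_ne_zero.1 g3).symm
      have ga : a ≠ a - 1 := fun e => hl1 (by linear_combination e)
      simp [hl1, ga]
      field_simp
      ring
    · simp [h3, Ne.symm h3]
  · by_cases h3 : a = c
    · subst h3
      have g2 := h13 rfl
      have e1 : a = b + 1 ↔ b = a - 1 := by rw [eq_sub_iff_add_eq, eq_comm]
      simp only [h2, Ne.symm h2, e1, if_true, if_false, true_and]
      split_ifs with h4 h5
      · exact absurd (h4.symm.trans h5) fun e => hl (by linear_combination e)
      · field_simp; ring
      · field_simp; ring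
      · ring
    · by_cases h4 : b = c
      · subst h4; simp [h2, Ne.symm h2]
      · simp [h2, h3, h4, Ne.symm h3]

lemma braid_r (X : K) {u v w : ZMod l × K} (huv : u ≠ v) (huw : u ≠ w)
    (hvw : v ≠ w) :
    cA u v * cA v w * cB X u v + cB X u v * cA u w * cA v u = cA v w * cB X u v * cA u w := by
  have h12 := sub_ne_zero_of_fst huv
  have h13 := sub_ne_zero_of_fst huw
  have h23 := sub_ne_zero_of_fst hvw
  have : cA u v * cA v w + cA u w * cA v u = cA v w * cA u w := by
    obtain ⟨a, y1⟩ := u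
    obtain ⟨b, y2⟩ := v
    obtain ⟨c, y3⟩ := w
    simp only at h12 h13 h23
    unfold cA
    simp only
    by_cases h2 : a = b
    · subst h2
      by_cases h3 : a = c
      · subst h3
        have g1 := h12 rfl
        have g2 := h13 rfl
        have g3 := h23 rfl
        have g4 : y1 - y2 ≠ 0 := sub_ne_zero.2 (sub_ne_zero.1 g1).symm
        simp
        field_simp
        ring
      · simp [h3]
    · by_cases h3 : a = c
      · subst h3; simp [h2, Ne.symm h2]
      · simp [h2, h3]
  linear_combination cB X u v * this

lemma braid_s (X : K) {u v w : ZMod l × K} (huv : u ≠ v) (huw : u ≠ w)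
    (hvw : v ≠ w) :
    cA u v * cB X v w * cA u w = cA v w * cA u v * cB X v w + cB X v w * cA u w * cA w v := by
  have h12 := sub_ne_zero_of_fst huv
  have h13 := sub_ne_zero_of_fst huw
  have h23 := sub_ne_zero_of_fst hvw
  have : cA u v * cA u w = cA v w * cA u v + cA u w * cA w v := by
    obtain ⟨a, y1⟩ := u
    obtain ⟨b, y2⟩ := v
    obtain ⟨c, y3⟩ := w
    simp only at h12 h13 h23
    unfold cA
    simp only
    by_cases h2 : a = b
    · subst h2
      by_cases h3 : a = c
      · subst h3
        have g1 := h12 rfl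
        have g2 := h13 rfl
        have g3 := h23 rfl
        have g4 : y2 - y3 ≠ 0 := sub_ne_zero.2 (sub_ne_zero.1 g3).symm
        simp
        field_simp
        ring
      · simp [h3, Ne.symm h3]
    · by_cases h3 : a = c
      · subst h3; simp [h2, Ne.symm h2]
      · simp [h2, h3]
  linear_combination cB X v w * this

end Generic

section Semi
variable {K : Type*} [Field K] {l n : ℕ} [NeZero l] {T T' : Type*}

/-- The seminormal operators on functions on `T`, for contents `z` and transpositions `τ`. -/
def semi (X : K) (z : T → Fin n → ZMod l × K) (τ : Fin (n - 1) → T → T) :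
    Fam (Module.End K (T → K)) l n where
  e i :=
    { toFun f t := if (fun j => (z t j).1) = i then f t else 0
      map_add' f g := by funext t; dsimp only [Pi.add_apply]; split_ifs <;> simp
      map_smul' c f := by funext t; dsimp only [Pi.smul_apply, RingHom.id_apply]; split_ifs <;> simp }
  y r :=
    { toFun f t := (z t r).2 * f t
      map_add' f g := by funext t; simp [mul_add]
      map_smul' c f := by funext t; simp [mul_left_comm] }
  ψ r :=
    { toFun f t := cA (z t (lo r)) (z t (hi r)) * f t + cB X (z t (lo r)) (z t (hi r)) * f (τ r t)
      map_add' f g := by funext t; simp only [Pi.add_apply]; ring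
      map_smul' c f := by
        funext t; simp only [Pi.smul_apply, RingHom.id_apply, smul_eq_mul]; ring }

section
variable (X : K) (z : T → Fin n → ZMod l × K) (τ : Fin (n - 1) → T → T) (f : T → K) (t : T)

lemma semi_e (i : Res l n) :
    (semi X z τ).e i f t = if (fun j => (z t j).1) = i then f t else 0 := rfl
lemma semi_y (r : Fin n) : (semi X z τ).y r f t = (z t r).2 * f t := rfl
lemma semi_ψ (r : Fin (n - 1)) : (semi X z τ).ψ r f t =
    cA (z t (lo r)) (z t (hi r)) * f t + cB X (z t (lo r)) (z t (hi r)) * f (τ r t) := rfl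
end

/-- Exchange of two adjacent entries of an injective sequence. -/
def esw (r : Fin (n - 1)) (z : Fin n ↪ ZMod l × K) : Fin n ↪ ZMod l × K :=
  (sw r).toEmbedding.trans z

lemma esw_apply (r : Fin (n - 1)) (z : Fin n ↪ ZMod l × K) (j : Fin n) : esw r z j = z (sw r j) :=
  rfl

lemma esw_esw (r : Fin (n - 1)) (z : Fin n ↪ ZMod l × K) : esw r (esw r z) = z := by
  ext1 j; simp [esw, sw]

lemma lo_ne_hi (r : Fin (n - 1)) : lo r ≠ hi r :=
  fun h => by simpa [lo, hi] using congrArg Fin.val h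

lemma esw_e_iff (r : Fin (n - 1)) (z : Fin n ↪ ZMod l × K) (i : Res l n) :
    (fun j => (esw r z j).1) = i ↔ (fun j => (z j).1) = i ∘ sw r := by
  constructor
  · rintro rfl; funext j; simp [esw_apply, sw]
  · intro h
    have := congrArg (· ∘ sw r) h
    simp only [comp_sw_sw] at this
    exact this

lemma ite_apply (P : Prop) [Decidable P] (u v : Module.End K (T → K)) (F : T → K) (t : T) :
    (if P then u else v) F t = if P then u F t else v F t := by
  split_ifs <;> rfl

lemma exists_semi_e (X : K) (z : T → Fin n → ZMod l × K) (τ : Fin (n - 1) → T → T) (i : Res l n)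
    (f : T → K) : ∃ F, (semi X z τ).e i f = F ∧ ∀ t, (fun j => (z t j).1) ≠ i → F t = 0 :=
  ⟨_, rfl, fun t h => by rw [semi_e, if_neg h]⟩

lemma esw_braid (r s : Fin (n - 1)) (h : s.val = r.val + 1) (z : Fin n ↪ ZMod l × K) :
    esw r (esw s (esw r z)) = esw s (esw r (esw s z)) := by
  ext1 j
  exact congrFun (sw_braid h z) j

lemma semi_isKLR_emb (hl : (2 : ZMod l) ≠ 0) (X : K) :
    (semi X (fun z : Fin n ↪ ZMod l × K => (z : Fin n → ZMod l × K)) esw).IsKLR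
      (algebraMap K _ X) where
  orth {i j} h := by
    ext1 f; funext t
    simp only [Module.End.mul_apply, semi_e]
    split_ifs <;> simp_all
  idem i := by
    ext1 f; funext t
    simp only [Module.End.mul_apply, semi_e]
    split_ifs <;> simp_all
  sum1 := by
    ext1 f; funext t
    simp [LinearMap.sum_apply, Finset.sum_apply, semi_e]
  ye r i := by
    ext1 f; funext t
    simp only [Module.End.mul_apply, semi_e, semi_y, mul_ite, mul_zero]
  psie r i := by
    ext1 f; funext t
    simp only [Module.End.mul_apply, semi_e, semi_ψ, esw_e_iff]
    rw [← sw]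
    by_cases h : (t (lo r)).1 = (t (hi r)).1
    · have h1 : (fun j => (t j).1) = i ↔ (fun j => (t j).1) = i ∘ sw r := by
        rw [← esw_e_iff]
        have := comp_sw_of_eq (i := fun j => (t j).1) h
        exact Eq.congr_left this.symm
      by_cases h2 : (fun j => (t j).1) = i ∘ sw r
      · rw [if_pos (h1.2 h2), if_pos h2, if_pos h2]
      · rw [if_neg (mt h1.1 h2), if_neg h2, if_neg h2]; ring
    · simp only [cA, if_neg h, zero_mul, zero_add, mul_ite, mul_zero, ite_self]
  yy r s := by
    ext1 f; funext t
    simp only [Module.End.mul_apply, semi_y]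
    ring
  psiy r s h1 h2 := by
    ext1 f; funext t
    simp only [Module.End.mul_apply, semi_y, semi_ψ, esw_apply, sw_of_ne h1 h2]
    ring
  pp r s h := by
    ext1 f; funext t
    have h1 : sw r (lo s) = lo s := sw_of_ne (by simp [lo]; omega) (by simp [lo]; omega)
    have h2 : sw r (hi s) = hi s := sw_of_ne (by simp [hi]; omega) (by simp [hi]; omega)
    have h3 : sw s (lo r) = lo r := sw_of_ne (by simp [lo]; omega) (by simp [lo]; omega)
    have h4 : sw s (hi r) = hi r := sw_of_ne (by simp [hi]; omega) (by simp [hi]; omega)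
    have h5 : esw r (esw s t) = esw s (esw r t) := by
      ext1 j
      simp only [esw_apply]
      by_cases h6 : j = lo r
      · subst h6; rw [h3, sw_lo, h4]
      by_cases h7 : j = hi r
      · subst h7; rw [h4, sw_hi, h3]
      have h8 : sw r j = j := sw_of_ne (fun e => h6 (Fin.ext e)) (fun e => h7 (Fin.ext e))
      by_cases h9 : j = lo s
      · subst h9; rw [h1, sw_lo, h2]
      by_cases h10 : j = hi s
      · subst h10; rw [h2, sw_hi, h1]
      have h11 : sw s j = j := sw_of_ne (fun e => h9 (Fin.ext e)) (fun e => h10 (Fin.ext e))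
      rw [h8, h11, h8]
    simp only [Module.End.mul_apply, semi_ψ, esw_apply, h1, h2, h3, h4, h5]
    ring
  py r i := by
    ext1 f; funext t
    obtain ⟨F, hF, hF0⟩ := exists_semi_e X
      (fun z : Fin n ↪ ZMod l × K => (z : Fin n → ZMod l × K)) esw i f
    have := cA_mul (t.injective.ne (lo_ne_hi r))
    simp only [Module.End.mul_apply, LinearMap.add_apply, hF, semi_ψ, semi_y, Pi.add_apply,
      ite_apply, esw_apply, sw_hi, Module.End.one_apply, LinearMap.zero_apply, Pi.zero_apply]
    by_cases h : (fun j => (t j).1) = i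
    · subst h
      simp only
      split_ifs at this ⊢
      all_goals linear_combination F t * this
    · rw [hF0 t h, ite_self]; ring
  yp r i := by
    ext1 f; funext t
    obtain ⟨F, hF, hF0⟩ := exists_semi_e X
      (fun z : Fin n ↪ ZMod l × K => (z : Fin n → ZMod l × K)) esw i f
    have := cA_mul (t.injective.ne (lo_ne_hi r))
    simp only [Module.End.mul_apply, LinearMap.add_apply, hF, semi_ψ, semi_y, Pi.add_apply,
      ite_apply, esw_apply, sw_lo, Module.End.one_apply, LinearMap.zero_apply, Pi.zero_apply]
    by_cases h : (fun j => (t j).1) = i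
    · subst h
      simp only
      split_ifs at this ⊢
      all_goals linear_combination F t * this
    · rw [hF0 t h, ite_self]; ring
  psisq r i := by
    ext1 f; funext t
    obtain ⟨F, hF, hF0⟩ := exists_semi_e X
      (fun z : Fin n ↪ ZMod l × K => (z : Fin n → ZMod l × K)) esw i f
    have h1 := cAB_sq hl X (t.injective.ne (lo_ne_hi r))
    have h2 := cA_swap (t (lo r)) (t (hi r))
    simp only [Module.End.mul_apply, LinearMap.sub_apply, hF, semi_ψ, semi_y, Pi.sub_apply,
      ite_apply, esw_apply, sw_lo, sw_hi, esw_esw, Module.End.one_apply, LinearMap.zero_apply,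
      Pi.zero_apply, h2, Module.algebraMap_end_apply, Pi.smul_apply, smul_eq_mul]
    by_cases h : (fun j => (t j).1) = i
    · subst h
      simp only
      split_ifs at h1 ⊢
      all_goals linear_combination F t * h1
    · rw [hF0 t h]
      split_ifs <;> ring
  braid r s h i := by
    ext1 f; funext t
    obtain ⟨F, hF, hF0⟩ := exists_semi_e X
      (fun z : Fin n ↪ ZMod l × K => (z : Fin n → ZMod l × K)) esw i f
    have g1 : t (lo r) ≠ t (hi r) := t.injective.ne (lo_ne_hi r)
    have g2 : t (lo r) ≠ t (hi s) := t.injective.ne fun e => by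
      have := congrArg Fin.val e
      simp [lo, hi] at this; omega
    have g3 : t (hi r) ≠ t (hi s) := t.injective.ne fun e => by
      have := congrArg Fin.val e
      simp [hi] at this; omega
    have e1 := braid_e hl X g1 g2 g3
    have e2 := braid_r X g1 g2 g3
    have e3 := braid_s X g1 g2 g3
    have e4 := esw_braid r s h t
    have h1 : sw r (hi s) = hi s := sw_of_ne (by simp [hi]; omega) (by simp [hi]; omega)
    have h2 : sw s (lo r) = lo r := sw_of_ne (by simp [lo]; omega) (by simp [lo]; omega)
    have h3 : sw s (hi r) = hi s := by rw [← lo_eq_hi h, sw_lo]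
    have h4 : sw s (hi s) = hi r := by rw [sw_hi, lo_eq_hi h]
    simp only [Module.End.mul_apply, LinearMap.add_apply, hF, semi_ψ, Pi.add_apply,
      ite_apply, esw_apply, sw_lo, sw_hi, esw_esw, Module.End.one_apply, LinearMap.zero_apply,
      Pi.zero_apply, LinearMap.neg_apply, Pi.neg_apply, lo_eq_hi h, h1, h2, h3, h4, e4]
    by_cases hi : (fun j => (t j).1) = i
    · subst hi
      simp only
      split_ifs at e1 ⊢
      all_goals linear_combination F t * e1 + F (esw r t) * e2 + F (esw s t) * e3
    · rw [hF0 t hi] at *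
      have e5 : (if i (Statement1.hi s) = i (lo r) ∧ i (Statement1.hi r) = i (lo r) + 1 then (0 : K)
        else if i (Statement1.hi s) = i (lo r) ∧ i (Statement1.hi r) = i (lo r) - 1 then -0 else 0) = 0 := by
        simp
      rw [e5]
      linear_combination F (esw r t) * e2 + F (esw s t) * e3

end Semi

section Transfer
variable {A A' : Type*} [Ring A] [Ring A'] {l n : ℕ} [NeZero l]

lemma Fam.IsKLR.of_injective {D : Fam A l n} {x : A} {f : A →+* A'}
    (H : (D.map f).IsKLR (f x)) (hf : Function.Injective f) : D.IsKLR x where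
  orth h := hf (by simpa [Fam.map] using H.orth h)
  idem i := hf (by simpa [Fam.map] using H.idem i)
  sum1 := hf (by simpa [Fam.map] using H.sum1)
  ye r i := hf (by simpa [Fam.map] using H.ye r i)
  psie r i := hf (by simpa [Fam.map] using H.psie r i)
  yy r s := hf (by simpa [Fam.map] using H.yy r s)
  psiy r s h1 h2 := hf (by simpa [Fam.map] using H.psiy r s h1 h2)
  pp r s h := hf (by simpa [Fam.map] using H.pp r s h)
  py r i := hf (by
    have := H.py r i
    split_ifs at this ⊢ <;> simpa [Fam.map] using this)
  yp r i := hf (by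
    have := H.yp r i
    split_ifs at this ⊢ <;> simpa [Fam.map] using this)
  psisq r i := hf (by
    have := H.psisq r i
    split_ifs at this ⊢ <;> simpa [Fam.map] using this)
  braid r s h i := hf (by
    have := H.braid r s h i
    split_ifs at this ⊢ <;> simpa [Fam.map] using this)

lemma Fam.IsCyc.of_injective {D : Fam A l n} {hn : 2 ≤ n} {κ : Bool → ZMod l} {h : Bool → A}
    {f : A →+* A'} (C : (D.map f).IsCyc hn κ (fun b => f (h b))) (hf : Function.Injective f) :
    D.IsCyc hn κ h where
  out hi := hf (by simpa [Fam.map] using C.out hi)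
  y_eq hi := hf (by simpa [Fam.map] using C.y_eq hi)
  bad h0 h1 := hf (by simpa [Fam.map] using C.bad h0 h1)

variable {K V V' : Type*} [Field K] [AddCommGroup V] [Module K V] [AddCommGroup V'] [Module K V']

/-- Pairs of endomorphisms intertwined by a linear map. -/
def intertwined (R : V →ₗ[K] V') : Subring (Module.End K V × Module.End K V') where
  carrier := {p | ∀ F, R (p.1 F) = p.2 (R F)}
  mul_mem' {p q} hp hq F := (hp (q.1 F)).trans (congrArg p.2 (hq F))
  one_mem' F := rfl
  add_mem' {p q} hp hq F := by
    simp only [Prod.fst_add, Prod.snd_add, LinearMap.add_apply, map_add, hp F, hq F]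
  zero_mem' F := by simp
  neg_mem' {p} hp F := by simp only [Prod.fst_neg, Prod.snd_neg, LinearMap.neg_apply, map_neg, hp F]

lemma Fam.IsKLR.of_intertwined {D : Fam (Module.End K V) l n} {D' : Fam (Module.End K V') l n}
    {x : Module.End K V} {x' : Module.End K V'} (H : D.IsKLR x) {R : V →ₗ[K] V'}
    (hR : Function.Surjective R) (hx : (x, x') ∈ intertwined R)
    (he : ∀ i, (D.e i, D'.e i) ∈ intertwined R) (hy : ∀ r, (D.y r, D'.y r) ∈ intertwined R)
    (hψ : ∀ r, (D.ψ r, D'.ψ r) ∈ intertwined R) : D'.IsKLR x' := by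
  let P : Fam (intertwined R) l n :=
    ⟨fun i => ⟨_, he i⟩, fun r => ⟨_, hy r⟩, fun r => ⟨_, hψ r⟩⟩
  let f := (RingHom.fst (Module.End K V) (Module.End K V')).comp (intertwined R).subtype
  let g := (RingHom.snd (Module.End K V) (Module.End K V')).comp (intertwined R).subtype
  have hf : Function.Injective f := by
    rintro ⟨⟨a, a'⟩, ha⟩ ⟨⟨b, b'⟩, hb⟩ (rfl : a = b)
    obtain rfl : a' = b' := by
      ext w
      obtain ⟨F, rfl⟩ := hR w
      exact (ha F).symm.trans (hb F)
    rfl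
  exact (Fam.IsKLR.of_injective (D := P) (x := ⟨_, hx⟩) (f := f) H hf).map g

lemma semi_isKLR (hl : (2 : ZMod l) ≠ 0) {T : Type*} (X : K) (z : T → (Fin n ↪ ZMod l × K))
    (hz : Function.Injective z) (τ : Fin (n - 1) → T → T)
    (hτ : ∀ r t, cB X (z t (lo r)) (z t (hi r)) = 0 ∨ z (τ r t) = esw r (z t)) :
    (semi X (fun t => z t) τ).IsKLR (algebraMap K _ X) := by
  refine (semi_isKLR_emb (n := n) hl X).of_intertwined
    (R := LinearMap.funLeft K K z) (LinearMap.funLeft_surjective_of_injective K K z hz)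
    (fun F => ?_) (fun i F => ?_) (fun r F => ?_) (fun r F => ?_)
  · rfl
  · rfl
  · rfl
  · funext t
    simp only [LinearMap.funLeft_apply, semi_ψ]
    rcases hτ r t with h | h
    · rw [h, zero_mul, zero_mul]
    · rw [h]

end Transfer

section Paths
variable {K : Type*} [Field K] [CharZero K] {l n : ℕ} [NeZero l]

/-- The number of earlier steps of a path in the same direction as the given one. -/
def cnt (t : Fin n → Bool) (r : Fin n) : ℕ := (Finset.univ.filter fun j => j < r ∧ t j = t r).card

/-- The deformation parameters of the two components. -/
def shift (X : K) (b : Bool) : K := if b then 2⁻¹ * X else 0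

/-- The deformed contents along a path. -/
def cont (κ : Bool → ZMod l) (X : K) (t : Fin n → Bool) (r : Fin n) : ZMod l × K :=
  (κ (t r) + cnt t r, shift X (t r) + cnt t r * X)

lemma shift_add_inj {X : K} (hX : X ≠ 0) {b b' : Bool} {c c' : ℤ}
    (h : shift X b + c * X = shift X b' + c' * X) : b = b' ∧ c = c' := by
  have key : ∀ d : ℤ, (2⁻¹ : K) ≠ d := fun d e => by
    have h1 : (1 : K) = ((2 * d : ℤ) : K) := by push_cast; rw [← e]; norm_num
    have h2 : (1 : ℤ) = 2 * d := by exact_mod_cast h1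
    omega
  cases b <;> cases b' <;> simp only [shift, if_true, Bool.false_eq_true, if_false] at h
  · exact ⟨rfl, by
      have := mul_right_cancel₀ hX (by linear_combination h : (c : K) * X = c' * X)
      exact_mod_cast this⟩
  · have := mul_right_cancel₀ hX
      (by push_cast; linear_combination h : ((c - c' : ℤ) : K) * X = 2⁻¹ * X)
    exact absurd this.symm (key _)
  · have := mul_right_cancel₀ hX
      (by push_cast; linear_combination -h : ((c' - c : ℤ) : K) * X = 2⁻¹ * X)
    exact absurd this.symm (key _)
  · exact ⟨rfl, by
      have := mul_right_cancel₀ hX (by linear_combination h : (c : K) * X = c' * X)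
      exact_mod_cast this⟩

lemma cont_snd_inj {X : K} (hX : X ≠ 0) {κ : Bool → ZMod l} {t t' : Fin n → Bool} {r r' : Fin n}
    (h : (cont κ X t r).2 = (cont κ X t' r').2) : t r = t' r' ∧ cnt t r = cnt t' r' := by
  have := shift_add_inj (c := cnt t r) (c' := cnt t' r') hX (by simpa [cont] using h)
  exact ⟨this.1, by exact_mod_cast this.2⟩

lemma cnt_lt {t : Fin n → Bool} {r s : Fin n} (h : r < s) (ht : t r = t s) : cnt t r < cnt t s := by
  refine Finset.card_lt_card (Finset.ssubset_iff_subset_ne.2 ⟨fun j hj => ?_, fun e => ?_⟩)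
  · simp only [Finset.mem_filter, Finset.mem_univ, true_and] at hj ⊢
    exact ⟨hj.1.trans h, hj.2.trans ht⟩
  · have : r ∈ Finset.univ.filter fun j => j < s ∧ t j = t s := by simp [h, ht]
    rw [← e] at this
    simp at this

lemma cont_injective {X : K} (hX : X ≠ 0) (κ : Bool → ZMod l) (t : Fin n → Bool) :
    Function.Injective (cont κ X t) := fun r s h => by
  obtain ⟨h1, h2⟩ := cont_snd_inj hX (congrArg Prod.snd h)
  rcases lt_trichotomy r s with h3 | h3 | h3
  · exact absurd h2 (cnt_lt h3 h1).ne
  · exact h3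
  · exact absurd h2 (cnt_lt h3 h1.symm).ne'

/-- The deformed contents of a path, as an injective sequence. -/
def contEmb (κ : Bool → ZMod l) {X : K} (hX : X ≠ 0) (t : Fin n → Bool) : Fin n ↪ ZMod l × K :=
  ⟨cont κ X t, cont_injective hX κ t⟩

lemma contEmb_injective (κ : Bool → ZMod l) {X : K} (hX : X ≠ 0) :
    Function.Injective (contEmb (n := n) κ hX) := fun t t' h => by
  funext r
  exact (cont_snd_inj hX (congrArg (fun z : Fin n ↪ ZMod l × K => (z r).2) h)).1

lemma sw_lt_sw (r : Fin (n - 1)) {i j : Fin n} (h : ¬ (i = lo r ∧ j = hi r))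
    (h' : ¬ (i = hi r ∧ j = lo r)) : sw r i < sw r j ↔ i < j := by
  simp only [sw, Equiv.swap_apply_def]
  simp only [Fin.ext_iff, lo, hi] at h h'
  split_ifs <;> simp only [Fin.ext_iff, Fin.lt_def, lo, hi] at * <;> omega

lemma cnt_sw {r : Fin (n - 1)} {t : Fin n → Bool} (h : t (lo r) ≠ t (hi r)) (s : Fin n) :
    cnt (t ∘ sw r) s = cnt t (sw r s) := by
  refine Finset.card_equiv (sw r) fun j => ?_
  simp only [Finset.mem_filter, Finset.mem_univ, true_and, Function.comp]
  refine and_congr_left fun h1 => (sw_lt_sw r ?_ ?_).symm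
  · rintro ⟨rfl, rfl⟩
    rw [sw_lo, sw_hi] at h1
    exact h h1.symm
  · rintro ⟨rfl, rfl⟩
    rw [sw_lo, sw_hi] at h1
    exact h h1

lemma cnt_hi {r : Fin (n - 1)} {t : Fin n → Bool} (h : t (lo r) = t (hi r)) :
    cnt t (hi r) = cnt t (lo r) + 1 := by
  unfold cnt
  rw [← Finset.card_insert_of_notMem (a := lo r)]
  · congr 1
    ext j
    simp only [Finset.mem_filter, Finset.mem_univ, true_and, Finset.mem_insert, h]
    constructor
    · rintro ⟨h1, h2⟩
      simp only [Fin.ext_iff, Fin.lt_def, lo, hi] at h1 ⊢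
      exact (Nat.lt_succ_iff_lt_or_eq.1 h1).symm.imp_right fun h3 => ⟨h3, h2⟩
    · rintro (rfl | ⟨h1, h2⟩)
      · exact ⟨by simp [Fin.lt_def, lo, hi], h⟩
      · exact ⟨h1.trans (by simp [Fin.lt_def, lo, hi]), h2⟩
  · simp

variable {X : K} (κ : Bool → ZMod l)

lemma contEmb_sw (hX : X ≠ 0) {r : Fin (n - 1)} {t : Fin n → Bool} (h : t (lo r) ≠ t (hi r)) :
    contEmb κ hX (t ∘ sw r) = esw r (contEmb κ hX t) := by
  ext1 s
  rw [esw_apply]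
  change cont κ X (t ∘ sw r) s = cont κ X t (sw r s)
  simp [cont, cnt_sw h]

lemma cB_cont_ne_zero (hX : X ≠ 0) {r : Fin (n - 1)} {t : Fin n → Bool} (h : t (lo r) ≠ t (hi r)) :
    cB X (cont κ X t (lo r)) (cont κ X t (hi r)) ≠ 0 := by
  unfold cB
  split_ifs with h1 h2
  · exact neg_ne_zero.2 (inv_ne_zero (sub_ne_zero_of_fst
      ((cont_injective hX κ t).ne (lo_ne_hi r)) h1))
  · intro e
    refine h.symm (shift_add_inj (c := cnt t (hi r)) (c' := cnt t (lo r) + 1) hX ?_).1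
    simp only [cont] at e
    push_cast
    linear_combination e
  · exact one_ne_zero

/-- The seminormal family on functions on paths. -/
def pathFam (κ : Bool → ZMod l) (X : K) : Fam (Module.End K ((Fin n → Bool) → K)) l n :=
  semi X (cont κ X) (fun r t => t ∘ sw r)

lemma pathFam_isKLR (hX : X ≠ 0) (hl : (2 : ZMod l) ≠ 0) :
    (pathFam (n := n) κ X).IsKLR (algebraMap K _ X) := by
  refine semi_isKLR hl X (contEmb κ hX) (contEmb_injective κ hX) _ fun r t => ?_
  by_cases h : t (lo r) = t (hi r)
  · left
    have h1 := cnt_hi h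
    have hl1 : (1 : ZMod l) ≠ 0 := fun e => hl (by linear_combination 2 * e)
    change cB X (cont κ X t (lo r)) (cont κ X t (hi r)) = 0
    have h2 : cont κ X t (hi r) =
        ((cont κ X t (lo r)).1 + 1, (cont κ X t (lo r)).2 + X) := by
      simp only [cont, h1, h, Nat.cast_add, Nat.cast_one]
      ext <;> ring
    rw [h2]
    simp [cB, hl1]
  · exact .inr (contEmb_sw κ hX h)

lemma pathFam_isCyc (hl : (2 : ZMod l) ≠ 0) (S : Sep κ) (hn : 2 ≤ n) :
    (pathFam (n := n) κ X).IsCyc hn κ (fun b => algebraMap K _ (shift X b)) := by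
  have h0 : ∀ t : Fin n → Bool, cnt t ⟨0, by omega⟩ = 0 := fun t => by
    simp [cnt, Fin.lt_def]
  have ext0 : ∀ {i : Res l n}, (∀ t, (fun j => (cont κ X t j).1) ≠ i) →
      (pathFam κ X).e i = 0 := fun h => LinearMap.ext fun f => funext fun t => by
    rw [pathFam, semi_e, if_neg (h t)]; rfl
  have e0 : ∀ {i : Res l n} {t}, (fun j => (cont κ X t j).1) = i → i ⟨0, by omega⟩ =
      κ (t ⟨0, by omega⟩) := by
    rintro i t rfl
    simp [cont, h0]
  have inj : ∀ {b c}, κ b = κ c → b = c := fun {b c} e => by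
    by_contra h
    obtain rfl : c = !b := by cases b <;> cases c <;> simp_all
    exact (S b).1 e
  refine ⟨fun hi => ext0 fun t ht => hi _ (e0 ht), fun {i b} hi => ?_, fun {i b} hi hi' => ?_⟩
  · refine LinearMap.ext fun f => funext fun t => ?_
    simp only [Module.End.mul_apply, pathFam, semi_e, semi_y, Module.algebraMap_end_apply,
      Pi.smul_apply, smul_eq_mul]
    split_ifs with ht
    · obtain rfl := inj (hi.symm.trans (e0 ht))
      simp [cont, h0]
    · simp
  · refine ext0 fun t ht => ?_
    obtain rfl := inj (hi.symm.trans (e0 ht))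
    let r : Fin (n - 1) := ⟨0, by omega⟩
    have h1 : κ (t (Statement1.hi r)) + cnt t (Statement1.hi r) = κ (t (lo r)) - 1 :=
      (congrFun ht (Statement1.hi r)).trans hi'
    have h2 : cnt t (lo r) = 0 := h0 t
    by_cases h : t (lo r) = t (Statement1.hi r)
    · rw [cnt_hi h, h2, h] at h1
      exact hl (by push_cast at h1; linear_combination h1)
    · have h3 : cnt t (Statement1.hi r) = 0 := by
        rw [cnt, Finset.card_eq_zero, Finset.filter_eq_empty_iff]
        rintro j - ⟨h4, h5⟩
        obtain rfl : j = lo r := Fin.ext (by simp [Fin.lt_def, lo, Statement1.hi, r] at h4 ⊢; omega)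
        exact h h5
      have h4 : t (Statement1.hi r) = !t (lo r) := by
        cases h5 : t (lo r) <;> cases h6 : t (Statement1.hi r) <;> simp_all
      rw [h3, h4] at h1
      exact (S (t (lo r))).2 (by push_cast at h1; linear_combination -h1)

end Paths

section Cells
variable {O A A' : Type*} [CommRing O] [Ring A] [Algebra O A] [Ring A'] {l n : ℕ} [NeZero l]

/-- The path with steps in the first direction at the entries of `S`. -/
def path (S : Finset (Fin n)) (j : Fin n) : Bool := decide (j ∈ S)

/-- The path of `S` as a list. -/
def word (S : Finset (Fin n)) : List Bool := List.ofFn (path S)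

lemma length_word (S : Finset (Fin n)) : (word S).length = n := List.length_ofFn

lemma height_eq (s : List Bool) : height s = 2 * s.count true - s.length := by
  rw [height, ← List.count_true_add_count_false (l := s)]
  push_cast; ring

lemma count_word (S : Finset (Fin n)) : (word S).count true = S.card := by
  rw [← Multiset.coe_count, word, ← Fin.univ_val_map, Multiset.count_map, Finset.card]
  congr 1
  rw [← Finset.filter_val]
  congr 1
  ext j
  simp [path]

lemma height_word {lam : Bi n} (S : Std n lam) : height (word S.1) = fBi lam := by
  have := lam.2
  rw [height_eq, count_word, length_word, S.2, fBi]
  omega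

lemma exists_word (s : List Bool) (hs : s.length = n) : ∃ S : Finset (Fin n), word S = s := by
  subst hs
  refine ⟨Finset.univ.filter fun j => s.get j = true, ?_⟩
  conv_rhs => rw [← List.ofFn_get s]
  rw [word]
  congr 1
  funext j
  simp [path]

lemma fBi_injective : Function.Injective (fBi (n := n)) := fun lam mu h => by
  have h1 := lam.2
  have h2 := mu.2
  simp only [fBi] at h
  ext <;> omega

lemma exists_std (s : List Bool) (hs : s.length = n) :
    ∃ (lam : Bi n) (S : Std n lam), word S.1 = s := by
  obtain ⟨S, rfl⟩ := exists_word s hs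
  exact ⟨⟨(S.card, n - S.card), by have := S.card_le_univ; simp at this ⊢; omega⟩, ⟨S, rfl⟩, rfl⟩

lemma exists_std_of_height {lam : Bi n} (s : List Bool) (hs : s.length = n)
    (h : height s = fBi lam) : ∃ S : Std n lam, word S.1 = s := by
  obtain ⟨mu, S, rfl⟩ := exists_std s hs
  obtain rfl := fBi_injective ((height_word S).symm.trans h)
  exact ⟨S, rfl⟩

/-- The path elements of a family. -/
def Fam.up (D : Fam A l n) (κ : Bool → ZMod l) (S : Finset (Fin n)) : A :=
  D.gen.Psi 0 1 κ (word S)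

/-- The mirrored path elements of a family. -/
def Fam.down (D : Fam A l n) (κ : Bool → ZMod l) (S : Finset (Fin n)) : A :=
  D.gen.PsiStar κ (word S)

lemma Fam.up_map (D : Fam A l n) (f : A →+* A') (κ : Bool → ZMod l) (S : Finset (Fin n)) :
    (D.map f).up κ S = f (D.up κ S) := by
  have := D.gen.psi_map f 0 1 κ (word S)
  rwa [map_one, ← D.gen_map f] at this

lemma Fam.down_map (D : Fam A l n) (f : A →+* A') (κ : Bool → ZMod l) (S : Finset (Fin n)) :
    (D.map f).down κ S = f (D.down κ S) := by
  have := D.gen.psiStar_map f κ (word S)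
  rwa [← D.gen_map f] at this

lemma Fam.up_op (D : Fam A l n) (κ : Bool → ZMod l) (S : Finset (Fin n)) :
    D.op.up κ S = MulOpposite.op (D.down κ S) := by
  rw [Fam.up, D.gen_op]; rfl

/-- Index set of the cellular basis. -/
abbrev Idx (n : ℕ) := Σ lam : Bi n, Std n lam × Std n lam

/-- The candidate cellular basis of a family. -/
def Fam.cell (D : Fam A l n) (κ : Bool → ZMod l) (p : Idx n) : A :=
  D.up κ p.2.1.1 * D.down κ p.2.2.1

lemma Fam.cell_map (D : Fam A l n) (f : A →+* A') (κ : Bool → ZMod l) (p : Idx n) :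
    (D.map f).cell κ p = f (D.cell κ p) := by
  simp only [Fam.cell, D.up_map, D.down_map, map_mul]

lemma Fam.cell_le (D : Fam A l n) (κ : Bool → ZMod l) (f : ℤ) : D.gen.Cell O κ n f ≤
    Submodule.span O {x | ∃ (mu : Bi n) (_ : |fBi mu| < f) (u v : Std n mu),
      x = D.cell κ ⟨mu, u, v⟩} := by
  refine Submodule.span_le.2 ?_
  rintro _ ⟨u, w, hu, hw, h, hf, rfl⟩
  obtain ⟨mu, U, rfl⟩ := exists_std u hu
  obtain ⟨W, rfl⟩ := exists_std_of_height w hw (h.symm.trans (height_word U))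
  exact Submodule.subset_span ⟨mu, by rwa [← height_word U], U, W, rfl⟩

variable {D : Fam A l n} {x : O} {hn : 2 ≤ n} {κ : Bool → ZMod l} {h : Bool → O}

lemma Fam.IsKLR.span_cell (H : D.IsKLR (algebraMap O A x))
    (C : D.IsCyc hn κ (fun b => algebraMap O A (h b))) (S : Sep κ) (hl : (2 : ZMod l) ≠ 0)
    (hD : Algebra.adjoin O (Set.range D.elt) = ⊤) :
    Submodule.span O (Set.range (D.cell κ)) = ⊤ := by
  refine top_le_iff.1 fun a _ => ?_
  have := D.cell_le κ _ ((H.gen hl rfl).mem_cell (C.cyc0 H) S (H.adjoin_gens hD) hl a)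
  refine Submodule.span_mono ?_ this
  rintro _ ⟨mu, -, u, v, rfl⟩
  exact ⟨_, rfl⟩

/-- A family regarded in the subalgebra which it generates. -/
def Fam.res (O : Type*) [CommRing O] [Algebra O A] (D : Fam A l n) :
    Fam (Algebra.adjoin O (Set.range D.elt)) l n where
  e i := ⟨D.e i, Algebra.subset_adjoin ⟨.e i, rfl⟩⟩
  y r := ⟨D.y r, Algebra.subset_adjoin ⟨.y r, rfl⟩⟩
  ψ r := ⟨D.ψ r, Algebra.subset_adjoin ⟨.psi r, rfl⟩⟩

lemma Fam.res_elt (D : Fam A l n) (g : KLRGen l n) : ((D.res O).elt g : A) = D.elt g := by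
  cases g <;> rfl

lemma Fam.res_adjoin (D : Fam A l n) : Algebra.adjoin O (Set.range (D.res O).elt) = ⊤ := by
  rw [← Algebra.adjoin_adjoin_coe_preimage (s := Set.range D.elt)]
  congr 1
  ext a
  constructor
  · rintro ⟨g, rfl⟩
    exact ⟨g, (D.res_elt g).symm⟩
  · rintro ⟨g, hg⟩
    exact ⟨g, Subtype.ext ((D.res_elt g).trans hg)⟩

lemma Fam.IsKLR.res (H : D.IsKLR (algebraMap O A x)) :
    (D.res O).IsKLR (algebraMap O _ x) :=
  .of_injective (f := (Algebra.adjoin O (Set.range D.elt)).val.toRingHom) H Subtype.val_injective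

lemma Fam.IsCyc.res (C : D.IsCyc hn κ (fun b => algebraMap O A (h b))) :
    (D.res O).IsCyc hn κ (fun b => algebraMap O _ (h b)) :=
  .of_injective (f := (Algebra.adjoin O (Set.range D.elt)).val.toRingHom) C Subtype.val_injective

lemma Fam.res_cell (D : Fam A l n) (κ : Bool → ZMod l) (p : Idx n) :
    ((D.res O).cell κ p : A) = D.cell κ p :=
  ((D.res O).cell_map (Algebra.adjoin O (Set.range D.elt)).val.toRingHom κ p).symm

lemma Fam.IsKLR.adjoin_le_span_cell (H : D.IsKLR (algebraMap O A x))
    (C : D.IsCyc hn κ (fun b => algebraMap O A (h b))) (S : Sep κ) (hl : (2 : ZMod l) ≠ 0) :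
    Subalgebra.toSubmodule (Algebra.adjoin O (Set.range D.elt)) ≤
      Submodule.span O (Set.range (D.cell κ)) := by
  intro a ha
  have h1 := Fam.IsKLR.span_cell H.res C.res S hl D.res_adjoin
  have h2 : (⟨a, ha⟩ : Algebra.adjoin O (Set.range D.elt)) ∈
    Submodule.span O (Set.range ((D.res O).cell κ)) := h1 ▸ Submodule.mem_top
  have h3 := Submodule.mem_map_of_mem
    (f := (Algebra.adjoin O (Set.range D.elt)).val.toLinearMap) h2
  rw [Submodule.map_span, ← Set.range_comp] at h3
  have h4 : (⇑(Algebra.adjoin O (Set.range D.elt)).val.toLinearMap ∘ (D.res O).cell κ) =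
    D.cell κ := funext (D.res_cell κ)
  rwa [h4] at h3

end Cells

section Units
variable {K : Type*} [Field K]

lemma mem_of_separates {T : Type*} [Fintype T] [DecidableEq T] {P : Subalgebra K (T → K)}
    (hP : ∀ s t, s ≠ t → ∃ f ∈ P, f s ≠ f t) (t : T) : Pi.single t 1 ∈ P := by
  have h1 : ∀ s, ∃ g ∈ P, g t = 1 ∧ (s ≠ t → g s = 0) := fun s => by
    by_cases h : s = t
    · exact ⟨1, P.one_mem, rfl, fun h' => absurd h h'⟩
    · obtain ⟨f, hf, hst⟩ := hP s t h
      refine ⟨(f t - f s)⁻¹ • (f - algebraMap K _ (f s)),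
        P.smul_mem (P.sub_mem hf (P.algebraMap_mem _)) _, ?_, fun _ => ?_⟩
      · simp [inv_mul_cancel₀ (sub_ne_zero.2 hst.symm)]
      · simp
  choose g hg h1 h2 using h1
  have : (Pi.single t 1 : T → K) = ∏ s, g s := by
    funext u
    rw [Finset.prod_apply]
    by_cases h : u = t
    · subst h; simp [h1]
    · rw [Pi.single_eq_of_ne h, (Finset.prod_eq_zero (Finset.mem_univ u) (h2 u h) : ∏ c, g c u = 0)]
  rw [this]
  exact P.prod_mem fun s _ => hg s

variable {T : Type*} [DecidableEq T]

/-- Matrix units acting on functions. -/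
def eunit (K : Type*) [Field K] (t s : T) : Module.End K (T → K) :=
  (LinearMap.single K (fun _ => K) t).comp (LinearMap.proj s)

lemma eunit_apply (t s : T) (f : T → K) (u : T) : eunit K t s f u = if u = t then f s else 0 := by
  simp [eunit, Pi.single_apply]

lemma eunit_mul (t s u : T) : eunit K t s * eunit K s u = eunit K t u := by
  refine LinearMap.ext fun f => funext fun v => ?_
  simp [Module.End.mul_apply, eunit_apply]

lemma eunit_eq (t : T) : eunit K t t = Algebra.lmul K (T → K) (Pi.single t 1) := by
  refine LinearMap.ext fun f => funext fun v => ?_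
  rw [eunit_apply]
  simp only [Algebra.coe_lmul_eq_mul, LinearMap.mul_apply', Pi.mul_apply, Pi.single_apply]
  split_ifs with h
  · rw [h, one_mul]
  · rw [zero_mul]

lemma eunit_linearIndependent [Finite T] :
    LinearIndependent K (fun p : T × T => eunit K p.1 p.2) := by
  have := Fintype.ofFinite T
  rw [Fintype.linearIndependent_iff]
  rintro g hg ⟨t, s⟩
  have := congrFun (LinearMap.congr_fun hg (Pi.single s 1)) t
  simp only [LinearMap.sum_apply, LinearMap.smul_apply, Finset.sum_apply, Pi.smul_apply,
    eunit_apply, smul_eq_mul, Pi.single_apply, LinearMap.zero_apply, Pi.zero_apply] at this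
  rw [Finset.sum_eq_single (t, s)] at this
  · simpa using this
  · rintro ⟨t', s'⟩ - hne
    by_cases h : t = t'
    · subst h
      have : s' ≠ s := fun h => hne (by rw [h])
      simp [this]
    · simp [h]
  · simp

variable [CharZero K] {l n : ℕ} [NeZero l] {X : K} (hX : X ≠ 0) (κ : Bool → ZMod l)

lemma eunit_self_mem (hX : X ≠ 0) (t : Fin n → Bool) :
    eunit K t t ∈ Algebra.adjoin K (Set.range (pathFam (n := n) κ X).elt) := by
  rw [eunit_eq]
  refine mem_of_separates (P := (Algebra.adjoin K (Set.range (pathFam κ X).elt)).comap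
    (Algebra.lmul K ((Fin n → Bool) → K))) (fun s t h => ?_) t
  obtain ⟨r, hr⟩ := Function.ne_iff.1 h
  refine ⟨fun u => (cont κ X u r).2, ?_, fun e => hr (cont_snd_inj hX e).1⟩
  exact Algebra.subset_adjoin ⟨.y r, rfl⟩

lemma eunit_sw_mem (hX : X ≠ 0) (t : Fin n → Bool) (r : Fin (n - 1)) :
    eunit K t (t ∘ sw r) ∈ Algebra.adjoin K (Set.range (pathFam (n := n) κ X).elt) := by
  by_cases h : t (lo r) = t (hi r)
  · rw [comp_sw_of_eq h]
    exact eunit_self_mem κ hX t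
  · have h0 := cB_cont_ne_zero κ hX h
    have h1 : t ≠ t ∘ sw r := fun e => h (by
      conv_lhs => rw [e]
      rw [Function.comp, sw_lo])
    have : eunit K t (t ∘ sw r) = (cB X (cont κ X t (lo r)) (cont κ X t (hi r)))⁻¹ •
        (eunit K t t * (pathFam (n := n) κ X).ψ r * eunit K (t ∘ sw r) (t ∘ sw r)) := by
      refine LinearMap.ext fun f => funext fun v => ?_
      simp only [LinearMap.smul_apply, Module.End.mul_apply, Pi.smul_apply, eunit_apply,
        pathFam, semi_ψ, h1, if_false, if_true, mul_zero, zero_add, smul_eq_mul]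
      split_ifs
      · rw [inv_mul_cancel_left₀ h0]
      · rw [mul_zero]
    rw [this]
    exact Subalgebra.smul_mem _ (mul_mem (mul_mem (eunit_self_mem κ hX _)
      (Algebra.subset_adjoin ⟨.psi r, rfl⟩)) (eunit_self_mem κ hX _)) _

lemma eunit_perm_mem (hX : X ≠ 0) (σ : Equiv.Perm (Fin n)) (t : Fin n → Bool) :
    eunit K t (t ∘ σ) ∈ Algebra.adjoin K (Set.range (pathFam (n := n) κ X).elt) := by
  have hσ : σ ∈ Submonoid.closure (Set.range (sw (n := n))) := by
    rcases n with _ | n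
    · rw [Subsingleton.elim σ 1]; exact one_mem _
    · have := Equiv.Perm.mclosure_swap_castSucc_succ n
      have h2 : (Set.range fun i : Fin n => Equiv.swap i.castSucc i.succ) =
        Set.range (sw (n := n + 1)) := rfl
      rw [← h2, this]
      exact Submonoid.mem_top _
  induction hσ using Submonoid.closure_induction generalizing t with
  | mem σ h =>
    obtain ⟨r, rfl⟩ := h
    exact eunit_sw_mem κ hX t r
  | one => exact eunit_self_mem κ hX t
  | mul σ τ _ _ h1 h2 =>
    have := mul_mem (h1 t) (h2 (t ∘ σ))
    rwa [eunit_mul] at this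

lemma exists_perm {lam : Bi n} (S T : Std n lam) : ∃ σ : Equiv.Perm (Fin n),
    path T.1 = path S.1 ∘ σ := by
  have e : Nonempty (∀ c, {j // path T.1 j = c} ≃ {j // path S.1 j = c}) := by
    have h (S : Std n lam) (c : Bool) : Fintype.card {j // path S.1 j = c} =
        if c then lam.1.1 else n - lam.1.1 := by
      rw [Fintype.card_subtype]
      cases c
      · have : (Finset.univ.filter fun j => path S.1 j = false) = S.1ᶜ := by ext j; simp [path]
        rw [this, Finset.card_compl, S.2, Fintype.card_fin]
        rfl
      · have : (Finset.univ.filter fun j => path S.1 j = true) = S.1 := by ext j; simp [path]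
        rw [this, S.2]
        rfl
    exact ⟨fun c => Fintype.equivOfCardEq ((h T c).trans (h S c).symm)⟩
  obtain ⟨e⟩ := e
  exact ⟨Equiv.ofFiberEquiv e, funext fun j => (Equiv.ofFiberEquiv_map e j).symm⟩

lemma path_injective : Function.Injective (path (n := n)) := fun S T h => by
  ext j
  simpa [path] using congrFun h j

instance : Fintype (Bi n) := Fintype.subtype (Finset.HasAntidiagonal.antidiagonal n) fun p => by simp

lemma pathFam_linearIndependent (hX : X ≠ 0) (S : Sep κ) (hl : (2 : ZMod l) ≠ 0) (hn : 2 ≤ n) :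
    LinearIndependent K ((pathFam (n := n) κ X).cell κ) := by
  have h1 := (pathFam_isKLR (n := n) κ hX hl).adjoin_le_span_cell
    (pathFam_isCyc (X := X) κ hl S hn) S hl
  have h2 : LinearIndependent K fun p : Idx n => eunit K (path p.2.1.1) (path p.2.2.1) := by
    refine (eunit_linearIndependent (K := K)).comp
      (fun p : Idx n => (path p.2.1.1, path p.2.2.1)) ?_
    rintro ⟨lam, s, t⟩ ⟨mu, u, v⟩ h
    simp only [Prod.mk.injEq] at h
    have hs := path_injective h.1
    have ht := path_injective h.2
    obtain rfl : lam = mu := fBi_injective (by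
      rw [← height_word s, ← height_word u, hs])
    rw [Subtype.ext hs, Subtype.ext ht]
  rw [linearIndependent_iff_card_le_finrank_span]
  rw [linearIndependent_iff_card_eq_finrank_span] at h2
  rw [h2]
  refine Submodule.finrank_mono (Submodule.span_le.2 ?_)
  rintro _ ⟨⟨lam, s, t⟩, rfl⟩
  obtain ⟨σ, hσ⟩ := exists_perm s t
  refine h1 ?_
  simp only [hσ]
  exact eunit_perm_mem κ hX σ _

end Units

section Degenerate
variable {l n : ℕ} [NeZero l]
open TensorProduct Polynomial

lemma exists_independent_of_algebra {O A : Type*} [CommRing O] [Ring A] [Algebra O A] [Algebra O ℂ]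
    {D : Fam A l n} {x : O} {hn : 2 ≤ n} {κ : Bool → ZMod l} {h : Bool → O}
    (H : D.IsKLR (algebraMap O A x)) (C : D.IsCyc hn κ (fun b => algebraMap O A (h b)))
    (S : Sep κ) (hl : (2 : ZMod l) ≠ 0) (hx : algebraMap O ℂ x = 0)
    (hh : ∀ b, algebraMap O ℂ (h b) = 0) (hi : LinearIndependent O (D.cell κ)) :
    ∃ D' : Fam (ℂ ⊗[O] Algebra.adjoin O (Set.range D.elt)) l n,
      D'.IsKLR 0 ∧ D'.IsCyc hn κ 0 ∧ LinearIndependent ℂ (D'.cell κ) := by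
  let E := Algebra.adjoin O (Set.range D.elt)
  let f : E →ₐ[O] ℂ ⊗[O] E := Algebra.TensorProduct.includeRight
  have h0 : ∀ c : O, algebraMap O ℂ c = 0 → f (algebraMap O E c) = 0 := fun c hc => by
    rw [AlgHom.commutes, Algebra.TensorProduct.algebraMap_apply, hc, TensorProduct.zero_tmul]
  refine ⟨(D.res O).map f.toRingHom, ?_, ?_, ?_⟩
  · have := (Fam.IsKLR.res H).map f.toRingHom
    rwa [show f.toRingHom _ = 0 from h0 x hx] at this
  · have := (Fam.IsCyc.res C).map f.toRingHom
    rwa [show (fun b => f.toRingHom _) = 0 from funext fun b => h0 _ (hh b)] at this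
  · have hi' : LinearIndependent O ((D.res O).cell κ) := by
      refine LinearIndependent.of_comp E.val.toLinearMap ?_
      convert hi
      exact funext (D.res_cell κ)
    let b : Module.Basis (Idx n) O E := .mk hi' (H.res.span_cell C.res S hl D.res_adjoin).ge
    have h1 : ((D.res O).map f.toRingHom).cell κ = b.baseChange ℂ := by
      funext p
      rw [Fam.cell_map, Module.Basis.baseChange_apply, Module.Basis.mk_apply]
      rfl
    rw [h1]
    exact (b.baseChange ℂ).linearIndependent

lemma exists_independent {κ : Bool → ZMod l} (S : Sep κ) (hl : (2 : ZMod l) ≠ 0) (hn : 2 ≤ n) :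
    ∃ (A : Type) (_ : Ring A) (_ : Algebra ℂ A) (D : Fam A l n),
      D.IsKLR 0 ∧ D.IsCyc hn κ 0 ∧ LinearIndependent ℂ (D.cell κ) := by
  let K := FractionRing ℂ[X]
  let V := (Fin n → Bool) → K
  let _ : Algebra ℂ[X] ℂ := (aeval (0 : ℂ)).toAlgebra
  have : CharZero K := charZero_of_injective_algebraMap (IsFractionRing.injective ℂ[X] K)
  have hX : algebraMap ℂ[X] K X ≠ 0 := by simp [X_ne_zero]
  have H := pathFam_isKLR (n := n) κ hX hl
  have C := pathFam_isCyc (X := algebraMap ℂ[X] K X) κ hl S hn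
  have hi := pathFam_linearIndependent κ hX S hl hn
  let h : Bool → ℂ[X] := fun b => if b then Polynomial.C 2⁻¹ * X else 0
  have hs : ∀ b, shift (algebraMap ℂ[X] K X) b = algebraMap ℂ[X] K (h b) := fun b => by
    cases b
    · simp [shift, h]
    · simp only [shift, h, if_true, map_mul]
      congr 1
      refine inv_eq_of_mul_eq_one_right ?_
      rw [← map_ofNat (algebraMap ℂ[X] K) 2, ← map_mul, ← C_ofNat, ← C_mul]
      simp
  have hV : ∀ c, algebraMap K (Module.End K V) (algebraMap ℂ[X] K c) =
      algebraMap ℂ[X] (Module.End K V) c := fun c => (IsScalarTower.algebraMap_apply _ _ _ c).symm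
  simp only [hs] at C
  replace H : (pathFam κ (algebraMap ℂ[X] K X)).IsKLR (algebraMap ℂ[X] (Module.End K V) X) := by
    rw [← hV]; exact H
  replace C : (pathFam κ (algebraMap ℂ[X] K X)).IsCyc hn κ
    fun b => algebraMap ℂ[X] (Module.End K V) (h b) := by
    simp only [← hV]; exact C
  obtain ⟨D, hD⟩ := exists_independent_of_algebra H C S hl (aeval_X (0 : ℂ))
    (fun b => by
      change aeval (0 : ℂ) (h b) = 0
      cases b <;> simp [h])
    (hi.restrict_scalars (R := ℂ[X]) (by
      simpa [Algebra.smul_def] using IsFractionRing.injective ℂ[X] K))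
  exact ⟨_, _, _, D, hD⟩

end Degenerate

section Universal
variable {B : Type} [Ring B] [Algebra ℂ B] {l n : ℕ} [NeZero l]

/-- A family is universal among the complex families satisfying the cyclotomic relations. -/
structure Fam.IsUniversal (D : Fam B l n) (hn : 2 ≤ n) (κ : Bool → ZMod l) : Prop where
  klr : D.IsKLR 0
  cyc : D.IsCyc hn κ 0
  adjoin : Algebra.adjoin ℂ (Set.range D.elt) = ⊤
  lift : ∀ (A : Type) [Ring A] [Algebra ℂ A] (D' : Fam A l n), D'.IsKLR 0 → D'.IsCyc hn κ 0 →
    ∃ f : B →ₐ[ℂ] A, D.map (f : B →+* A) = D'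

namespace Fam.IsUniversal
variable {D : Fam B l n} {hn : 2 ≤ n} {κ : Bool → ZMod l} (U : D.IsUniversal hn κ)
include U

lemma klr' : D.IsKLR (algebraMap ℂ B 0) := by simpa using U.klr

lemma cyc' : D.IsCyc hn κ (fun b => algebraMap ℂ B ((0 : Bool → ℂ) b)) := by
  have : (fun b => algebraMap ℂ B ((0 : Bool → ℂ) b)) = 0 := funext fun _ => map_zero _
  rw [this]
  exact U.cyc

lemma induction {P : B → Prop} (x : B) (e : ∀ i, P (D.e i)) (y : ∀ r, P (D.y r))
    (ψ : ∀ r, P (D.ψ r)) (algebraMap : ∀ c, P (algebraMap ℂ B c))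
    (hadd : ∀ x y, P x → P y → P (x + y)) (mul : ∀ x y, P x → P y → P (x * y)) : P x := by
  have hx : x ∈ Algebra.adjoin ℂ (Set.range D.elt) := U.adjoin ▸ Algebra.mem_top
  induction hx using Algebra.adjoin_induction with
  | mem x hx =>
    obtain ⟨g | g | g, rfl⟩ := hx
    exacts [e g, y g, ψ g]
  | algebraMap c => exact algebraMap c
  | add x y _ _ h1 h2 => exact hadd x y h1 h2
  | mul x y _ _ h1 h2 => exact mul x y h1 h2

lemma linearIndependent_cell (S : Sep κ) (hl : (2 : ZMod l) ≠ 0) :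
    LinearIndependent ℂ (D.cell κ) := by
  obtain ⟨A, _, _, D', H', C', h⟩ := exists_independent S hl hn
  obtain ⟨f, rfl⟩ := U.lift A D' H' C'
  refine LinearIndependent.of_comp f.toLinearMap ?_
  rwa [show ⇑f.toLinearMap ∘ D.cell κ = (D.map (f : B →+* A)).cell κ from
    funext fun p => (D.cell_map (f : B →+* A) κ p).symm]

lemma span_cell (S : Sep κ) (hl : (2 : ZMod l) ≠ 0) :
    Submodule.span ℂ (Set.range (D.cell κ)) = ⊤ :=
  U.klr'.span_cell U.cyc' S hl U.adjoin

/-- The anti-automorphism fixing the generators. -/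
lemma exists_anti : ∃ σ : B ≃ₗ[ℂ] B, (∀ x y, σ (x * y) = σ y * σ x) ∧
    (∀ i, σ (D.e i) = D.e i) ∧ (∀ r, σ (D.y r) = D.y r) ∧ (∀ r, σ (D.ψ r) = D.ψ r) ∧
    (∀ S, σ (D.up κ S) = D.down κ S) ∧ ∀ S, σ (D.down κ S) = D.up κ S := by
  obtain ⟨f, hf⟩ := U.lift Bᵐᵒᵖ D.op (by simpa using U.klr.op (by simp)) (U.cyc.op U.klr)
  let s : B →ₗ[ℂ] B := (MulOpposite.opLinearEquiv ℂ).symm.toLinearMap ∘ₗ f.toLinearMap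
  have hs : ∀ x, s x = (f x).unop := fun _ => rfl
  have mul : ∀ x y, s (x * y) = s y * s x := fun x y => by simp [hs]
  have he : ∀ i, s (D.e i) = D.e i := fun i =>
    congrArg (fun D' : Fam Bᵐᵒᵖ l n => (D'.e i).unop) hf
  have hy : ∀ i, s (D.y i) = D.y i := fun i =>
    congrArg (fun D' : Fam Bᵐᵒᵖ l n => (D'.y i).unop) hf
  have hψ : ∀ i, s (D.ψ i) = D.ψ i := fun i =>
    congrArg (fun D' : Fam Bᵐᵒᵖ l n => (D'.ψ i).unop) hf
  have inv : Function.Involutive s := fun x => by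
    induction x using U.induction with
    | e i => rw [he, he]
    | y r => rw [hy, hy]
    | ψ r => rw [hψ, hψ]
    | algebraMap c => simp [hs]
    | hadd x y hx hy => rw [map_add, map_add, hx, hy]
    | mul x y hx hy => rw [mul, mul, hx, hy]
  have up : ∀ S, s (D.up κ S) = D.down κ S := fun S => by
    have := D.up_map (f : B →+* Bᵐᵒᵖ) κ S
    rw [hf, D.up_op] at this
    exact (congrArg MulOpposite.unop this).symm
  exact ⟨.ofInvolutive s inv, mul, he, hy, hψ, up,
    fun S => (congrArg s (up S)).symm.trans (inv _)⟩

/-- The automorphism acting on elements of degree `d` by `z ^ d`. -/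
lemma exists_scale (hl : (1 : ZMod l) ≠ 0) (z : ℂˣ) :
    ∃ φ : B →ₐ[ℂ] B, D.map (φ : B →+* B) = D.scale z :=
  U.lift B _ (U.klr.scale hl z) (U.cyc.scale z)

lemma up_homog (hl : (2 : ZMod l) ≠ 0) {z : ℂˣ} {φ : B →ₐ[ℂ] B}
    (hφ : D.map (φ : B →+* B) = D.scale z) (S : Finset (Fin n)) :
    ∃ d : ℤ, φ (D.up κ S) = (z ^ d) • D.up κ S := by
  have hg : (D.scale z).gen = D.gen.map (φ : B →+* B) := by rw [← hφ, D.gen_map]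
  refine ((U.klr.gen hl (map_zero _)).psi_homog (o := 0) (ε := 1) φ z (fun r a => ?_)
    (fun a b => -cartan l a b) (fun r a b v ha hb => ?_) (Nat.zero_add n) (map_one _) (by simp)
    (by simp) κ (word S) (length_word S)).2
  · exact (congrArg (fun G : Gens B l => G.p r a) hg).symm
  · have hψ : (D.scale z).gen.ψ r = φ (D.gen.ψ r) := congrArg (fun G : Gens B l => G.ψ r) hg
    rw [← hψ]
    by_cases hr : r < n - 1
    · lift r to Fin (n - 1) using hr
      have hscale : (D.scale z).gen.ψ r = (D.scale z).ψ r := by simp [Fam.gen]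
      rw [hscale, U.klr.gen_ψ]
      suffices h : ∀ i, (D.scale z).ψ r * (D.e i * v) =
          (z ^ (-cartan l a b)) • (D.ψ r * (D.e i * v)) by
        rw [← one_mul v, ← U.klr.sum1, Finset.sum_mul, Finset.mul_sum, Finset.mul_sum,
          Finset.smul_sum]
        exact Finset.sum_congr rfl fun i _ => h i
      intro i
      by_cases h : i (lo r) = a ∧ i (hi r) = b
      · obtain ⟨rfl, rfl⟩ := h
        exact U.klr.scale_ψ z r (by rw [← mul_assoc, U.klr.idem])
      · have : D.e i * v = 0 := by
          rcases not_and_or.1 h with h | h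
          · rw [← ha, ← mul_assoc]
            have := U.klr.e_p (lo r) a i
            rw [if_neg h] at this
            erw [this, zero_mul]
          · rw [← hb, ← mul_assoc]
            have := U.klr.e_p (hi r) b i
            rw [if_neg h] at this
            erw [this, zero_mul]
        simp [this]
    · have : (D.scale z).gen.ψ r = 0 := by simp [Fam.gen, hr]
      rw [this, U.klr.gen_ψ_out (by omega)]
      simp

lemma scale_anti {z : ℂˣ} {φ : B →ₐ[ℂ] B} (hφ : D.map (φ : B →+* B) = D.scale z) {σ : B ≃ₗ[ℂ] B}
    (mul : ∀ x y, σ (x * y) = σ y * σ x) (he : ∀ i, σ (D.e i) = D.e i)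
    (hy : ∀ r, σ (D.y r) = D.y r) (hψ : ∀ r, σ (D.ψ r) = D.ψ r) (x : B) :
    φ (σ x) = σ (φ x) := by
  have one : σ 1 = 1 := by
    rw [← U.klr.sum1, map_sum]
    exact Finset.sum_congr rfl fun i _ => he i
  have smul : ∀ (d : ℤ) (x : B), σ ((z ^ d) • x) = (z ^ d) • σ x := fun d x =>
    map_smul σ ((z ^ d : ℂˣ) : ℂ) x
  induction x using U.induction with
  | e i =>
    have : φ (D.e i) = D.e i := congrArg (fun D' : Fam B l n => D'.e i) hφ
    rw [he, this, he]
  | y r =>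
    have : φ (D.y r) = (z ^ (2 : ℤ)) • D.y r := congrArg (fun D' : Fam B l n => D'.y r) hφ
    rw [hy, this, smul, hy]
  | ψ r =>
    have : φ (D.ψ r) = ∑ i, (z ^ cdeg r i) • (D.ψ r * D.e i) :=
      congrArg (fun D' : Fam B l n => D'.ψ r) hφ
    rw [hψ, this, map_sum]
    simp only [smul, mul, he, hψ, U.klr.e_psi]
    refine Fintype.sum_bijective (· ∘ sw r)
      (Function.Involutive.bijective fun i => comp_sw_sw i r) _ _ fun i => ?_
    rw [cdeg_sw, comp_sw_sw]
  | algebraMap c => simp [Algebra.algebraMap_eq_smul_one, one]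
  | hadd x y hx hy => simp only [map_add, hx, hy]
  | mul x y hx hy => simp only [map_mul, mul, hx, hy]

end Fam.IsUniversal
end Universal

section Grading
variable {B : Type*} [Ring B] [Algebra ℂ B]

/-- The elements on which `φ` acts by `2 ^ d`. -/
def degSub (φ : B →ₐ[ℂ] B) (d : ℤ) : Submodule ℂ B :=
  Module.End.eigenspace (φ.toLinearMap : Module.End ℂ B) ((2 : ℂ) ^ d)

lemma mem_degSub {φ : B →ₐ[ℂ] B} {d : ℤ} {x : B} :
    x ∈ degSub φ d ↔ φ x = ((2 : ℂ) ^ d) • x := Module.End.mem_eigenspace_iff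

lemma mul_mem_degSub {φ : B →ₐ[ℂ] B} {c d : ℤ} {x y : B} (hx : x ∈ degSub φ c)
    (hy : y ∈ degSub φ d) : x * y ∈ degSub φ (c + d) := by
  rw [mem_degSub] at *
  rw [map_mul, hx, hy, smul_mul_smul_comm, zpow_add₀ two_ne_zero]

lemma iSupIndep_degSub (φ : B →ₐ[ℂ] B) : iSupIndep (degSub φ) := by
  refine (Module.End.eigenspaces_iSupIndep (φ.toLinearMap : Module.End ℂ B)).comp
    (f := fun d : ℤ => (2 : ℂ) ^ d) fun a b h => ?_
  have h' : ((2 : ℝ) ^ a : ℝ) = (2 : ℝ) ^ b := by exact_mod_cast congrArg Complex.re (by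
    simpa using h : (((2 : ℝ) ^ a : ℝ) : ℂ) = (((2 : ℝ) ^ b : ℝ) : ℂ))
  exact zpow_right_injective₀ two_pos (by norm_num) h'

lemma nonempty_gradedAlgebra {φ : B →ₐ[ℂ] B} (h : ⨆ d, degSub φ d = ⊤) :
    Nonempty (GradedAlgebra (degSub φ)) := by
  have hI := DirectSum.isInternal_submodule_of_iSupIndep_of_iSup_eq_top (iSupIndep_degSub φ) h
  exact ⟨{ one_mem := by simp [mem_degSub]
           mul_mem := fun _ _ _ _ => mul_mem_degSub
           toDecomposition := hI.chooseDecomposition _ }⟩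

end Grading

section Cellular
variable {B : Type} [Ring B] [Algebra ℂ B] {l n : ℕ} [NeZero l]

namespace Fam.IsUniversal
variable {D : Fam B l n} {hn : 2 ≤ n} {κ : Bool → ZMod l} (U : D.IsUniversal hn κ)
include U

lemma mul_cell (S : Sep κ) (hl : (2 : ZMod l) ≠ 0) (a : B) (lam : Bi n) (s : Std n lam) :
    ∃ r : Std n lam → ℂ, ∀ t : Std n lam,
      a * D.cell κ ⟨lam, s, t⟩ - ∑ u : Std n lam, r u • D.cell κ ⟨lam, u, t⟩ ∈
        Submodule.span ℂ {x | ∃ (mu : Bi n) (_ : biSucceq mu lam ∧ mu ≠ lam) (u v : Std n mu),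
          x = D.cell κ ⟨mu, u, v⟩} := by
  obtain ⟨z, hz, h⟩ := (U.klr'.gen hl rfl).mul_psi (U.cyc'.cyc0 U.klr') S
    (U.klr'.adjoin_gens U.adjoin) hl a (length_word s.1)
  have hz' : z ∈ Submodule.span ℂ (Set.range fun u : Std n lam => D.up κ u.1) := by
    refine Submodule.span_mono ?_ hz
    rintro _ ⟨u, hu, hh, rfl⟩
    obtain ⟨u, rfl⟩ := exists_std_of_height u hu (hh.trans (height_word s))
    exact ⟨u, rfl⟩
  obtain ⟨r, rfl⟩ := (Submodule.mem_span_range_iff_exists_fun ℂ).1 hz'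
  refine ⟨r, fun t => ?_⟩
  have := D.cell_le κ _ (h (D.down κ t.1))
  rw [height_word, mul_assoc, Finset.sum_mul] at this
  simp only [smul_mul_assoc] at this
  refine Submodule.span_mono ?_ this
  rintro _ ⟨mu, hmu, u, v, rfl⟩
  exact ⟨mu, ⟨.inl hmu, fun e => by simp [e] at hmu⟩, u, v, rfl⟩

theorem graded_cellular (S : Sep κ) (hl : (2 : ZMod l) ≠ 0) (hl1 : (1 : ZMod l) ≠ 0) :
    ∃ 𝒜 : ℤ → Submodule ℂ B,
      Nonempty (GradedAlgebra 𝒜) ∧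
      (∀ i : Res l n, D.e i ∈ 𝒜 0) ∧
      (∀ r : Fin n, D.y r ∈ 𝒜 2) ∧
      (∀ (r : Fin (n - 1)) (i : Res l n),
        D.ψ r * D.e i ∈ 𝒜 (-(cartan l (i (lo r)) (i (hi r))))) ∧
      ∃ (c : (lam : Bi n) → Std n lam → Std n lam → B) (dg : (lam : Bi n) → Std n lam → ℤ),
        (∀ (lam : Bi n) (s t : Std n lam), c lam s t ∈ 𝒜 (dg lam s + dg lam t)) ∧
        LinearIndependent ℂ
          (fun p : Σ lam : Bi n, Std n lam × Std n lam => c p.1 p.2.1 p.2.2) ∧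
        Submodule.span ℂ
          (Set.range (fun p : Σ lam : Bi n, Std n lam × Std n lam => c p.1 p.2.1 p.2.2)) = ⊤ ∧
        (∃ σ : B ≃ₗ[ℂ] B, (∀ x y, σ (x * y) = σ y * σ x) ∧
          ∀ (lam : Bi n) (s t : Std n lam), σ (c lam s t) = c lam t s) ∧
        (∀ (a : B) (lam : Bi n) (s : Std n lam),
          ∃ r : Std n lam → ℂ, ∀ t : Std n lam,
            a * c lam s t - ∑ u : Std n lam, r u • c lam u t ∈
              Submodule.span ℂ
                {x | ∃ (mu : Bi n) (_ : biSucceq mu lam ∧ mu ≠ lam)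
                    (u v : Std n mu), x = c mu u v}) := by
  let z : ℂˣ := Units.mk0 2 two_ne_zero
  have hz : ∀ (d : ℤ) (x : B), (z ^ d) • x = ((2 : ℂ) ^ d) • x := fun d x => by
    rw [Units.smul_def, Units.val_zpow_eq_zpow_val]; rfl
  obtain ⟨φ, hφ⟩ := U.exists_scale hl1 z
  obtain ⟨σ, mul, he, hy, hψ, hu, hd⟩ := U.exists_anti
  choose dg hdg using U.up_homog hl hφ
  have hup : ∀ T, D.up κ T ∈ degSub φ (dg T) := fun T => mem_degSub.2 ((hdg T).trans (hz _ _))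
  have hdown : ∀ T, D.down κ T ∈ degSub φ (dg T) := fun T => by
    rw [mem_degSub, ← hu, U.scale_anti hφ mul he hy hψ, mem_degSub.1 (hup T), map_smul]
  have hcell : ∀ p : Idx n, D.cell κ p ∈ degSub φ (dg p.2.1.1 + dg p.2.2.1) := fun p =>
    mul_mem_degSub (hup _) (hdown _)
  have htop : ⨆ d, degSub φ d = ⊤ := by
    rw [eq_top_iff, ← U.span_cell S hl, Submodule.span_le]
    rintro _ ⟨p, rfl⟩
    exact Submodule.mem_iSup_of_mem _ (hcell p)
  refine ⟨degSub φ, nonempty_gradedAlgebra htop, fun i => ?_, fun r => ?_, fun r i => ?_,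
    fun lam s t => D.cell κ ⟨lam, s, t⟩, fun _ s => dg s.1, fun lam s t => hcell ⟨lam, s, t⟩,
    U.linearIndependent_cell S hl, U.span_cell S hl, ⟨σ, mul, fun lam s t => ?_⟩,
    U.mul_cell S hl⟩
  · have : φ (D.e i) = D.e i := congrArg (fun D' : Fam B l n => D'.e i) hφ
    simpa [mem_degSub] using this
  · have : φ (D.y r) = (z ^ (2 : ℤ)) • D.y r := congrArg (fun D' : Fam B l n => D'.y r) hφ
    exact mem_degSub.2 (this.trans (hz _ _))
  · have h1 : φ (D.e i) = D.e i := congrArg (fun D' : Fam B l n => D'.e i) hφ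
    have h2 : φ (D.ψ r) = (D.scale z).ψ r := congrArg (fun D' : Fam B l n => D'.ψ r) hφ
    rw [mem_degSub, map_mul, h1, h2, U.klr.scale_ψ z r (U.klr.idem i), hz]
    rfl
  · refine (mul _ _).trans ?_
    rw [hu, hd]
    rfl

end Fam.IsUniversal

lemma kap_sep {m k : ℤ} (hm0 : (m : ZMod l) ≠ 0) (hm1 : (m : ZMod l) ≠ 1)
    (hmm1 : (m : ZMod l) ≠ -1) (hk : ((2 * k : ℤ) : ZMod l) = (m : ZMod l)) : Sep (kap l k) := by
  push_cast at hk
  rintro (_ | _) <;> refine ⟨fun h => ?_, fun h => ?_⟩ <;>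
    simp only [kap, Bool.not_true, Bool.not_false, if_true, Bool.false_eq_true, if_false] at h
  · exact hm0 (by linear_combination -hk - h)
  · exact hmm1 (by linear_combination -hk - h)
  · exact hm0 (by linear_combination -hk + h)
  · exact hm1 (by linear_combination -hk + h)

lemma two_ne_zero_zmod {l : ℕ} (hl : 3 ≤ l) : (2 : ZMod l) ≠ 0 := fun h => by
  have h2 : ((2 : ℕ) : ZMod l) = 0 := by exact_mod_cast h
  have := Nat.le_of_dvd two_pos ((ZMod.natCast_eq_zero_iff 2 l).1 h2)
  omega

lemma one_ne_zero_zmod {l : ℕ} (hl : 3 ≤ l) : (1 : ZMod l) ≠ 0 := fun h =>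
  two_ne_zero_zmod hl (by linear_combination 2 * h)

lemma bfam_isUniversal (k : ℤ) (hn : 2 ≤ n) :
    (bfam l n (Lam2 l k) (badSet2 l n k hn)).IsUniversal hn (kap l k) where
  klr := bfam_isKLR _ _
  cyc := bfam_isCyc k hn
  adjoin := bfam_adjoin _ _
  lift _ _ _ _ H C := exists_blob_lift H C

end Cellular

/-- The quotient `B_n` of the level-two cyclotomic KLR algebra by the
two-sided ideal generated by the idempotents `e(i)` with `(i₁,i₂) ≡ (k,k-1)` or
`(-k,-k-1) (mod l)` (isomorphic to the blob algebra `b_n(m)`), with its induced `ℤ`-grading,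
is a graded cellular algebra with respect to the poset `(bi(n), ⪰)` of one-line bipartitions
and index sets `T(λ) = Std(λ)`:  there exist homogeneous elements `ψ_{st}` forming a graded
cellular basis of `B_n` with `deg ψ_{st} = deg s + deg t` for a degree function
`deg : Std(n) → ℤ`. -/
theorem statement1 (l : ℕ) [NeZero l] (hl : 3 ≤ l) (hodd : Odd l)
    (q : ℂ) (hq : IsPrimitiveRoot q l)
    (m k : ℤ) (hm0 : (m : ZMod l) ≠ 0) (hm1 : (m : ZMod l) ≠ 1) (hmm1 : (m : ZMod l) ≠ -1)
    (hk : ((2 * k : ℤ) : ZMod l) = (m : ZMod l))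
    (n : ℕ) (hn : 2 ≤ n) :
    ∃ 𝒜 : ℤ → Submodule ℂ (BQuot l n (Lam2 l k) (badSet2 l n k hn)),
      Nonempty (GradedAlgebra 𝒜) ∧
      -- the grading is the one induced from the KLR grading
      (∀ i : Res l n, bmk l n (Lam2 l k) (badSet2 l n k hn) (eG l n i) ∈ 𝒜 0) ∧
      (∀ r : Fin n, bmk l n (Lam2 l k) (badSet2 l n k hn) (yG l n r) ∈ 𝒜 2) ∧
      (∀ (r : Fin (n - 1)) (i : Res l n),
        bmk l n (Lam2 l k) (badSet2 l n k hn) (pG l n r * eG l n i) ∈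
          𝒜 (-(cartan l (i (lo r)) (i (hi r))))) ∧
      -- a graded cellular basis
      ∃ (c : (lam : Bi n) → Std n lam → Std n lam → BQuot l n (Lam2 l k) (badSet2 l n k hn))
        (dg : (lam : Bi n) → Std n lam → ℤ),
        -- each ψ_{st} is homogeneous of degree `deg s + deg t`
        (∀ (lam : Bi n) (s t : Std n lam), c lam s t ∈ 𝒜 (dg lam s + dg lam t)) ∧
        -- the ψ_{st} form a basis
        LinearIndependent ℂ
          (fun p : Σ lam : Bi n, Std n lam × Std n lam => c p.1 p.2.1 p.2.2) ∧
        Submodule.span ℂ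
          (Set.range (fun p : Σ lam : Bi n, Std n lam × Std n lam => c p.1 p.2.1 p.2.2)) = ⊤ ∧
        -- the linear map `ψ_{st} ↦ ψ_{ts}` is an algebra anti-automorphism
        (∃ σ : BQuot l n (Lam2 l k) (badSet2 l n k hn) ≃ₗ[ℂ]
            BQuot l n (Lam2 l k) (badSet2 l n k hn),
          (∀ x y, σ (x * y) = σ y * σ x) ∧
          ∀ (lam : Bi n) (s t : Std n lam), σ (c lam s t) = c lam t s) ∧
        -- the cellular multiplication property
        (∀ (a : BQuot l n (Lam2 l k) (badSet2 l n k hn)) (lam : Bi n) (s : Std n lam),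
          ∃ r : Std n lam → ℂ, ∀ t : Std n lam,
            a * c lam s t - ∑ u : Std n lam, r u • c lam u t ∈
              Submodule.span ℂ
                {x | ∃ (mu : Bi n) (_ : biSucceq mu lam ∧ mu ≠ lam)
                    (u v : Std n mu), x = c mu u v}) := by
  obtain ⟨𝒜, h1, h2, h3, h4, h5⟩ := (bfam_isUniversal k hn).graded_cellular
    (kap_sep hm0 hm1 hmm1 hk) (two_ne_zero_zmod hl) (one_ne_zero_zmod hl)
  exact ⟨𝒜, h1, h2, h3, fun r i => by rw [map_mul]; exact h4 r i, h5⟩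

end Statement1
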